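/- Fix an integer r ≥ 3, reals ε > 0 and K ≥ 1, and a function δ : ℕ → (0,∞) with δ(n) → 0. Then there exists C > 0 such that for every k > 0 there is n₀ with the following property: for all n ≥ n₀ divisible by r and all integers m with (1+ε)(n/r)·log n < m ≤ C(n,r), P( H^r_{n,m} satisfies A(δ(n)) and R(δ(n),K) but does not satisfy B(C) ) ≤ n^{−k}. -/

import Mathlib

open Finset

/-- The set of perfect matchings of the `r`-graph `G` on vertex set `W`. -/
def pmSet (W : Finset ℕ) (G : Finset (Finset ℕ)) : Finset (Finset (Finset ℕ)) :=
  G.powerset.filter (fun M => (∀ A ∈ M, ∀ B ∈ M, A ≠ B → A ∩ B = ∅) ∧ M.biUnion id = W)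

/-- The number of perfect matchings of `G` (denoted `Φ(G)`). -/
def pmCount (W : Finset ℕ) (G : Finset (Finset ℕ)) : ℕ := (pmSet W G).card

/-- All `r`-element subsets of `[n]`. -/
def Kn (n r : ℕ) : Finset (Finset ℕ) := Finset.powersetCard r (Finset.range n)

/-- `G − Z`: the set of edges of `G` disjoint from `Z`. -/
def minus (G : Finset (Finset ℕ)) (Z : Finset ℕ) : Finset (Finset ℕ) :=
  G.filter (fun A => A ∩ Z = ∅)

/-- `Φ(G − Z)`, with `G − Z` regarded as an `r`-graph on `W \ Z`. -/
def phiSub (W : Finset ℕ) (G : Finset (Finset ℕ)) (Z : Finset ℕ) : ℕ :=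
  pmCount (W \ Z) (minus G Z)

/-- Degree of `x` in `G`. -/
def deg (G : Finset (Finset ℕ)) (x : ℕ) : ℕ := (G.filter (fun A => x ∈ A)).card

/-- Codegree of `x, y` in `G`. -/
def codeg (G : Finset (Finset ℕ)) (x y : ℕ) : ℕ :=
  (G.filter (fun A => x ∈ A ∧ y ∈ A)).card

/-- Average degree `D_G = r|G|/|W|`. -/
noncomputable def avgDeg (r : ℕ) (W : Finset ℕ) (G : Finset (Finset ℕ)) : ℝ :=
  ((r : ℝ) * G.card) / W.card

/-- Property `R(δ,K)`: all but at most `δ|W|` vertices have degree `(1±δ)D_G`,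
every degree lies in `[D_G/K, K·D_G]`, and all codegrees are at most `δ·D_G`. -/
def propR (r : ℕ) (W : Finset ℕ) (G : Finset (Finset ℕ)) (δ K : ℝ) : Prop :=
  ((W.filter (fun x =>
      ¬((1 - δ) * avgDeg r W G ≤ (deg G x : ℝ) ∧
        (deg G x : ℝ) ≤ (1 + δ) * avgDeg r W G))).card : ℝ) ≤ δ * W.card ∧
  (∀ x ∈ W, (deg G x : ℝ) ≤ K * avgDeg r W G ∧ avgDeg r W G / K ≤ (deg G x : ℝ)) ∧
  ∀ x ∈ W, ∀ y ∈ W, x ≠ y → (codeg G x y : ℝ) ≤ δ * avgDeg r W G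

/-- Property `E(σ)`: all but at most `σ|G|` edges `A` satisfy
`Φ(G−A) = (1±σ)Φ(G)/D_G`. -/
def propE (r : ℕ) (W : Finset ℕ) (G : Finset (Finset ℕ)) (σ : ℝ) : Prop :=
  ((G.filter (fun A =>
      ¬((1 - σ) * (pmCount W G : ℝ) / avgDeg r W G ≤ (phiSub W G A : ℝ) ∧
        (phiSub W G A : ℝ) ≤ (1 + σ) * (pmCount W G : ℝ) / avgDeg r W G))).card : ℝ) ≤
    σ * G.card

/-- Property `F(σ)`: all but at most `σ·C(|W|,r)` of the `r`-subsets `U` of `W`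
satisfy `Φ(G−U) = (1±σ)Φ(G)/D_G`. -/
def propF (r : ℕ) (W : Finset ℕ) (G : Finset (Finset ℕ)) (σ : ℝ) : Prop :=
  (((Finset.powersetCard r W).filter (fun U =>
      ¬((1 - σ) * (pmCount W G : ℝ) / avgDeg r W G ≤ (phiSub W G U : ℝ) ∧
        (phiSub W G U : ℝ) ≤ (1 + σ) * (pmCount W G : ℝ) / avgDeg r W G))).card : ℝ) ≤
    σ * (W.card.choose r)

/-- Property `C(δ,σ)`: for every `r`-subset `Z` of `W` with
`Φ(G−Z) ≥ Φ(G)e^{−δ|W|}` and every `x ∈ Z`, all but at most `σ|W|` vertices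
`y ∈ W∖Z` satisfy `Φ(G−((Z∖{x})∪{y})) ≥ (1−σ)·Φ(G−Z)·d_G(x)/D_G`. -/
def propC (r : ℕ) (W : Finset ℕ) (G : Finset (Finset ℕ)) (δ σ : ℝ) : Prop :=
  ∀ Z ∈ Finset.powersetCard r W,
    (pmCount W G : ℝ) * Real.exp (-δ * W.card) ≤ (phiSub W G Z : ℝ) →
    ∀ x ∈ Z,
      (((W \ Z).filter (fun y =>
          ¬((1 - σ) * (phiSub W G Z : ℝ) * (deg G x : ℝ) / avgDeg r W G ≤
            (phiSub W G (insert y (Z.erase x)) : ℝ)))).card : ℝ) ≤ σ * W.card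

/-- Property `B(C)`: `Φ(G−A) ≤ C·Φ(G)/D_G` for every edge `A ∈ G`. -/
def propB (r : ℕ) (W : Finset ℕ) (G : Finset (Finset ℕ)) (C : ℝ) : Prop :=
  ∀ A ∈ G, (phiSub W G A : ℝ) ≤ C * (pmCount W G : ℝ) / avgDeg r W G

/-- Property `A(δ)` for an `r`-graph `H` on `[n]` with `m` edges:
`log Φ(H) > log Φ₀ − ∑_{i=1}^{t} γ_i − δn`, where `t = C(n,r) − m`,
`γ_i = (n/r)/(C(n,r)−i+1)`, and `Φ₀ = n!/((n/r)!·(r!)^{n/r})`. -/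
def propA (r n : ℕ) (H : Finset (Finset ℕ)) (δ : ℝ) : Prop :=
  Real.log ((n.factorial : ℝ) /
      ((Nat.factorial (n / r) : ℝ) * (Nat.factorial r : ℝ) ^ (n / r)))
    - (∑ i ∈ Finset.Icc 1 (n.choose r - H.card),
        ((n : ℝ) / r) / ((n.choose r : ℝ) - (i : ℝ) + 1))
    - δ * n < Real.log (pmCount (Finset.range n) H)



section paths
variable {α : Type*} [DecidableEq α]

def paths : ℕ → Finset α → Finset (List α)
  | 0, _ => {[]}
  | s + 1, G => G.biUnion fun a => (paths s (G.erase a)).image (List.cons a)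

lemma sum_paths_succ (s : ℕ) (G : Finset α) (ψ : List α → ℝ) :
    ∑ l ∈ paths (s + 1) G, ψ l = ∑ a ∈ G, ∑ l ∈ paths s (G.erase a), ψ (a :: l) := by
  rw [paths, Finset.sum_biUnion]
  · refine Finset.sum_congr rfl fun a _ => ?_
    rw [Finset.sum_image]
    intro x _ y _ h
    exact (List.cons.inj h).2
  · intro a _ b _ hab
    rw [Function.onFun, Finset.disjoint_left]
    intro l hl hl'
    simp only [Finset.mem_image] at hl hl'
    obtain ⟨x, _, rfl⟩ := hl
    obtain ⟨y, _, h⟩ := hl'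
    exact hab (List.cons.inj h).1.symm

lemma card_paths (s : ℕ) (G : Finset α) :
    ((paths s G).card : ℝ) = (G.card.descFactorial s : ℝ) := by
  induction s generalizing G with
  | zero => simp [paths]
  | succ s ih =>
    have h := sum_paths_succ s G (fun _ => (1 : ℝ))
    simp only [Finset.sum_const, nsmul_eq_mul, mul_one] at h
    rw [h, Finset.sum_congr rfl (g := fun _ => ((G.card - 1).descFactorial s : ℝ))]
    · rw [Finset.sum_const, nsmul_eq_mul]
      rcases Nat.eq_zero_or_pos G.card with h0 | h0
      · simp [h0]
      · obtain ⟨k, hk⟩ := Nat.exists_eq_succ_of_ne_zero h0.ne'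
        rw [hk, Nat.succ_descFactorial_succ]
        simp
    · intro a ha
      rw [ih, Finset.card_erase_of_mem ha]

lemma mem_paths_cons {s : ℕ} {G : Finset α} {a : α} {l : List α} :
    a :: l ∈ paths (s + 1) G ↔ a ∈ G ∧ l ∈ paths s (G.erase a) := by
  simp only [paths, Finset.mem_biUnion, Finset.mem_image]
  constructor
  · rintro ⟨b, hb, x, hx, h⟩
    obtain ⟨rfl, rfl⟩ := List.cons.inj h
    exact ⟨hb, hx⟩
  · rintro ⟨h1, h2⟩
    exact ⟨a, h1, l, h2, rfl⟩

lemma length_paths {s : ℕ} {G : Finset α} {l : List α} (h : l ∈ paths s G) : l.length = s := by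
  induction s generalizing G l with
  | zero => simp [paths] at h; simp [h]
  | succ s ih =>
    cases l with
    | nil => simp [paths] at h
    | cons a l =>
      rw [mem_paths_cons] at h
      simp [ih h.2]

lemma subset_paths {s : ℕ} {G : Finset α} {l : List α} (h : l ∈ paths s G) :
    l.toFinset ⊆ G := by
  induction s generalizing G l with
  | zero => simp [paths] at h; simp [h]
  | succ s ih =>
    cases l with
    | nil => simp
    | cons a l =>
      rw [mem_paths_cons] at h
      rw [List.toFinset_cons]
      exact Finset.insert_subset h.1 ((ih h.2).trans (Finset.erase_subset _ _))

lemma paths_full {s : ℕ} {G : Finset α} {l : List α} (h : l ∈ paths s G) (hs : G.card = s) :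
    l.toFinset = G := by
  induction s generalizing G l with
  | zero =>
    simp [paths] at h
    rw [Finset.card_eq_zero] at hs
    simp [h, hs]
  | succ s ih =>
    cases l with
    | nil => simp [paths] at h
    | cons a l =>
      rw [mem_paths_cons] at h
      rw [List.toFinset_cons, ih h.2 (by rw [Finset.card_erase_of_mem h.1, hs]; rfl),
        Finset.insert_erase h.1]

/-- probability that the first `j` of a random path in an `m`-set avoid a fixed `f`-set -/
noncomputable def avoidP (j f m : ℕ) : ℝ :=
  ∏ t ∈ range j, (((m - t - f : ℕ) : ℝ) / ((m - t : ℕ) : ℝ))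

lemma avoidP_nonneg (j f m : ℕ) : 0 ≤ avoidP j f m :=
  Finset.prod_nonneg fun _ _ => by positivity

lemma sum_avoid (s : ℕ) (G F : Finset α) (j : ℕ) (hF : F ⊆ G) (hj : j ≤ s) (hs : s ≤ G.card) :
    ∑ l ∈ paths s G, (if Disjoint F (l.take j).toFinset then (1 : ℝ) else 0)
      = avoidP j F.card G.card * (paths s G).card := by
  induction s generalizing G j with
  | zero =>
    obtain rfl : j = 0 := by omega
    simp [paths, avoidP]
  | succ s ih =>
    cases j with
    | zero => simp [avoidP]
    | succ j =>
      rw [sum_paths_succ]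
      have key : ∀ a ∈ G, ∑ l ∈ paths s (G.erase a),
          (if Disjoint F (List.take (j + 1) (a :: l)).toFinset then (1 : ℝ) else 0)
          = if a ∈ F then 0 else avoidP j F.card (G.card - 1) *
            ((G.card - 1).descFactorial s : ℝ) := by
        intro a ha
        split_ifs with haF
        · apply Finset.sum_eq_zero
          intro l _
          rw [if_neg]
          rw [Finset.not_disjoint_iff]
          exact ⟨a, haF, by simp⟩
        · have h2 := ih (G.erase a) j (fun x hx => Finset.mem_erase.2
            ⟨fun h => haF (h ▸ hx), hF hx⟩) (by omega)
            (by rw [Finset.card_erase_of_mem ha]; omega)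
          rw [card_paths, Finset.card_erase_of_mem ha] at h2
          rw [← h2]
          refine Finset.sum_congr rfl fun l _ => ?_
          congr 1
          simp only [List.take_succ_cons, List.toFinset_cons, Finset.disjoint_insert_right]
          simp [haF]
      rw [Finset.sum_congr rfl key, Finset.sum_ite, Finset.sum_const_zero, zero_add,
        Finset.sum_const, nsmul_eq_mul, card_paths]
      have hc : (G.filter (fun x => x ∉ F)).card = G.card - F.card := by
        rw [← Finset.card_sdiff_of_subset hF]; congr 1; ext; simp
      rw [hc]
      unfold avoidP
      rw [Finset.prod_range_succ']
      obtain ⟨k, hk⟩ : ∃ k, G.card = k + 1 := ⟨G.card - 1, by omega⟩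
      rw [hk]
      simp only [Nat.add_sub_cancel, Nat.sub_zero, Nat.succ_descFactorial_succ]
      have : ∀ t, k + 1 - (t + 1) = k - t := fun t => by omega
      simp only [this]
      push_cast
      field_simp

lemma reversal (m : ℕ) (Ω : Finset α) (φ : Finset α → α → ℝ) :
    ∑ G ∈ powersetCard (m + 1) Ω, ∑ a ∈ G, φ (G.erase a) a
      = ∑ G ∈ powersetCard m Ω, ∑ a ∈ Ω \ G, φ G a := by
  rw [Finset.sum_sigma', Finset.sum_sigma']
  refine Finset.sum_bij' (fun x _ => ⟨x.1.erase x.2, x.2⟩) (fun x _ => ⟨insert x.2 x.1, x.2⟩)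
    ?_ ?_ ?_ ?_ ?_
  · rintro ⟨G, a⟩ h
    simp only [mem_sigma, mem_powersetCard, mem_sdiff] at h ⊢
    refine ⟨⟨(erase_subset _ _).trans h.1.1, ?_⟩, h.1.1 h.2, by simp⟩
    rw [card_erase_of_mem h.2, h.1.2]; rfl
  · rintro ⟨G, a⟩ h
    simp only [mem_sigma, mem_powersetCard, mem_sdiff] at h ⊢
    refine ⟨⟨insert_subset h.2.1 h.1.1, ?_⟩, by simp⟩
    rw [card_insert_of_notMem h.2.2, h.1.2]
  · rintro ⟨G, a⟩ h
    simp only [mem_sigma] at h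
    simp [insert_erase h.2]
  · rintro ⟨G, a⟩ h
    simp only [mem_sigma, mem_sdiff] at h
    simp [erase_insert h.2.2]
  · intros; rfl

/-- multiplicative functional along a deletion path -/
noncomputable def mulF (q : Finset α → α → ℝ) : Finset α → List α → ℝ
  | _, [] => 1
  | G, a :: l => q G a * mulF q (G.erase a) l

noncomputable def addF (b : Finset α → ℝ) : Finset α → List α → ℝ
  | _, [] => 0
  | G, a :: l => b (G.erase a) + addF b (G.erase a) l

lemma addF_eq (b : Finset α → ℝ) (G : Finset α) (l : List α) :
    addF b G l = ∑ j ∈ range l.length, b (G \ (l.take (j + 1)).toFinset) := by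
  induction l generalizing G with
  | nil => simp [addF]
  | cons a l ih =>
    rw [addF, ih, List.length_cons, Finset.sum_range_succ', add_comm]
    congr 1
    · refine Finset.sum_congr rfl fun j _ => ?_
      congr 1
      ext x; simp; tauto
    · congr 1
      ext x; simp; tauto

lemma mulF_nonneg (q : Finset α → α → ℝ) (hq : ∀ G a, 0 ≤ q G a) (G : Finset α) (l : List α) :
    0 ≤ mulF q G l := by
  induction l generalizing G with
  | nil => simp [mulF]
  | cons a l ih => exact mul_nonneg (hq _ _) (ih _)

/-- backward bound -/
lemma mulF_backward (ρ : Finset α → α → ℝ) (hρ : ∀ G a, 0 ≤ ρ G a) (σ : ℝ) (hσ : 0 ≤ σ)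
    (h : ∀ G, ∑ a ∈ G, ρ G a ≤ G.card * (1 + σ)) (s : ℕ) (G : Finset α) :
    ∑ l ∈ paths s G, mulF ρ G l ≤ (1 + σ) ^ s * G.card.descFactorial s := by
  induction s generalizing G with
  | zero => simp [paths, mulF]
  | succ s ih =>
    rw [sum_paths_succ]
    simp only [mulF]
    simp_rw [← Finset.mul_sum]
    calc ∑ a ∈ G, ρ G a * ∑ l ∈ paths s (G.erase a), mulF ρ (G.erase a) l
        ≤ ∑ a ∈ G, ρ G a * ((1 + σ) ^ s * (G.card - 1).descFactorial s) := by
          refine Finset.sum_le_sum fun a ha => mul_le_mul_of_nonneg_left ?_ (hρ _ _)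
          have := ih (G.erase a)
          rwa [card_erase_of_mem ha] at this
      _ = (∑ a ∈ G, ρ G a) * ((1 + σ) ^ s * (G.card - 1).descFactorial s) := by
          rw [Finset.sum_mul]
      _ ≤ (G.card * (1 + σ)) * ((1 + σ) ^ s * (G.card - 1).descFactorial s) := by
          exact mul_le_mul_of_nonneg_right (h G) (by positivity)
      _ = (1 + σ) ^ (s + 1) * G.card.descFactorial (s + 1) := by
          rcases Nat.eq_zero_or_pos G.card with h0 | h0
          · simp [h0]
          · obtain ⟨k, hk⟩ := Nat.exists_eq_succ_of_ne_zero h0.ne'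
            rw [hk, Nat.succ_descFactorial_succ]
            simp
            ring

/-- forward bound -/
lemma mulF_forward (Ω : Finset α) (q : Finset α → α → ℝ) (hq : ∀ G a, 0 ≤ q G a)
    (h : ∀ G ⊆ Ω, ∑ a ∈ Ω \ G, q G a ≤ (Ω \ G).card) (s m : ℕ) :
    ∑ G ∈ powersetCard m Ω, ∑ l ∈ paths s G, mulF (fun G a => q (G.erase a) a) G l
      ≤ Ω.card.choose m * m.descFactorial s := by
  induction s generalizing m with
  | zero => simp [paths, mulF]
  | succ s ih =>
    cases m with
    | zero => simp [paths]
    | succ m =>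
      simp_rw [sum_paths_succ, mulF, ← Finset.mul_sum]
      rw [reversal m Ω (fun G a => q G a * ∑ l ∈ paths s G, mulF (fun G a => q (G.erase a) a) G l)]
      simp_rw [← Finset.sum_mul]
      calc ∑ G ∈ powersetCard m Ω, (∑ a ∈ Ω \ G, q G a) *
              ∑ l ∈ paths s G, mulF (fun G a => q (G.erase a) a) G l
          ≤ ∑ G ∈ powersetCard m Ω, ((Ω.card - m : ℕ) : ℝ) *
              ∑ l ∈ paths s G, mulF (fun G a => q (G.erase a) a) G l := by
            refine Finset.sum_le_sum fun G hG => mul_le_mul_of_nonneg_right ?_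
              (Finset.sum_nonneg fun l _ => mulF_nonneg _ (fun _ _ => hq _ _) _ _)
            rw [mem_powersetCard] at hG
            have := h G hG.1
            rwa [card_sdiff_of_subset hG.1, hG.2] at this
        _ ≤ ((Ω.card - m : ℕ) : ℝ) * (Ω.card.choose m * m.descFactorial s) := by
            rw [← Finset.mul_sum]
            exact mul_le_mul_of_nonneg_left (ih m) (by positivity)
        _ = _ := by
            rw [Nat.succ_descFactorial_succ]
            have := Nat.choose_succ_right_eq Ω.card m
            have h2 : (Ω.card.choose (m + 1) : ℝ) * (m + 1 : ℝ)
              = Ω.card.choose m * ((Ω.card - m : ℕ) : ℝ) := by exact_mod_cast this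
            push_cast
            linear_combination (-(m.descFactorial s : ℝ)) * h2

open scoped Classical in
/-- fraction of non-members of `G` in `Ω` which are bad for `G` -/
noncomputable def badFrac (Ω : Finset α) (bad : Finset α → α → Prop) (G : Finset α) : ℝ :=
  ((Ω \ G).filter (fun a => bad G a)).card / (Ω \ G).card

open scoped Classical in
def eGood (bad : Finset α → α → Prop) (σ : ℝ) (G : Finset α) : Prop :=
  ((G.filter (fun a => bad G a)).card : ℝ) ≤ σ * G.card

open scoped Classical in
lemma chain_pathwise (Ω : Finset α) (bad : Finset α → α → Prop) (σ : ℝ)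
    (hb : ∀ G a, a ∈ G → bad (G.erase a) a → bad G a) (s : ℕ) (G : Finset α) (l : List α)
    (hl : l ∈ paths s G) (hg : ∀ G', G \ l.toFinset ⊆ G' → G' ⊆ G → eGood bad σ G') :
    Real.exp (addF (badFrac Ω bad) G l / 2) ≤
    mulF (fun G a => (if bad (G.erase a) a then (1 / 2 : ℝ) else 1) *
        Real.exp (badFrac Ω bad (G.erase a) / 2)) G l *
      mulF (fun G a => if eGood bad σ G ∧ bad G a then (2 : ℝ) else 1) G l := by
  induction l generalizing G s with
  | nil => simp [addF, mulF]
  | cons a l ih =>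
    cases s with
    | zero => simp [paths] at hl
    | succ s =>
      rw [mem_paths_cons] at hl
      have h1 := ih s (G.erase a) hl.2 (fun G' h h' => hg G' (by
        intro x hx; apply h; simp at hx ⊢; tauto) (h'.trans (erase_subset _ _)))
      have h2 : eGood bad σ G := hg G sdiff_subset (Subset.refl _)
      simp only [addF, mulF]
      rw [add_div, Real.exp_add]
      set A := mulF (fun G a => (if bad (G.erase a) a then (1 / 2 : ℝ) else 1) *
        Real.exp (badFrac Ω bad (G.erase a) / 2)) (G.erase a) l
      set B := mulF (fun G a => if eGood bad σ G ∧ bad G a then (2 : ℝ) else 1) (G.erase a) l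
      have h3 : (1 : ℝ) ≤ (if bad (G.erase a) a then (1 / 2 : ℝ) else 1) *
          (if eGood bad σ G ∧ bad G a then (2 : ℝ) else 1) := by
        by_cases c1 : bad (G.erase a) a
        · have := hb G a hl.1 c1
          simp [c1, this, h2]
        · simp only [c1, if_false]
          split_ifs <;> norm_num
      have hAB : 0 ≤ A * B := le_trans (Real.exp_pos _).le h1
      calc _ ≤ Real.exp (badFrac Ω bad (G.erase a) / 2) * (A * B) :=
            mul_le_mul_of_nonneg_left h1 (Real.exp_pos _).le
        _ ≤ ((if bad (G.erase a) a then (1 / 2 : ℝ) else 1) *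
          (if eGood bad σ G ∧ bad G a then (2 : ℝ) else 1)) *
          (Real.exp (badFrac Ω bad (G.erase a) / 2) * (A * B)) :=
            le_mul_of_one_le_left (mul_nonneg (Real.exp_pos _).le hAB) h3
        _ = _ := by ring

open scoped Classical in
/-- The chain lemma. -/
lemma chain_lemma (Ω : Finset α) (bad : Finset α → α → Prop) (σ : ℝ) (hσ : 0 ≤ σ)
    (hb : ∀ G a, a ∈ G → bad (G.erase a) a → bad G a) (s m : ℕ) (β : ℝ) :
    ∑ G ∈ powersetCard m Ω, (((paths s G).filter (fun l =>
        (∀ G', G \ l.toFinset ⊆ G' → G' ⊆ G → eGood bad σ G') ∧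
        β * s ≤ addF (badFrac Ω bad) G l)).card : ℝ)
      ≤ Real.exp (-(β * s / 4)) * (1 + (1 + σ) ^ s) * (Ω.card.choose m * m.descFactorial s) := by
  set q : Finset α → α → ℝ := fun G a => (if bad G a then (1 / 2 : ℝ) else 1) *
        Real.exp (badFrac Ω bad G / 2) with hqdef
  set ρ : Finset α → α → ℝ := fun G a => if eGood bad σ G ∧ bad G a then (2 : ℝ) else 1 with hρdef
  have hq0 : ∀ G a, 0 ≤ q G a := fun G a => by
    simp only [hqdef]; split_ifs <;> positivity
  have hρ0 : ∀ G a, 0 ≤ ρ G a := fun G a => by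
    simp only [hρdef]; split_ifs <;> positivity
  have hQ := mulF_forward Ω q hq0 (by
    intro G hG
    simp only [hqdef]
    rw [← Finset.sum_mul]
    have e1 : ∑ a ∈ Ω \ G, (if bad G a then (1 / 2 : ℝ) else 1)
        = (Ω \ G).card - (((Ω \ G).filter (fun a => bad G a)).card : ℝ) / 2 := by
      have : ∀ a ∈ Ω \ G, (if bad G a then (1 / 2 : ℝ) else 1)
        = 1 - (if bad G a then (1 : ℝ) else 0) / 2 := by
        intro a _; split_ifs <;> norm_num
      rw [Finset.sum_congr rfl this, Finset.sum_sub_distrib, ← Finset.sum_div]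
      simp
    rw [e1]
    rcases Nat.eq_zero_or_pos (Ω \ G).card with h0 | h0
    · have : (Ω \ G) = ∅ := card_eq_zero.1 h0
      simp [this]
    · have h0' : (0 : ℝ) < (Ω \ G).card := by exact_mod_cast h0
      have e2 : ((Ω \ G).card : ℝ) - (((Ω \ G).filter (fun a => bad G a)).card : ℝ) / 2
        = (Ω \ G).card * (1 - badFrac Ω bad G / 2) := by
        rw [badFrac]; field_simp
      rw [e2]
      have := Real.add_one_le_exp (-(badFrac Ω bad G / 2))
      calc _ ≤ (Ω \ G).card * Real.exp (-(badFrac Ω bad G / 2)) * Real.exp (badFrac Ω bad G / 2) := by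
            gcongr; linarith
        _ = _ := by rw [mul_assoc, ← Real.exp_add]; simp) s m
  have hR : ∑ G ∈ powersetCard m Ω, ∑ l ∈ paths s G, mulF ρ G l
      ≤ Ω.card.choose m * ((1 + σ) ^ s * m.descFactorial s) := by
    calc _ ≤ ∑ G ∈ powersetCard m Ω, ((1 + σ) ^ s * m.descFactorial s) := by
          refine Finset.sum_le_sum fun G hG => ?_
          have := mulF_backward ρ hρ0 σ hσ (by
            intro G
            simp only [hρdef]
            by_cases hg : eGood bad σ G
            · have : ∀ a ∈ G, (if eGood bad σ G ∧ bad G a then (2 : ℝ) else 1)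
                = 1 + (if bad G a then 1 else 0) := by
                intro a _; simp only [hg, true_and]; split_ifs <;> norm_num
              rw [Finset.sum_congr rfl this, Finset.sum_add_distrib]
              simp only [sum_const, nsmul_eq_mul, mul_one, sum_boole]
              have := hg
              rw [eGood] at this
              linarith
            · simp only [hg, false_and, if_false]
              simp only [sum_const, nsmul_eq_mul, mul_one]
              have : (0 : ℝ) ≤ G.card := by positivity
              nlinarith) s G
          rwa [(mem_powersetCard.1 hG).2] at this
      _ = _ := by rw [sum_const, nsmul_eq_mul, card_powersetCard]
  calc _ ≤ ∑ G ∈ powersetCard m Ω, ∑ l ∈ paths s G, Real.exp (-(β * s / 4)) *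
        (mulF (fun G a => q (G.erase a) a) G l + mulF ρ G l) := by
        refine Finset.sum_le_sum fun G hG => ?_
        rw [← Finset.sum_boole]
        refine Finset.sum_le_sum fun l hl => ?_
        have n1 := mulF_nonneg (fun G a => q (G.erase a) a) (fun _ _ => hq0 _ _) G l
        have n2 := mulF_nonneg ρ hρ0 G l
        split_ifs with hc
        · have hp := chain_pathwise Ω bad σ hb s G l hl hc.1
          have hp2 : Real.exp (β * s / 4) ^ 2 ≤
              mulF (fun G a => q (G.erase a) a) G l * mulF ρ G l := by
            refine le_trans ?_ hp
            rw [← Real.exp_nat_mul]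
            apply Real.exp_le_exp.2
            have := hc.2
            push_cast
            linarith
          have hE := Real.exp_pos (β * s / 4)
          have : Real.exp (β * s / 4) ≤ mulF (fun G a => q (G.erase a) a) G l + mulF ρ G l := by
            by_contra hlt
            push Not at hlt
            nlinarith
          rw [Real.exp_neg, ← div_eq_inv_mul, le_div_iff₀ hE]
          linarith
        · have := Real.exp_pos (-(β * s / 4))
          positivity
    _ = Real.exp (-(β * s / 4)) * (∑ G ∈ powersetCard m Ω, ∑ l ∈ paths s G, mulF (fun G a => q (G.erase a) a) G l
        + ∑ G ∈ powersetCard m Ω, ∑ l ∈ paths s G, mulF ρ G l) := by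
        simp_rw [← Finset.mul_sum, Finset.sum_add_distrib]
    _ ≤ Real.exp (-(β * s / 4)) * (Ω.card.choose m * m.descFactorial s +
          Ω.card.choose m * ((1 + σ) ^ s * m.descFactorial s)) := by
        gcongr
    _ = _ := by ring

end paths


lemma mem_pmSet {W : Finset ℕ} {G M : Finset (Finset ℕ)} :
    M ∈ pmSet W G ↔ M ⊆ G ∧ (∀ A ∈ M, ∀ B ∈ M, A ≠ B → A ∩ B = ∅) ∧ M.biUnion id = W := by
  simp [pmSet]

lemma minus_subset (G : Finset (Finset ℕ)) (Z : Finset ℕ) : minus G Z ⊆ G := filter_subset _ _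

lemma mem_minus {G : Finset (Finset ℕ)} {Z A : Finset ℕ} :
    A ∈ minus G Z ↔ A ∈ G ∧ A ∩ Z = ∅ := by simp [minus]

lemma minus_minus (G : Finset (Finset ℕ)) (Z U : Finset ℕ) :
    minus (minus G Z) U = minus G (Z ∪ U) := by
  ext A
  simp only [mem_minus, inter_union_distrib_left, union_eq_empty, and_assoc]

lemma minus_sub_powersetCard {r : ℕ} {W : Finset ℕ} {G : Finset (Finset ℕ)}
    (hG : G ⊆ powersetCard r W) (Z : Finset ℕ) : minus G Z ⊆ powersetCard r (W \ Z) := by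
  intro A hA
  rw [mem_minus] at hA
  have := mem_powersetCard.1 (hG hA.1)
  rw [mem_powersetCard]
  refine ⟨?_, this.2⟩
  rw [subset_sdiff]
  exact ⟨this.1, disjoint_iff_inter_eq_empty.2 hA.2⟩

lemma phiSub_union (W : Finset ℕ) (G : Finset (Finset ℕ)) (Z U : Finset ℕ) :
    phiSub (W \ Z) (minus G Z) U = phiSub W G (Z ∪ U) := by
  unfold phiSub
  rw [minus_minus, sdiff_sdiff_left]; rfl

lemma pmSet_mono {W : Finset ℕ} {G G' : Finset (Finset ℕ)} (h : G ⊆ G') :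
    pmSet W G ⊆ pmSet W G' := by
  intro M hM
  rw [mem_pmSet] at hM ⊢
  exact ⟨hM.1.trans h, hM.2⟩

lemma pmCount_mono {W : Finset ℕ} {G G' : Finset (Finset ℕ)} (h : G ⊆ G') :
    pmCount W G ≤ pmCount W G' := card_le_card (pmSet_mono h)

lemma pm_card {r ℓ : ℕ} (hr : 0 < r) {W : Finset ℕ} {G M : Finset (Finset ℕ)}
    (hW : W.card = r * ℓ) (hG : G ⊆ powersetCard r W) (hM : M ∈ pmSet W G) : M.card = ℓ := by
  rw [mem_pmSet] at hM
  have h1 : (M.biUnion id).card = ∑ A ∈ M, A.card := by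
    rw [card_biUnion]
    · rfl
    · intro A hA B hB hAB
      exact disjoint_iff_inter_eq_empty.2 (hM.2.1 A hA B hB hAB)
  rw [hM.2.2, hW, sum_congr rfl (g := fun _ => r) (fun A hA => (mem_powersetCard.1 (hG (hM.1 hA))).2),
    sum_const, smul_eq_mul, mul_comm] at h1
  exact (Nat.eq_of_mul_eq_mul_right hr h1).symm

lemma pmSet_sdiff (W : Finset ℕ) (G S : Finset (Finset ℕ)) :
    pmSet W (G \ S) = (pmSet W G).filter (fun M => Disjoint M S) := by
  ext M
  rw [mem_filter, mem_pmSet, mem_pmSet, subset_sdiff]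
  tauto

lemma minus_sdiff (G S : Finset (Finset ℕ)) (Z : Finset ℕ) :
    minus (G \ S) Z = minus G Z \ S := by
  ext A; simp [mem_minus]; tauto

lemma pm_swap {W : Finset ℕ} {G : Finset (Finset ℕ)} (hG : ∀ A ∈ G, A.Nonempty ∧ A ⊆ W)
    (φ : Finset ℕ → Finset (Finset ℕ) → ℝ) :
    ∑ M ∈ pmSet W G, ∑ a ∈ M, φ a (M.erase a)
      = ∑ a ∈ G, ∑ M ∈ pmSet (W \ a) (minus G a), φ a M := by
  rw [Finset.sum_sigma', Finset.sum_sigma']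
  refine Finset.sum_bij' (fun x _ => ⟨x.2, x.1.erase x.2⟩) (fun x _ => ⟨insert x.1 x.2, x.1⟩)
    ?_ ?_ ?_ ?_ ?_
  · rintro ⟨M, a⟩ h
    simp only [mem_sigma] at h ⊢
    obtain ⟨hM, ha⟩ := h
    rw [mem_pmSet] at hM
    obtain ⟨h1, h2, h3⟩ := hM
    refine ⟨h1 ha, ?_⟩
    rw [mem_pmSet]
    refine ⟨?_, ?_, ?_⟩
    · intro B hB
      rw [mem_erase] at hB
      rw [mem_minus]
      exact ⟨h1 hB.2, h2 B hB.2 a ha hB.1⟩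
    · intro A hA B hB
      exact h2 A (mem_of_mem_erase hA) B (mem_of_mem_erase hB)
    · ext x
      simp only [mem_biUnion, mem_erase, id, mem_sdiff]
      constructor
      · rintro ⟨B, ⟨hBa, hB⟩, hx⟩
        refine ⟨h3 ▸ mem_biUnion.2 ⟨B, hB, hx⟩, fun hxa => ?_⟩
        have := h2 B hB a ha hBa
        exact notMem_empty x (this ▸ mem_inter.2 ⟨hx, hxa⟩)
      · rintro ⟨hx, hxa⟩
        rw [← h3, mem_biUnion] at hx
        obtain ⟨B, hB, hxB⟩ := hx
        exact ⟨B, ⟨fun h => hxa (h ▸ hxB), hB⟩, hxB⟩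
  · rintro ⟨a, M⟩ h
    simp only [mem_sigma] at h ⊢
    obtain ⟨ha, hM⟩ := h
    rw [mem_pmSet] at hM
    obtain ⟨h1, h2, h3⟩ := hM
    refine ⟨?_, mem_insert_self _ _⟩
    rw [mem_pmSet]
    refine ⟨insert_subset ha (h1.trans (minus_subset _ _)), ?_, ?_⟩
    · intro A hA B hB hAB
      rw [mem_insert] at hA hB
      rcases hA with rfl | hA
      · rcases hB with rfl | hB
        · exact absurd rfl hAB
        · rw [inter_comm]; exact (mem_minus.1 (h1 hB)).2
      · rcases hB with rfl | hB
        · exact (mem_minus.1 (h1 hA)).2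
        · exact h2 A hA B hB hAB
    · rw [biUnion_insert, h3]
      exact union_sdiff_of_subset (hG a ha).2
  · rintro ⟨M, a⟩ h
    simp only [mem_sigma] at h
    simp [insert_erase h.2]
  · rintro ⟨a, M⟩ h
    simp only [mem_sigma] at h
    have : a ∉ M := by
      intro haM
      have h1 := (mem_minus.1 ((mem_pmSet.1 h.2).1 haM)).2
      rw [inter_self] at h1
      exact (hG a h.1).1.ne_empty h1
    simp [erase_insert this]
  · intros; rfl

lemma edges_ok {r : ℕ} (hr : 0 < r) {W : Finset ℕ} {G : Finset (Finset ℕ)}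
    (hG : G ⊆ powersetCard r W) : ∀ A ∈ G, A.Nonempty ∧ A ⊆ W := by
  intro A hA
  have := mem_powersetCard.1 (hG hA)
  exact ⟨card_pos.1 (by omega), this.1⟩

/-- weighted incidence count -/
lemma sum_phiSub {W : Finset ℕ} {G : Finset (Finset ℕ)} (hG : ∀ A ∈ G, A.Nonempty ∧ A ⊆ W)
    (f : Finset ℕ → ℝ) :
    ∑ M ∈ pmSet W G, ∑ a ∈ M, f a = ∑ a ∈ G, f a * phiSub W G a := by
  rw [pm_swap hG (fun a _ => f a)]
  refine sum_congr rfl fun a _ => ?_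
  rw [sum_const, nsmul_eq_mul, mul_comm]; rfl

lemma phiSub_eq {W : Finset ℕ} {G : Finset (Finset ℕ)} (hG : ∀ A ∈ G, A.Nonempty ∧ A ⊆ W)
    {A : Finset ℕ} (hA : A ∈ G) :
    (phiSub W G A : ℝ) = ((pmSet W G).filter (fun M => A ∈ M)).card := by
  have := sum_phiSub hG (fun a => if a = A then 1 else 0)
  simp only [sum_ite_eq', ite_mul, one_mul, zero_mul, hA, if_true] at this
  rw [← this, ← sum_boole]

lemma pmCount_vertex {W : Finset ℕ} {G : Finset (Finset ℕ)} (hG : ∀ A ∈ G, A.Nonempty ∧ A ⊆ W)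
    {x : ℕ} (hx : x ∈ W) :
    (pmCount W G : ℝ) = ∑ A ∈ G.filter (fun A => x ∈ A), (phiSub W G A : ℝ) := by
  have := sum_phiSub hG (fun a => if x ∈ a then 1 else 0)
  simp only [ite_mul, one_mul, zero_mul] at this
  rw [sum_filter, ← this]
  have key : ∀ M ∈ pmSet W G, ∑ a ∈ M, (if x ∈ a then (1 : ℝ) else 0) = 1 := by
    intro M hM
    rw [mem_pmSet] at hM
    have hx' : x ∈ M.biUnion id := by rw [hM.2.2]; exact hx
    rw [mem_biUnion] at hx'
    obtain ⟨B, hB, hxB⟩ := hx'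
    rw [sum_eq_single B]
    · simp only [id] at hxB; simp [hxB]
    · intro C hC hCB
      rw [if_neg]
      intro hxC
      have := hM.2.1 C hC B hB hCB
      exact notMem_empty x (this ▸ mem_inter.2 ⟨hxC, hxB⟩)
    · intro h; exact absurd hB h
  rw [sum_congr rfl key]
  simp [pmCount]

lemma sum_phiSub_total {r ℓ : ℕ} (hr : 0 < r) {W : Finset ℕ} {G : Finset (Finset ℕ)}
    (hW : W.card = r * ℓ) (hG : G ⊆ powersetCard r W) :
    ∑ A ∈ G, (phiSub W G A : ℝ) = ℓ * pmCount W G := by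
  have := sum_phiSub (edges_ok hr hG) (fun _ => 1)
  simp only [one_mul, sum_const, nsmul_eq_mul, mul_one] at this
  rw [← this, sum_congr rfl (fun M hM => by rw [pm_card hr hW hG hM]), sum_const, nsmul_eq_mul,
    mul_comm]; rfl

lemma phiSub_le {W : Finset ℕ} {G : Finset (Finset ℕ)} (hG : ∀ A ∈ G, A.Nonempty ∧ A ⊆ W)
    {A : Finset ℕ} (hA : A ∈ G) : (phiSub W G A : ℝ) ≤ pmCount W G := by
  rw [phiSub_eq hG hA]
  exact_mod_cast card_le_card (filter_subset _ _)

lemma phiSub_erase {W : Finset ℕ} {G : Finset (Finset ℕ)} {A : Finset ℕ} (hA : A.Nonempty) :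
    phiSub W (G.erase A) A = phiSub W G A := by
  unfold phiSub
  congr 1
  ext B
  simp only [mem_minus, mem_erase]
  constructor
  · tauto
  · rintro ⟨h1, h2⟩
    refine ⟨⟨?_, h1⟩, h2⟩
    rintro rfl
    rw [inter_self] at h2
    exact hA.ne_empty h2


noncomputable def greedyT (g : Finset ℕ → ℝ) : Finset (Finset ℕ) → List (Finset ℕ) → ℝ
  | _, [] => 1
  | G, a :: l => g a / (∑ A ∈ G, g A) * greedyT g (minus G a) l

lemma greedy_le {r : ℕ} (hr : 0 < r) (g : Finset ℕ → ℝ) (hg : ∀ A, 0 < g A) (ℓ : ℕ)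
    (W : Finset ℕ) (G : Finset (Finset ℕ)) (hW : W.card = r * ℓ) (hG : G ⊆ powersetCard r W) :
    ∑ M ∈ pmSet W G, ∑ l ∈ paths ℓ M, greedyT g G l ≤ 1 := by
  induction ℓ generalizing W G with
  | zero =>
    simp only [paths, sum_singleton, greedyT, sum_const, nsmul_eq_mul, mul_one]
    have : pmSet W G ⊆ {∅} := by
      intro M hM
      rw [mem_singleton, ← card_eq_zero]
      exact pm_card hr hW hG hM
    have := card_le_card this
    simp at this
    exact_mod_cast this
  | succ ℓ ih =>
    simp_rw [sum_paths_succ, greedyT, ← mul_sum]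
    rw [pm_swap (edges_ok hr hG) (fun a M => g a / (∑ A ∈ G, g A) *
      ∑ l ∈ paths ℓ M, greedyT g (minus G a) l)]
    simp_rw [← mul_sum]
    calc _ ≤ ∑ a ∈ G, g a / (∑ A ∈ G, g A) * 1 := by
          refine sum_le_sum fun a ha => mul_le_mul_of_nonneg_left ?_
            (div_nonneg (hg a).le (sum_nonneg fun _ _ => (hg _).le))
          apply ih
          · have h := mem_powersetCard.1 (hG ha)
            rw [card_sdiff_of_subset h.1, h.2, hW, Nat.mul_succ, Nat.add_sub_cancel]
          · exact minus_sub_powersetCard hG a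
      _ = (∑ a ∈ G, g a) / (∑ A ∈ G, g A) := by simp [sum_div]
      _ ≤ 1 := div_self_le_one _

noncomputable def wt (g : Finset ℕ → ℝ) (G : Finset (Finset ℕ)) (t : List (Finset ℕ)) : ℝ :=
  ∑ A ∈ G.filter (fun A => ∀ B ∈ t, A ∩ B = ∅), g A

lemma greedyT_eq (g : Finset ℕ → ℝ) (G : Finset (Finset ℕ)) (l : List (Finset ℕ)) :
    greedyT g G l = (l.map g).prod * ∏ i ∈ range l.length, (1 / wt g G (l.take i)) := by
  induction l generalizing G with
  | nil => simp [greedyT]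
  | cons a l ih =>
    rw [greedyT, ih, List.length_cons, prod_range_succ', List.map_cons, List.prod_cons]
    have h1 : ∀ t, wt g (minus G a) t = wt g G (a :: t) := by
      intro t
      unfold wt
      congr 1
      ext A
      simp [mem_minus]; tauto
    have h2 : wt g G ((a :: l).take 0) = ∑ A ∈ G, g A := by simp [wt]
    rw [h2]
    simp only [h1, List.take_succ_cons]
    ring

lemma prod_paths (g : Finset ℕ → ℝ) (s : ℕ) (M : Finset (Finset ℕ)) (hM : M.card = s)
    (l : List (Finset ℕ)) (hl : l ∈ paths s M) : (l.map g).prod = ∏ A ∈ M, g A := by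
  induction s generalizing M l with
  | zero =>
    rw [card_eq_zero] at hM
    simp [paths] at hl
    simp [hl, hM]
  | succ s ih =>
    cases l with
    | nil => simp [paths] at hl
    | cons a l =>
      rw [mem_paths_cons] at hl
      rw [List.map_cons, List.prod_cons, ih (M.erase a)
        (by rw [card_erase_of_mem hl.1, hM]; rfl) l hl.2, mul_prod_erase _ _ hl.1]

lemma avoidP_le_one (j f m : ℕ) : avoidP j f m ≤ 1 := by
  unfold avoidP
  apply prod_le_one
  · intro i _; positivity
  · intro i _
    apply div_le_one_of_le₀ _ (by positivity)
    exact_mod_cast Nat.sub_le _ _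

lemma avoidP_le_pow (j f m r : ℕ) (hf : r ≤ f) (hj : j ≤ m) (hm : 0 < m) :
    avoidP j f m ≤ (((m : ℝ) - j) / m) ^ r := by
  have hm' : (0 : ℝ) < m := by exact_mod_cast hm
  induction j with
  | zero =>
    simp only [avoidP, range_zero, prod_empty]
    rw [Nat.cast_zero, sub_zero, div_self hm'.ne', one_pow]
  | succ j ih =>
    have ih' := ih (by omega)
    unfold avoidP at ih' ⊢
    rw [prod_range_succ]
    have hp : (0 : ℝ) < (m : ℝ) - j := by
      have : (j : ℝ) + 1 ≤ m := by exact_mod_cast hj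
      linarith
    have hp2 : (0 : ℝ) ≤ (m : ℝ) - (j + 1 : ℕ) := by
      have : (j : ℝ) + 1 ≤ m := by exact_mod_cast hj
      push_cast; linarith
    have key : (((m - j - f : ℕ) : ℝ) / ((m - j : ℕ) : ℝ)) ≤
        (((m : ℝ) - (j + 1 : ℕ)) / ((m : ℝ) - j)) ^ r := by
      rw [Nat.cast_sub (by omega : j ≤ m)]
      rcases le_total (m - j) f with h | h
      · rw [Nat.sub_eq_zero_of_le h]
        simp only [Nat.cast_zero, zero_div]
        exact pow_nonneg (div_nonneg hp2 hp.le) _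
      · rw [Nat.cast_sub h, Nat.cast_sub (by omega : j ≤ m)]
        have hb := one_add_mul_le_pow (a := -(1 / ((m : ℝ) - j))) (by
          have h1 : 1 / ((m : ℝ) - j) ≤ 1 := by
            rw [div_le_one hp]
            push_cast at hp2
            linarith
          linarith) r
        have e1 : 1 + -(1 / ((m : ℝ) - j)) = ((m : ℝ) - (j + 1 : ℕ)) / ((m : ℝ) - j) := by
          field_simp
          push_cast; ring
        rw [e1] at hb
        refine le_trans ?_ hb
        have e2 : 1 + (r : ℝ) * -(1 / ((m : ℝ) - j)) = ((m : ℝ) - j - r) / ((m : ℝ) - j) := by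
          field_simp
          ring
        rw [e2]
        apply div_le_div_of_nonneg_right _ hp.le
        have : (r : ℝ) ≤ f := by exact_mod_cast hf
        linarith
    calc _ ≤ (((m : ℝ) - j) / m) ^ r * (((m : ℝ) - (j + 1 : ℕ)) / ((m : ℝ) - j)) ^ r := by
          apply mul_le_mul ih' key (by positivity)
          exact pow_nonneg (div_nonneg hp.le hm'.le) _
      _ = _ := by
          rw [← mul_pow]
          congr 1
          field_simp

lemma sum_wt_le {r ℓ : ℕ} (hr : 0 < r) (hℓ : 0 < ℓ) (g : Finset ℕ → ℝ) (hg : ∀ A, 0 < g A)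
    {W : Finset ℕ} {G M : Finset (Finset ℕ)} (hW : W.card = r * ℓ) (hG : G ⊆ powersetCard r W)
    (hM : M ∈ pmSet W G) (η : ℝ)
    (hη : ∑ A ∈ G.filter (fun A => ∃ B ∈ M, 2 ≤ (A ∩ B).card), g A ≤ η * ∑ A ∈ G, g A)
    (i : ℕ) (hi : i ≤ ℓ) :
    ∑ l ∈ paths ℓ M, wt g G (l.take i) ≤
      ((∑ A ∈ G, g A) * ((((ℓ : ℝ) - i) / ℓ) ^ r + η)) * (paths ℓ M).card := by
  have hMc := pm_card hr hW hG hM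
  have hM' := mem_pmSet.1 hM
  have e1 : ∀ l ∈ paths ℓ M, wt g G (l.take i) = ∑ A ∈ G, g A *
      (if Disjoint (M.filter (fun B => A ∩ B ≠ ∅)) (l.take i).toFinset then (1 : ℝ) else 0) := by
    intro l hl
    unfold wt
    rw [sum_filter]
    refine sum_congr rfl fun A _ => ?_
    rw [mul_ite, mul_one, mul_zero]
    have hsub : ∀ B ∈ l.take i, B ∈ M := fun B hB =>
      subset_paths hl (List.mem_toFinset.2 (List.mem_of_mem_take hB))
    have : (∀ B ∈ l.take i, A ∩ B = ∅) ↔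
      Disjoint (M.filter (fun B => A ∩ B ≠ ∅)) (l.take i).toFinset := by
      rw [disjoint_right]
      simp only [List.mem_toFinset, mem_filter, not_and, not_not]
      exact ⟨fun h B hB _ => h B hB, fun h B hB => h hB (hsub B hB)⟩
    simp only [this]
  rw [sum_congr rfl e1, sum_comm]
  simp_rw [← mul_sum]
  have e2 : ∀ A ∈ G, g A * ∑ l ∈ paths ℓ M,
      (if Disjoint (M.filter (fun B => A ∩ B ≠ ∅)) (l.take i).toFinset then (1 : ℝ) else 0) ≤
      (g A * (((ℓ : ℝ) - i) / ℓ) ^ r +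
        (if ∃ B ∈ M, 2 ≤ (A ∩ B).card then g A else 0)) * (paths ℓ M).card := by
    intro A hA
    rw [sum_avoid ℓ M _ i (filter_subset _ _) hi hMc.ge, hMc]
    rw [← mul_assoc]
    apply mul_le_mul_of_nonneg_right _ (by positivity)
    have hpow : 0 ≤ (((ℓ : ℝ) - i) / ℓ) ^ r := by
      have : (i : ℝ) ≤ ℓ := by exact_mod_cast hi
      exact pow_nonneg (div_nonneg (by linarith) (by positivity)) _
    have hgA := hg A
    split_ifs with hc
    · have := avoidP_le_one i (M.filter (fun B => A ∩ B ≠ ∅)).card ℓ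
      nlinarith
    · rw [add_zero]
      apply mul_le_mul_of_nonneg_left _ hgA.le
      apply avoidP_le_pow _ _ _ _ _ hi hℓ
      push Not at hc
      have hAW := mem_powersetCard.1 (hG hA)
      have hcov : A ⊆ (M.filter (fun B => A ∩ B ≠ ∅)).biUnion (fun B => A ∩ B) := by
        intro x hx
        have : x ∈ M.biUnion id := by rw [hM'.2.2]; exact hAW.1 hx
        rw [mem_biUnion] at this
        obtain ⟨B, hB, hxB⟩ := this
        rw [mem_biUnion]
        exact ⟨B, mem_filter.2 ⟨hB, (nonempty_of_ne_empty (ne_empty_of_mem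
          (mem_inter.2 ⟨hx, hxB⟩))).ne_empty⟩, mem_inter.2 ⟨hx, hxB⟩⟩
      have h1 := (card_le_card hcov).trans (card_biUnion_le_card_mul _ _ 1 (by
        intro B hB
        have := hc B (mem_filter.1 hB).1
        omega))
      omega
  calc _ ≤ ∑ A ∈ G, (g A * (((ℓ : ℝ) - i) / ℓ) ^ r +
        (if ∃ B ∈ M, 2 ≤ (A ∩ B).card then g A else 0)) * (paths ℓ M).card := sum_le_sum e2
    _ = ((∑ A ∈ G, g A) * (((ℓ : ℝ) - i) / ℓ) ^ r +
        ∑ A ∈ G.filter (fun A => ∃ B ∈ M, 2 ≤ (A ∩ B).card), g A) * (paths ℓ M).card := by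
        rw [← sum_mul, sum_add_distrib, ← sum_mul, sum_filter]
    _ ≤ _ := by
        apply mul_le_mul_of_nonneg_right _ (by positivity)
        linarith

lemma Zbound {r ℓ : ℕ} (hr : 0 < r) (hℓ : 0 < ℓ) (g : Finset ℕ → ℝ) (hg : ∀ A, 0 < g A)
    {W : Finset ℕ} {G : Finset (Finset ℕ)} (hW : W.card = r * ℓ) (hG : G ⊆ powersetCard r W)
    (hGn : G.Nonempty) (η : ℝ) (hη0 : 0 ≤ η)
    (hη : ∀ M ∈ pmSet W G,
      ∑ A ∈ G.filter (fun A => ∃ B ∈ M, 2 ≤ (A ∩ B).card), g A ≤ η * ∑ A ∈ G, g A) :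
    (ℓ.factorial : ℝ) * ∑ M ∈ pmSet W G, ∏ A ∈ M, g A ≤
      ∏ i ∈ range ℓ, ((∑ A ∈ G, g A) * ((((ℓ : ℝ) - i) / ℓ) ^ r + η)) := by
  set v : ℕ → ℝ := fun i => (∑ A ∈ G, g A) * ((((ℓ : ℝ) - i) / ℓ) ^ r + η) with hv
  have hv0 : ∀ i ∈ range ℓ, 0 < v i := by
    intro i hi
    have : (i : ℝ) < ℓ := by exact_mod_cast mem_range.1 hi
    have h2 : 0 < ((ℓ : ℝ) - i) / ℓ := div_pos (by linarith) (by exact_mod_cast hℓ)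
    have h3 : 0 < ∑ A ∈ G, g A := sum_pos (fun _ _ => hg _) hGn
    positivity
  have hPv : 0 < ∏ i ∈ range ℓ, v i := prod_pos hv0
  have main := greedy_le hr g hg ℓ W G hW hG
  have key : ∀ M ∈ pmSet W G, (ℓ.factorial : ℝ) * (∏ A ∈ M, g A) / ∏ i ∈ range ℓ, v i ≤
      ∑ l ∈ paths ℓ M, greedyT g G l := by
    intro M hM
    have hMc := pm_card hr hW hG hM
    have hM' := mem_pmSet.1 hM
    have hcard : ((paths ℓ M).card : ℝ) = ℓ.factorial := by
      rw [card_paths, hMc, Nat.descFactorial_self]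
    have hT : ∀ l ∈ paths ℓ M, greedyT g G l = (∏ A ∈ M, g A) / (∏ i ∈ range ℓ, v i) *
        ∏ i ∈ range ℓ, (v i / wt g G (l.take i)) := by
      intro l hl
      rw [greedyT_eq, prod_paths g ℓ M hMc l hl, length_paths hl, prod_div_distrib]
      rw [prod_div_distrib]
      simp only [prod_const_one]
      field_simp
    have hw : ∀ l ∈ paths ℓ M, ∀ i ∈ range ℓ, 0 < wt g G (l.take i) := by
      intro l hl i hi
      have hlt : (l.take i).toFinset.card < M.card := by
        calc _ ≤ (l.take i).length := List.toFinset_card_le _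
          _ ≤ i := List.length_take_le _ _
          _ < _ := by rw [hMc]; exact mem_range.1 hi
      obtain ⟨A, hA, hA2⟩ := exists_mem_notMem_of_card_lt_card hlt
      unfold wt
      apply sum_pos (fun _ _ => hg _)
      refine ⟨A, mem_filter.2 ⟨hM'.1 hA, fun B hB => ?_⟩⟩
      refine hM'.2.1 A hA B (subset_paths hl (List.mem_toFinset.2 (List.mem_of_mem_take hB))) ?_
      rintro rfl
      exact hA2 (List.mem_toFinset.2 hB)
    have hlow : ∀ l ∈ paths ℓ M, 1 + ∑ i ∈ range ℓ, (1 - wt g G (l.take i) / v i) ≤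
        ∏ i ∈ range ℓ, (v i / wt g G (l.take i)) := by
      intro l hl
      have : ∏ i ∈ range ℓ, (v i / wt g G (l.take i)) =
          Real.exp (∑ i ∈ range ℓ, Real.log (v i / wt g G (l.take i))) := by
        rw [Real.exp_sum]
        refine prod_congr rfl fun i hi => ?_
        rw [Real.exp_log (div_pos (hv0 i hi) (hw l hl i hi))]
      rw [this]
      have h1 := Real.add_one_le_exp (∑ i ∈ range ℓ, Real.log (v i / wt g G (l.take i)))
      have h2 : ∑ i ∈ range ℓ, (1 - wt g G (l.take i) / v i) ≤
          ∑ i ∈ range ℓ, Real.log (v i / wt g G (l.take i)) := by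
        refine sum_le_sum fun i hi => ?_
        have := Real.one_sub_inv_le_log_of_pos (div_pos (hv0 i hi) (hw l hl i hi))
        rwa [inv_div] at this
      linarith
    rw [sum_congr rfl hT, ← mul_sum]
    have hsum : (ℓ.factorial : ℝ) ≤ ∑ l ∈ paths ℓ M, ∏ i ∈ range ℓ, (v i / wt g G (l.take i)) := by
      refine le_trans ?_ (sum_le_sum hlow)
      rw [sum_add_distrib, sum_const, nsmul_eq_mul, mul_one, hcard, sum_comm]
      have : 0 ≤ ∑ i ∈ range ℓ, ∑ l ∈ paths ℓ M, (1 - wt g G (l.take i) / v i) := by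
        refine sum_nonneg fun i hi => ?_
        rw [sum_sub_distrib, sum_const, nsmul_eq_mul, mul_one, ← sum_div, sub_nonneg,
          div_le_iff₀ (hv0 i hi), mul_comm]
        exact sum_wt_le hr hℓ g hg hW hG hM η (hη M hM) i (mem_range.1 hi).le
      linarith
    have hgM : 0 ≤ (∏ A ∈ M, g A) / ∏ i ∈ range ℓ, v i :=
      div_nonneg (prod_nonneg fun _ _ => (hg _).le) hPv.le
    calc _ = (∏ A ∈ M, g A) / (∏ i ∈ range ℓ, v i) * ℓ.factorial := by ring
      _ ≤ _ := mul_le_mul_of_nonneg_left hsum hgM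
  have := (sum_le_sum key).trans main
  rw [← sum_div, ← mul_sum, div_le_one hPv] at this
  exact this

lemma factorial_upper (n : ℕ) (hn : 0 < n) :
    (n.factorial : ℝ) ≤ Real.exp 1 * n * ((n : ℝ) ^ n * Real.exp (-n)) := by
  induction n, hn using Nat.le_induction with
  | base => simp [← Real.exp_add]
  | succ n hn ih =>
    have hn' : (0 : ℝ) < n := by exact_mod_cast hn
    rw [Nat.factorial_succ]
    push_cast
    have key : (n : ℝ) ^ (n + 1) * Real.exp 1 ≤ ((n : ℝ) + 1) ^ (n + 1) := by
      have h1 := Real.one_sub_inv_le_log_of_pos (x := ((n : ℝ) + 1) / n) (by positivity)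
      have h2 : 1 ≤ ((n : ℝ) + 1) * Real.log (((n : ℝ) + 1) / n) := by
        have : 1 - (((n : ℝ) + 1) / n)⁻¹ = 1 / ((n : ℝ) + 1) := by field_simp; ring
        rw [this, div_le_iff₀ (by positivity)] at h1
        linarith
      have h3 : Real.exp 1 ≤ (((n : ℝ) + 1) / n) ^ (n + 1) := by
        calc _ ≤ Real.exp (((n : ℝ) + 1) * Real.log (((n : ℝ) + 1) / n)) := Real.exp_le_exp.2 h2
          _ = _ := by
            rw [← Nat.cast_succ, Real.exp_nat_mul, Real.exp_log (by positivity)]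
      rw [div_pow, le_div_iff₀ (by positivity)] at h3
      linarith
    calc ((n : ℝ) + 1) * n.factorial ≤ ((n : ℝ) + 1) * (Real.exp 1 * n * ((n : ℝ) ^ n * Real.exp (-n))) := by
          gcongr
      _ = ((n : ℝ) + 1) * Real.exp (-n) * ((n : ℝ) ^ (n + 1) * Real.exp 1) := by ring
      _ ≤ ((n : ℝ) + 1) * Real.exp (-n) * ((n : ℝ) + 1) ^ (n + 1) := by gcongr
      _ = _ := by
        have : Real.exp (-(n : ℝ)) = Real.exp 1 * Real.exp (-((n : ℝ) + 1)) := by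
          rw [← Real.exp_add]; congr 1; ring
        rw [this]; ring

lemma sum_sqrt_le (ℓ : ℕ) : ∑ i ∈ range ℓ, 1 / Real.sqrt ((i : ℝ) + 1) ≤ 2 * Real.sqrt ℓ := by
  induction ℓ with
  | zero => simp
  | succ n ih =>
    rw [sum_range_succ]
    push_cast
    have ha : 0 < Real.sqrt ((n : ℝ) + 1) := Real.sqrt_pos.2 (by positivity)
    have hb : 0 ≤ Real.sqrt (n : ℝ) := Real.sqrt_nonneg _
    have ha2 : Real.sqrt ((n : ℝ) + 1) ^ 2 = n + 1 := Real.sq_sqrt (by positivity)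
    have hb2 : Real.sqrt (n : ℝ) ^ 2 = n := Real.sq_sqrt (by positivity)
    have : 1 / Real.sqrt ((n : ℝ) + 1) ≤ 2 * Real.sqrt ((n : ℝ) + 1) - 2 * Real.sqrt n := by
      rw [div_le_iff₀ ha]
      nlinarith [sq_nonneg (Real.sqrt ((n : ℝ) + 1) - Real.sqrt n)]
    linarith

lemma prod_bound (r ℓ : ℕ) (hr : 0 < r) (hℓ : 0 < ℓ) (κ : ℝ) (hκ : 0 ≤ κ) :
    ∏ i ∈ range ℓ, ((((ℓ : ℝ) - i) / ℓ) ^ r + κ ^ (2 * r)) ≤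
      ((ℓ.factorial : ℝ) / (ℓ : ℝ) ^ ℓ) ^ r * Real.exp (4 * r * κ * ℓ) := by
  have hℓ' : (0 : ℝ) < ℓ := by exact_mod_cast hℓ
  have hpos : ∀ i ∈ range ℓ, (0 : ℝ) < (ℓ : ℝ) - i := by
    intro i hi
    have : (i : ℝ) < ℓ := by exact_mod_cast mem_range.1 hi
    linarith
  have step : ∀ i ∈ range ℓ, (((ℓ : ℝ) - i) / ℓ) ^ r + κ ^ (2 * r) ≤
      (((ℓ : ℝ) - i) / ℓ) ^ r * Real.exp (2 * r * κ * Real.sqrt (ℓ / ((ℓ : ℝ) - i))) := by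
    intro i hi
    have hp := hpos i hi
    set x := ((ℓ : ℝ) - i) / ℓ with hx
    have hx0 : 0 < x := by positivity
    set z := κ * Real.sqrt (ℓ / ((ℓ : ℝ) - i)) with hz
    have hz0 : 0 ≤ z := by positivity
    have hz2 : z ^ 2 * x = κ ^ 2 := by
      rw [hz, mul_pow, Real.sq_sqrt (by positivity), hx]; field_simp
    have e : κ ^ (2 * r) = x ^ r * (z ^ 2) ^ r := by
      rw [pow_mul, ← hz2, mul_pow]; ring
    rw [e]
    have h1 : 1 + (z ^ 2) ^ r ≤ (1 + z ^ 2) ^ r := by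
      have := pow_add_pow_le (x := (1:ℝ)) (y := z ^ 2) zero_le_one (by positivity) hr.ne'
      simpa using this
    have h2 : (1 + z ^ 2) ^ r ≤ Real.exp (2 * r * z) := by
      calc (1 + z ^ 2) ^ r ≤ ((1 + z) ^ 2) ^ r := by
            gcongr; nlinarith
        _ ≤ ((Real.exp z) ^ 2) ^ r := by
            gcongr; linarith [Real.add_one_le_exp z]
        _ = _ := by
            rw [← pow_mul, ← Real.exp_nat_mul]; push_cast; ring_nf
    calc _ = x ^ r * (1 + (z ^ 2) ^ r) := by ring
      _ ≤ x ^ r * Real.exp (2 * r * z) := by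
        apply mul_le_mul_of_nonneg_left (h1.trans h2) (by positivity)
      _ = _ := by rw [hz]; ring_nf
  calc _ ≤ ∏ i ∈ range ℓ, ((((ℓ : ℝ) - i) / ℓ) ^ r *
        Real.exp (2 * r * κ * Real.sqrt (ℓ / ((ℓ : ℝ) - i)))) := by
        apply prod_le_prod _ step
        intro i hi
        have := hpos i hi
        positivity
    _ = ((ℓ.factorial : ℝ) / (ℓ : ℝ) ^ ℓ) ^ r *
        Real.exp (2 * r * κ * ∑ i ∈ range ℓ, Real.sqrt (ℓ / ((ℓ : ℝ) - i))) := by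
        rw [prod_mul_distrib, ← Real.exp_sum, ← mul_sum, prod_pow]
        congr 2
        rw [prod_div_distrib, prod_const, card_range]
        congr 1
        rw [← prod_range_add_one_eq_factorial, ← prod_range_reflect]
        push_cast
        refine prod_congr rfl fun i hi => ?_
        have := mem_range.1 hi
        rw [Nat.sub_sub, Nat.cast_sub (by omega)]; push_cast; ring
    _ ≤ _ := by
        apply mul_le_mul_of_nonneg_left _ (by positivity)
        apply Real.exp_le_exp.2
        have hs : ∑ i ∈ range ℓ, Real.sqrt (ℓ / ((ℓ : ℝ) - i)) ≤ 2 * ℓ := by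
          rw [← sum_range_reflect]
          calc _ = Real.sqrt ℓ * ∑ i ∈ range ℓ, 1 / Real.sqrt ((i : ℝ) + 1) := by
                rw [mul_sum]
                refine sum_congr rfl fun i hi => ?_
                have := mem_range.1 hi
                have e : (ℓ : ℝ) - ((ℓ - 1 - i : ℕ) : ℝ) = (i : ℝ) + 1 := by
                  rw [Nat.sub_sub, Nat.cast_sub (by omega)]; push_cast; ring
                rw [e, Real.sqrt_div' _ (by positivity)]; ring
            _ ≤ Real.sqrt ℓ * (2 * Real.sqrt ℓ) := by gcongr; exact sum_sqrt_le ℓ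
            _ = 2 * (Real.sqrt ℓ * Real.sqrt ℓ) := by ring
            _ = _ := by rw [Real.mul_self_sqrt hℓ'.le]
        calc 2 * r * κ * ∑ i ∈ range ℓ, Real.sqrt (ℓ / ((ℓ : ℝ) - i)) ≤ 2 * r * κ * (2 * ℓ) := by gcongr
          _ = _ := by ring


def Cod (W : Finset ℕ) (G : Finset (Finset ℕ)) (c : ℝ) : Prop :=
  ∀ x ∈ W, ∀ y ∈ W, x ≠ y → (codeg G x y : ℝ) ≤ c

def Adash (r ℓ : ℕ) (W : Finset ℕ) (G : Finset (Finset ℕ)) (δ : ℝ) : Prop :=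
  (G.card : ℝ) ^ ℓ ≤ ℓ.factorial * pmCount W G * Real.exp ((r + δ) * ℓ)

lemma pairs_bound {r ℓ : ℕ} (hr : 0 < r) {W : Finset ℕ} {G M : Finset (Finset ℕ)}
    (hW : W.card = r * ℓ) (hG : G ⊆ powersetCard r W) (hM : M ∈ pmSet W G) (c : ℝ) (hc0 : 0 ≤ c)
    (hc : Cod W G c) :
    ((G.filter (fun A => ∃ B ∈ M, 2 ≤ (A ∩ B).card)).card : ℝ) ≤ ℓ * r ^ 2 * c := by
  have hMc := pm_card hr hW hG hM
  have hM' := mem_pmSet.1 hM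
  have hsub : G.filter (fun A => ∃ B ∈ M, 2 ≤ (A ∩ B).card) ⊆
      M.biUnion (fun B => B.offDiag.biUnion (fun p => G.filter (fun A => p.1 ∈ A ∧ p.2 ∈ A))) := by
    intro A hA
    obtain ⟨hAG, B, hB, h2⟩ := mem_filter.1 hA
    obtain ⟨x, hx, y, hy, hxy⟩ := one_lt_card.1 (by omega : 1 < (A ∩ B).card)
    rw [mem_inter] at hx hy
    simp only [mem_biUnion, mem_offDiag, mem_filter, Prod.exists]
    exact ⟨B, hB, x, y, ⟨hx.2, hy.2, hxy⟩, hAG, hx.1, hy.1⟩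
  calc _ ≤ ((M.biUnion (fun B => B.offDiag.biUnion
          (fun p => G.filter (fun A => p.1 ∈ A ∧ p.2 ∈ A)))).card : ℝ) := by
        exact_mod_cast card_le_card hsub
    _ ≤ ∑ B ∈ M, ∑ p ∈ B.offDiag, ((G.filter (fun A => p.1 ∈ A ∧ p.2 ∈ A)).card : ℝ) := by
        have h1 := (card_biUnion_le (s := M) (t := fun B => B.offDiag.biUnion
          (fun p => G.filter (fun A => p.1 ∈ A ∧ p.2 ∈ A)))).trans
          (sum_le_sum fun B _ => card_biUnion_le)
        exact_mod_cast h1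
    _ ≤ ∑ B ∈ M, ∑ p ∈ B.offDiag, c := by
        refine sum_le_sum fun B hB => sum_le_sum fun p hp => ?_
        rw [mem_offDiag] at hp
        have hBW := (mem_powersetCard.1 (hG (hM'.1 hB))).1
        exact hc p.1 (hBW hp.1) p.2 (hBW hp.2.1) hp.2.2
    _ ≤ ∑ B ∈ M, (r : ℝ) ^ 2 * c := by
        refine sum_le_sum fun B hB => ?_
        rw [sum_const, nsmul_eq_mul]
        apply mul_le_mul_of_nonneg_right _ hc0
        have hBc := (mem_powersetCard.1 (hG (hM'.1 hB))).2
        rw [offDiag_card, hBc]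
        have : r * r - r ≤ r ^ 2 := by rw [sq]; omega
        exact_mod_cast this
    _ = _ := by rw [sum_const, hMc, nsmul_eq_mul]; ring

lemma Zcor {r ℓ : ℕ} (hr : 0 < r) (hℓ : 0 < ℓ) (g : Finset ℕ → ℝ) (hg : ∀ A, 1 / 2 ≤ g A)
    (hg2 : ∀ A, g A ≤ 2)
    {W : Finset ℕ} {G : Finset (Finset ℕ)} (hW : W.card = r * ℓ) (hG : G ⊆ powersetCard r W)
    (hGn : G.Nonempty) (κ δ : ℝ) (hκ : 0 ≤ κ) (hδ : 0 ≤ δ) (hκδ : 4 * r ^ 2 * δ ≤ κ ^ (2 * r))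
    (hc : Cod W G (δ * G.card / ℓ)) :
    (ℓ.factorial : ℝ) * ∑ M ∈ pmSet W G, ∏ A ∈ M, g A ≤
      (∑ A ∈ G, g A) ^ ℓ * (Real.exp (r * (1 + Real.log ℓ)) * Real.exp (-(r * ℓ) + 4 * r * κ * ℓ)) := by
  have hℓ' : (0 : ℝ) < ℓ := by exact_mod_cast hℓ
  have hg0 : ∀ A, 0 < g A := fun A => by linarith [hg A]
  have h1 := Zbound hr hℓ g hg0 hW hG hGn (κ ^ (2 * r)) (by positivity) (by
    intro M hM
    have hp := pairs_bound hr hW hG hM _ (by positivity) hc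
    have e1 : ∑ A ∈ G.filter (fun A => ∃ B ∈ M, 2 ≤ (A ∩ B).card), g A ≤
      2 * ((G.filter (fun A => ∃ B ∈ M, 2 ≤ (A ∩ B).card)).card : ℝ) := by
      rw [mul_comm, ← nsmul_eq_mul]
      exact sum_le_card_nsmul _ _ _ fun A _ => hg2 A
    have e2 : (1 / 2) * (G.card : ℝ) ≤ ∑ A ∈ G, g A := by
      rw [mul_comm, ← nsmul_eq_mul]
      exact card_nsmul_le_sum _ _ _ fun A _ => hg A
    have e3 : (ℓ : ℝ) * r ^ 2 * (δ * G.card / ℓ) = r ^ 2 * δ * G.card := by field_simp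
    rw [e3] at hp
    have hκ0 : (0 : ℝ) ≤ κ ^ (2 * r) := by positivity
    have hGc : (0 : ℝ) ≤ G.card := by positivity
    calc _ ≤ 2 * (r ^ 2 * δ * G.card) := by linarith
      _ = (4 * r ^ 2 * δ) * ((1 / 2) * G.card) := by ring
      _ ≤ κ ^ (2 * r) * ∑ A ∈ G, g A := by gcongr)
  refine h1.trans ?_
  rw [prod_mul_distrib, prod_const, card_range]
  apply mul_le_mul_of_nonneg_left _ (pow_nonneg (sum_nonneg fun A _ => (hg0 A).le) _)
  refine (prod_bound r ℓ hr hℓ κ hκ).trans ?_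
  have h2 := factorial_upper ℓ hℓ
  have h3 : (ℓ.factorial : ℝ) / (ℓ : ℝ) ^ ℓ ≤ Real.exp (1 + Real.log ℓ) * Real.exp (-ℓ) := by
    rw [div_le_iff₀ (by positivity), Real.exp_add, Real.exp_log hℓ']
    linarith
  calc _ ≤ (Real.exp (1 + Real.log ℓ) * Real.exp (-ℓ)) ^ r * Real.exp (4 * r * κ * ℓ) := by
        gcongr
    _ = _ := by
        rw [mul_pow, ← Real.exp_nat_mul, ← Real.exp_nat_mul, mul_assoc, ← Real.exp_add]
        congr 3; ring

lemma jensen {W : Finset ℕ} {G : Finset (Finset ℕ)} (hGe : ∀ A ∈ G, A.Nonempty ∧ A ⊆ W)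
    (g : Finset ℕ → ℝ) (hg : ∀ A, 0 < g A) (hΦ : 0 < pmCount W G) :
    (pmCount W G : ℝ) * Real.exp ((∑ A ∈ G, Real.log (g A) * phiSub W G A) / pmCount W G) ≤
      ∑ M ∈ pmSet W G, ∏ A ∈ M, g A := by
  have hΦ' : (0 : ℝ) < pmCount W G := by exact_mod_cast hΦ
  set x0 := (∑ A ∈ G, Real.log (g A) * phiSub W G A) / pmCount W G with hx0
  have h1 : ∀ M ∈ pmSet W G, Real.exp x0 * (1 + (∑ A ∈ M, Real.log (g A) - x0)) ≤ ∏ A ∈ M, g A := by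
    intro M _
    have : ∏ A ∈ M, g A = Real.exp x0 * Real.exp (∑ A ∈ M, Real.log (g A) - x0) := by
      rw [← Real.exp_add, add_sub_cancel, Real.exp_sum]
      exact prod_congr rfl fun A _ => (Real.exp_log (hg A)).symm
    rw [this]
    have := Real.add_one_le_exp (∑ A ∈ M, Real.log (g A) - x0)
    exact mul_le_mul_of_nonneg_left (by linarith) (Real.exp_pos _).le
  refine le_trans (le_of_eq ?_) (sum_le_sum h1)
  rw [← mul_sum, sum_add_distrib, sum_sub_distrib, sum_phiSub hGe]
  simp only [sum_const, nsmul_eq_mul, mul_one]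
  have : (∑ A ∈ G, Real.log (g A) * phiSub W G A) = x0 * pmCount W G := by
    rw [hx0]; field_simp
  rw [this]
  unfold pmCount
  ring

lemma entropy {r ℓ : ℕ} (hr : 0 < r) (hℓ : 0 < ℓ) (g : Finset ℕ → ℝ) (hg : ∀ A, 1 / 2 ≤ g A)
    (hg2 : ∀ A, g A ≤ 2)
    {W : Finset ℕ} {G : Finset (Finset ℕ)} (hW : W.card = r * ℓ) (hG : G ⊆ powersetCard r W)
    (hGn : G.Nonempty) (κ δ : ℝ) (hκ : 0 ≤ κ) (hδ : 0 ≤ δ) (hκδ : 4 * r ^ 2 * δ ≤ κ ^ (2 * r))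
    (hc : Cod W G (δ * G.card / ℓ)) (hΦ : 0 < pmCount W G) (hA : Adash r ℓ W G δ) :
    (∑ A ∈ G, Real.log (g A) * phiSub W G A) / pmCount W G ≤
      ℓ * ((∑ A ∈ G, g A) / G.card - 1) + ℓ * (δ + 4 * r * κ) + r * (1 + Real.log ℓ) := by
  have hg0 : ∀ A, 0 < g A := fun A => by linarith [hg A]
  have h1 := jensen (edges_ok hr hG) g hg0 hΦ
  have h2 := Zcor hr hℓ g hg hg2 hW hG hGn κ δ hκ hδ hκδ hc
  set x0 := (∑ A ∈ G, Real.log (g A) * phiSub W G A) / pmCount W G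
  set S := ∑ A ∈ G, g A with hS
  have hS0 : 0 ≤ S := sum_nonneg fun A _ => (hg0 A).le
  have hm : (0 : ℝ) < G.card := by exact_mod_cast card_pos.2 hGn
  unfold Adash at hA
  have h3 : S ^ ℓ ≤ (G.card : ℝ) ^ ℓ * Real.exp (ℓ * (S / G.card - 1)) := by
    rw [Real.exp_nat_mul, ← mul_pow]
    gcongr
    have := Real.add_one_le_exp (S / G.card - 1)
    have h4 : S = G.card * (S / G.card) := by field_simp
    nlinarith
  have hf : (0 : ℝ) < ℓ.factorial := by positivity
  have h5 : (G.card : ℝ) ^ ℓ * Real.exp x0 ≤ (G.card : ℝ) ^ ℓ *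
      Real.exp (ℓ * (S / G.card - 1) + ℓ * (δ + 4 * r * κ) + r * (1 + Real.log ℓ)) := by
    calc (G.card : ℝ) ^ ℓ * Real.exp x0 ≤
        (ℓ.factorial * pmCount W G * Real.exp ((r + δ) * ℓ)) * Real.exp x0 := by gcongr
      _ = (ℓ.factorial * (pmCount W G * Real.exp x0)) * Real.exp ((r + δ) * ℓ) := by ring
      _ ≤ (S ^ ℓ * (Real.exp (r * (1 + Real.log ℓ)) * Real.exp (-(r * ℓ) + 4 * r * κ * ℓ)))
          * Real.exp ((r + δ) * ℓ) := by
          exact mul_le_mul_of_nonneg_right ((mul_le_mul_of_nonneg_left h1 hf.le).trans h2)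
            (Real.exp_pos _).le
      _ ≤ (((G.card : ℝ) ^ ℓ * Real.exp (ℓ * (S / G.card - 1))) *
          (Real.exp (r * (1 + Real.log ℓ)) * Real.exp (-(r * ℓ) + 4 * r * κ * ℓ)))
          * Real.exp ((r + δ) * ℓ) := by gcongr
      _ = _ := by
          rw [mul_assoc, mul_assoc, ← Real.exp_add, ← Real.exp_add, ← Real.exp_add]
          congr 2; ring
  exact Real.exp_le_exp.1 (le_of_mul_le_mul_left h5 (by positivity))

lemma log_over (r : ℕ) (e : ℝ) (he : 0 < e) : ∃ ℓ0 : ℕ, ∀ ℓ : ℕ, ℓ0 ≤ ℓ →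
    r * (1 + Real.log ℓ) ≤ ℓ * e := by
  have h1 : Filter.Tendsto (fun ℓ : ℕ => (r : ℝ) * (1 + Real.log ℓ) / ℓ) Filter.atTop (nhds 0) := by
    have a : Filter.Tendsto (fun x : ℝ => (r : ℝ) * (1 / x + Real.log x / x)) Filter.atTop (nhds 0) := by
      have := (tendsto_inv_atTop_zero (𝕜 := ℝ)).add
        (Real.isLittleO_log_id_atTop.tendsto_div_nhds_zero)
      have := this.const_mul (r : ℝ)
      simpa [one_div] using this
    refine (a.comp tendsto_natCast_atTop_atTop).congr fun n => ?_
    simp only [Function.comp]; ring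
  have h2 := (h1.eventually (gt_mem_nhds he)).and (Filter.eventually_gt_atTop 0)
  obtain ⟨N, hN⟩ := Filter.eventually_atTop.1 h2
  refine ⟨N, fun ℓ hℓ => ?_⟩
  obtain ⟨ha, hb⟩ := hN ℓ hℓ
  have hb' : (0 : ℝ) < ℓ := by exact_mod_cast hb
  rw [div_lt_iff₀ hb'] at ha
  linarith

set_option maxHeartbeats 1000000 in
lemma E1 (r : ℕ) (hr : 0 < r) (σ : ℝ) (hσ : 0 < σ) : ∃ δ0 : ℝ, 0 < δ0 ∧ ∃ D0 : ℝ, 0 < D0 ∧ ∃ ℓ0 : ℕ,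
    ∀ ℓ : ℕ, ℓ0 ≤ ℓ → ∀ (W : Finset ℕ) (G : Finset (Finset ℕ)), W.card = r * ℓ →
    G ⊆ powersetCard r W → D0 * ℓ ≤ G.card → ∀ δ : ℝ, 0 ≤ δ → δ ≤ δ0 →
    Cod W G (δ * G.card / ℓ) → Adash r ℓ W G δ →
    0 < pmCount W G ∧
    ((G.filter (fun A => 2 * (G.card / ℓ : ℝ) * phiSub W G A < pmCount W G)).card : ℝ) ≤ σ * G.card ∧
    ∑ A ∈ G, (phiSub W G A : ℝ) ^ 2 ≤ σ * ℓ * (pmCount W G : ℝ) ^ 2 := by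
  set e0 := σ / 8 with he0
  have he0p : 0 < e0 := by positivity
  set κ := e0 / (12 * r) with hκ
  have hr' : (0 : ℝ) < r := by exact_mod_cast hr
  have hκp : 0 < κ := by positivity
  obtain ⟨ℓ0, hℓ0⟩ := log_over r (e0 / 3) (by positivity)
  refine ⟨min (e0 / 3) (κ ^ (2 * r) / (4 * r ^ 2)), by positivity, 32 / σ ^ 2, by positivity,
    max ℓ0 1, ?_⟩
  intro ℓ hℓ W G hW hG hD δ hδ hδ0 hc hA
  have hℓ1 : 0 < ℓ := lt_of_lt_of_le one_pos ((le_max_right _ _).trans hℓ)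
  have hlog := hℓ0 ℓ ((le_max_left _ _).trans hℓ)
  have hℓ' : (0 : ℝ) < ℓ := by exact_mod_cast hℓ1
  have hm : (0 : ℝ) < G.card := lt_of_lt_of_le (by positivity) hD
  have hGn : G.Nonempty := card_pos.1 (by exact_mod_cast hm)
  have hΦ : 0 < pmCount W G := by
    rcases Nat.eq_zero_or_pos (pmCount W G) with h | h
    · unfold Adash at hA
      rw [h] at hA
      have : (0 : ℝ) < (G.card : ℝ) ^ ℓ := by positivity
      simp at hA
      linarith
    · exact h
  have hΦ' : (0 : ℝ) < pmCount W G := by exact_mod_cast hΦ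
  have hκδ : 4 * r ^ 2 * δ ≤ κ ^ (2 * r) := by
    have := hδ0.trans (min_le_right _ _)
    rw [le_div_iff₀ (by positivity)] at this
    linarith
  have herr : ∀ g : Finset ℕ → ℝ, (∀ A, 1 / 2 ≤ g A) → (∀ A, g A ≤ 2) →
      (∑ A ∈ G, Real.log (g A) * phiSub W G A) / pmCount W G ≤
      ℓ * ((∑ A ∈ G, g A) / G.card - 1) + ℓ * e0 := by
    intro g hg hg2
    have h1 := entropy hr hℓ1 g hg hg2 hW hG hGn κ δ hκp.le hδ hκδ hc hΦ hA
    have h2 : 4 * r * κ = e0 / 3 := by rw [hκ]; field_simp; ring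
    have h3 := hδ0.trans (min_le_left _ _)
    rw [h2] at h1
    nlinarith
  have hlog2 := Real.log_two_lt_d9
  have hlog2' := Real.log_two_gt_d9
  refine ⟨hΦ, ?_, ?_⟩
  · set T := G.filter (fun A => 2 * (G.card / ℓ : ℝ) * phiSub W G A < pmCount W G) with hT
    have h1 := herr (fun A => if A ∈ T then 1 / 2 else 1)
      (fun A => by split_ifs <;> norm_num) (fun A => by split_ifs <;> norm_num)
    have hTG : T ⊆ G := filter_subset _ _
    have e1 : ∑ A ∈ G, (if A ∈ T then (1 / 2 : ℝ) else 1) = G.card - T.card / 2 := by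
      have : ∀ A ∈ G, (if A ∈ T then (1 / 2 : ℝ) else 1) = 1 - (if A ∈ T then 1 / 2 else 0) := by
        intro A _; split_ifs <;> norm_num
      rw [sum_congr rfl this, sum_sub_distrib, ← sum_filter, filter_mem_eq_inter,
        inter_eq_right.2 hTG]
      simp; ring
    have e2 : ∑ A ∈ G, Real.log (if A ∈ T then (1 / 2 : ℝ) else 1) * phiSub W G A =
        -Real.log 2 * ∑ A ∈ T, (phiSub W G A : ℝ) := by
      have : ∀ A ∈ G, Real.log (if A ∈ T then (1 / 2 : ℝ) else 1) * phiSub W G A =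
          (if A ∈ T then -Real.log 2 * phiSub W G A else 0) := by
        intro A _; split_ifs
        · rw [one_div, Real.log_inv]
        · simp
      rw [sum_congr rfl this, ← sum_filter, filter_mem_eq_inter, inter_eq_right.2 hTG, mul_sum]
    have e3 : ∑ A ∈ T, (phiSub W G A : ℝ) ≤ T.card * (pmCount W G * ℓ / (2 * G.card)) := by
      rw [← nsmul_eq_mul]
      refine sum_le_card_nsmul _ _ _ fun A hA => ?_
      have := (mem_filter.1 hA).2
      rw [le_div_iff₀ (by positivity)]
      have e : 2 * ((G.card : ℝ) / ℓ) * phiSub W G A * ℓ = phiSub W G A * (2 * G.card) := by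
        field_simp
      nlinarith
    rw [e1, e2, div_le_iff₀ hΦ'] at h1
    have h2 : -Real.log 2 * (T.card * (pmCount W G * ℓ / (2 * G.card))) ≤
        (ℓ * ((G.card - T.card / 2 : ℝ) / G.card - 1) + ℓ * e0) * pmCount W G := by
      refine le_trans ?_ h1
      have := mul_le_mul_of_nonneg_left e3 (by linarith : (0:ℝ) ≤ Real.log 2)
      linarith
    have e4 : (ℓ * ((G.card - T.card / 2 : ℝ) / G.card - 1) + ℓ * e0) * pmCount W G =
       (ℓ * pmCount W G / (2 * G.card)) * (- T.card + 2 * e0 * G.card) := by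
      field_simp; ring
    have e5 : -Real.log 2 * (T.card * (pmCount W G * ℓ / (2 * G.card))) =
       (ℓ * pmCount W G / (2 * G.card)) * (-Real.log 2 * T.card) := by ring
    rw [e4, e5] at h2
    have h3 := le_of_mul_le_mul_left h2 (by positivity)
    have hT0 : (0 : ℝ) ≤ T.card := by positivity
    have : (T.card : ℝ) * (1 / 4) ≤ 2 * e0 * G.card := by nlinarith
    rw [he0] at this
    linarith
  · set τ := σ / 4 with hτ
    have hτ0 : 0 < τ := by positivity
    set T := G.filter (fun A => τ * pmCount W G < (phiSub W G A : ℝ)) with hT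
    have h1 := herr (fun A => if A ∈ T then 2 else 1)
      (fun A => by split_ifs <;> norm_num) (fun A => by split_ifs <;> norm_num)
    have hTG : T ⊆ G := filter_subset _ _
    have e1 : ∑ A ∈ G, (if A ∈ T then (2 : ℝ) else 1) = G.card + T.card := by
      have : ∀ A ∈ G, (if A ∈ T then (2 : ℝ) else 1) = 1 + (if A ∈ T then 1 else 0) := by
        intro A _; split_ifs <;> norm_num
      rw [sum_congr rfl this, sum_add_distrib, ← sum_filter, filter_mem_eq_inter,
        inter_eq_right.2 hTG]
      simp
    have e2 : ∑ A ∈ G, Real.log (if A ∈ T then (2 : ℝ) else 1) * phiSub W G A =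
        Real.log 2 * ∑ A ∈ T, (phiSub W G A : ℝ) := by
      have : ∀ A ∈ G, Real.log (if A ∈ T then (2 : ℝ) else 1) * phiSub W G A =
          (if A ∈ T then Real.log 2 * phiSub W G A else 0) := by
        intro A _; split_ifs
        · rfl
        · simp
      rw [sum_congr rfl this, ← sum_filter, filter_mem_eq_inter, inter_eq_right.2 hTG, mul_sum]
    have htot := sum_phiSub_total hr hW hG
    set PT := ∑ A ∈ T, (phiSub W G A : ℝ) with hPT
    have hPTle : PT ≤ ℓ * pmCount W G := by
      rw [← htot]
      exact sum_le_sum_of_subset_of_nonneg hTG fun _ _ _ => by positivity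
    have hPT0 : 0 ≤ PT := sum_nonneg fun _ _ => by positivity
    have e3 : (T.card : ℝ) * (τ * pmCount W G) ≤ PT := by
      rw [← nsmul_eq_mul]
      exact card_nsmul_le_sum _ _ _ fun A hA => (mem_filter.1 hA).2.le
    have e3' : (T.card : ℝ) * τ ≤ ℓ := by
      refine le_of_mul_le_mul_right (a := (pmCount W G : ℝ)) ?_ hΦ'
      linarith
    rw [e1, e2, div_le_iff₀ hΦ'] at h1
    have e4 : ((G.card + T.card : ℝ) / G.card - 1) = T.card / G.card := by field_simp; ring
    rw [e4] at h1
    have e5 : (T.card : ℝ) / G.card ≤ σ / 8 := by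
      rw [div_le_iff₀ hm]
      have : 32 / σ ^ 2 * (T.card * τ) ≤ G.card := by
        refine le_trans ?_ hD
        gcongr
      rw [hτ] at this
      have e6 : 32 / σ ^ 2 * (T.card * (σ / 4)) = 8 * T.card / σ := by field_simp; ring
      rw [e6, div_le_iff₀ hσ] at this
      linarith
    have h2 : PT ≤ σ / 2 * ℓ * pmCount W G := by
      have a1 : Real.log 2 * PT ≤ ℓ * pmCount W G * (σ / 4) := by
        refine h1.trans ?_
        have : ℓ * ((T.card : ℝ) / G.card) ≤ ℓ * (σ / 8) := by gcongr
        have := mul_le_mul_of_nonneg_right this hΦ'.le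
        rw [he0]
        linarith
      have : (1 / 2) * PT ≤ Real.log 2 * PT := by gcongr; linarith
      linarith
    have h3 : ∀ A ∈ G, (phiSub W G A : ℝ) ^ 2 ≤ τ * pmCount W G * phiSub W G A +
        (if A ∈ T then (pmCount W G : ℝ) * phiSub W G A else 0) := by
      intro A hA
      have ha0 : (0 : ℝ) ≤ phiSub W G A := by positivity
      have hle := phiSub_le (edges_ok hr hG) hA
      split_ifs with h
      · have : 0 ≤ τ * pmCount W G * phiSub W G A := by positivity
        nlinarith
      · have : (phiSub W G A : ℝ) ≤ τ * pmCount W G := by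
          by_contra hcon
          exact h (mem_filter.2 ⟨hA, not_le.1 hcon⟩)
        nlinarith
    calc _ ≤ ∑ A ∈ G, (τ * pmCount W G * phiSub W G A +
        (if A ∈ T then (pmCount W G : ℝ) * phiSub W G A else 0)) := sum_le_sum h3
      _ = τ * pmCount W G * (ℓ * pmCount W G) + pmCount W G * PT := by
        rw [sum_add_distrib, ← mul_sum, htot, ← sum_filter, filter_mem_eq_inter,
          inter_eq_right.2 hTG, ← mul_sum]
      _ ≤ τ * pmCount W G * (ℓ * pmCount W G) + pmCount W G * (σ / 2 * ℓ * pmCount W G) := by gcongr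
      _ = σ * (3 / 4) * ℓ * (pmCount W G : ℝ) ^ 2 := by rw [hτ]; ring
      _ ≤ _ := by
        have : 0 ≤ σ * ℓ * (pmCount W G : ℝ) ^ 2 := by positivity
        linarith


lemma avoidP_succ (j f m : ℕ) : avoidP (j + 1) f m =
    avoidP j f m * (((m - j - f : ℕ) : ℝ) / ((m - j : ℕ) : ℝ)) := by
  unfold avoidP; rw [prod_range_succ]

lemma avoidP_ratio2 (j ℓ m x : ℕ) (hm : 4 * ℓ ≤ m) (hj : 2 * j ≤ m) (hx : x ≤ ℓ) (hm0 : 0 < m) :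
    avoidP j (2 * ℓ - x) m ≤ avoidP j ℓ m ^ 2 * Real.exp (8 * j * x / m) := by
  induction j with
  | zero => simp [avoidP]
  | succ j ih =>
    have ih' := ih (by omega)
    rw [avoidP_succ, avoidP_succ]
    have hm' : (0 : ℝ) < m := by exact_mod_cast hm0
    have ha : (0 : ℝ) < ((m - j : ℕ) : ℝ) := by
      have : 0 < m - j := by omega
      exact_mod_cast this
    have hm2 : (m : ℝ) ≤ 2 * ((m - j : ℕ) : ℝ) := by
      have : m ≤ 2 * (m - j) := by omega
      exact_mod_cast this
    have hl2 : 2 * (ℓ : ℝ) ≤ ((m - j : ℕ) : ℝ) := by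
      have : 2 * ℓ ≤ m - j := by omega
      exact_mod_cast this
    have e1 : ((m - j - (2 * ℓ - x) : ℕ) : ℝ) = ((m - j : ℕ) : ℝ) - 2 * ℓ + x := by
      rw [Nat.cast_sub (by omega), Nat.cast_sub (by omega : x ≤ 2 * ℓ)]; push_cast; ring
    have e2 : ((m - j - ℓ : ℕ) : ℝ) = ((m - j : ℕ) : ℝ) - ℓ := by
      rw [Nat.cast_sub (by omega)]
    rw [e1, e2]
    set a := ((m - j : ℕ) : ℝ)
    have hx0 : (0 : ℝ) ≤ x := by positivity
    have hl0 : (0 : ℝ) ≤ ℓ := by positivity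
    have key : (a - 2 * ℓ + x) / a ≤ ((a - ℓ) / a) ^ 2 * Real.exp (8 * x / m) := by
      have h1 : 1 + 4 * x / a ≤ Real.exp (8 * x / m) := by
        have : 4 * x / a ≤ 8 * x / m := by
          rw [div_le_div_iff₀ ha hm']; nlinarith
        linarith [Real.add_one_le_exp (8 * x / m : ℝ)]
      refine le_trans ?_ (mul_le_mul_of_nonneg_left h1 (by positivity))
      have e3 : ((a - ℓ) / a) ^ 2 * (1 + 4 * x / a) = ((a - ℓ) ^ 2 * (a + 4 * x) / a ^ 2) / a := by
        field_simp
      rw [e3]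
      apply div_le_div_of_nonneg_right _ ha.le
      rw [le_div_iff₀ (by positivity)]
      have h2 : (a / 2) ^ 2 ≤ (a - ℓ) ^ 2 := by
        apply pow_le_pow_left₀ (by positivity); linarith
      have h3 : 0 ≤ 4 * x * ((a - ℓ) ^ 2 - (a / 2) ^ 2) := mul_nonneg (by positivity) (by linarith)
      have h4 : 0 ≤ a * (ℓ : ℝ) ^ 2 := by positivity
      nlinarith
    calc _ ≤ (avoidP j ℓ m ^ 2 * Real.exp (8 * j * x / m)) *
          (((a - ℓ) / a) ^ 2 * Real.exp (8 * x / m)) := by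
          apply mul_le_mul ih' key
          · apply div_nonneg _ ha.le; linarith
          · positivity
      _ = (avoidP j ℓ m * ((a - ℓ) / a)) ^ 2 *
          (Real.exp (8 * j * x / m) * Real.exp (8 * x / m)) := by ring
      _ = _ := by
          rw [← Real.exp_add]; congr 2; push_cast; ring

lemma avoidP_ratio1 (j ℓ m : ℕ) (hm : 4 * ℓ ≤ m) (hj : 8 * j ≤ m) (hℓ : 1 ≤ ℓ) :
    avoidP j (ℓ - 1) m ≤ 2 * avoidP j ℓ m := by
  have hm' : (0 : ℝ) < m := by
    have : 0 < m := by omega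
    exact_mod_cast this
  have gen : ∀ i ≤ j, avoidP i (ℓ - 1) m ≤ Real.exp (4 * i / m) * avoidP i ℓ m := by
    intro i
    induction i with
    | zero => simp [avoidP]
    | succ i ih =>
      intro hi
      have ih' := ih (by omega)
      rw [avoidP_succ, avoidP_succ]
      have ha : (0 : ℝ) < ((m - i : ℕ) : ℝ) := by
        have : 0 < m - i := by omega
        exact_mod_cast this
      have hm2 : (m : ℝ) ≤ 2 * ((m - i : ℕ) : ℝ) := by
        have : m ≤ 2 * (m - i) := by omega
        exact_mod_cast this
      have hl2 : 2 * (ℓ : ℝ) ≤ ((m - i : ℕ) : ℝ) := by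
        have : 2 * ℓ ≤ m - i := by omega
        exact_mod_cast this
      have e1 : ((m - i - (ℓ - 1) : ℕ) : ℝ) = ((m - i : ℕ) : ℝ) - ℓ + 1 := by
        rw [Nat.cast_sub (by omega), Nat.cast_sub (by omega : 1 ≤ ℓ)]; push_cast; ring
      have e2 : ((m - i - ℓ : ℕ) : ℝ) = ((m - i : ℕ) : ℝ) - ℓ := by
        rw [Nat.cast_sub (by omega)]
      rw [e1, e2]
      set a := ((m - i : ℕ) : ℝ)
      have key : (a - ℓ + 1) / a ≤ Real.exp (4 / m) * ((a - ℓ) / a) := by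
        rw [← mul_div_assoc]
        apply div_le_div_of_nonneg_right _ ha.le
        have h1 := Real.add_one_le_exp (4 / m : ℝ)
        have h2 : 1 ≤ (4 / m : ℝ) * (a - ℓ) := by
          rw [div_mul_eq_mul_div, le_div_iff₀ hm']; linarith
        nlinarith
      calc _ ≤ (Real.exp (4 * i / m) * avoidP i ℓ m) * (Real.exp (4 / m) * ((a - ℓ) / a)) := by
            apply mul_le_mul ih' key
            · apply div_nonneg _ ha.le; linarith
            · exact mul_nonneg (Real.exp_pos _).le (avoidP_nonneg _ _ _)
        _ = (Real.exp (4 * i / m) * Real.exp (4 / m)) * (avoidP i ℓ m * ((a - ℓ) / a)) := by ring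
        _ = _ := by rw [← Real.exp_add]; congr 2; push_cast; ring
  refine (gen j le_rfl).trans (mul_le_mul_of_nonneg_right ?_ (avoidP_nonneg _ _ _))
  have : (4 * j / m : ℝ) ≤ Real.log 2 := by
    have h8 : (8 : ℝ) * j ≤ m := by exact_mod_cast hj
    have : (4 * j / m : ℝ) ≤ 1 / 2 := by rw [div_le_div_iff₀ hm' (by norm_num)]; linarith
    linarith [Real.log_two_gt_d9]
  calc _ ≤ Real.exp (Real.log 2) := Real.exp_le_exp.2 this
    _ = 2 := Real.exp_log (by norm_num)

lemma avoidP_lower (j ℓ m : ℕ) (hm : 4 * ℓ ≤ m) (hj : 2 * j ≤ m) (hm0 : 0 < m) :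
    Real.exp (-(4 * j * ℓ / m)) ≤ avoidP j ℓ m := by
  have hm' : (0 : ℝ) < m := by exact_mod_cast hm0
  induction j with
  | zero => simp [avoidP]
  | succ j ih =>
    have ih' := ih (by omega)
    rw [avoidP_succ]
    have ha : (0 : ℝ) < ((m - j : ℕ) : ℝ) := by
      have : 0 < m - j := by omega
      exact_mod_cast this
    have hm2 : (m : ℝ) ≤ 2 * ((m - j : ℕ) : ℝ) := by
      have : m ≤ 2 * (m - j) := by omega
      exact_mod_cast this
    have hl2 : 2 * (ℓ : ℝ) ≤ ((m - j : ℕ) : ℝ) := by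
      have : 2 * ℓ ≤ m - j := by omega
      exact_mod_cast this
    have e2 : ((m - j - ℓ : ℕ) : ℝ) = ((m - j : ℕ) : ℝ) - ℓ := by
      rw [Nat.cast_sub (by omega)]
    rw [e2]
    set a := ((m - j : ℕ) : ℝ)
    have hl0 : (0 : ℝ) ≤ ℓ := by positivity
    have hal : 0 < a - ℓ := by linarith
    have key : Real.exp (-(4 * ℓ / m)) ≤ (a - ℓ) / a := by
      have h1 := Real.add_one_le_exp (4 * ℓ / m : ℝ)
      rw [Real.exp_neg, inv_le_comm₀ (Real.exp_pos _) (by positivity), inv_div]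
      refine le_trans ?_ h1
      have : a / (a - ℓ) = 1 + ℓ / (a - ℓ) := by field_simp; ring
      rw [this]
      have : ℓ / (a - ℓ) ≤ 4 * ℓ / m := by
        rw [div_le_div_iff₀ hal hm']; nlinarith
      linarith
    calc _ = Real.exp (-(4 * j * ℓ / m)) * Real.exp (-(4 * ℓ / m)) := by
          rw [← Real.exp_add]; congr 1; push_cast; ring
      _ ≤ _ := mul_le_mul ih' key (Real.exp_pos _).le (avoidP_nonneg _ _ _)

/-- first moment -/
lemma moment1 {α : Type*} [DecidableEq α] (s j f : ℕ) (G : Finset α) (𝓜 : Finset (Finset α))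
    (h𝓜 : ∀ M ∈ 𝓜, M ⊆ G ∧ M.card = f) (hj : j ≤ s) (hs : s ≤ G.card) :
    ∑ l ∈ paths s G, ((𝓜.filter (fun M => Disjoint M (l.take j).toFinset)).card : ℝ) =
      avoidP j f G.card * 𝓜.card * (paths s G).card := by
  simp_rw [← sum_boole]
  rw [sum_comm]
  have : ∀ M ∈ 𝓜, ∑ l ∈ paths s G, (if Disjoint M (l.take j).toFinset then (1 : ℝ) else 0) =
      avoidP j f G.card * (paths s G).card := by
    intro M hM
    rw [sum_avoid s G M j (h𝓜 M hM).1 hj hs, (h𝓜 M hM).2]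
  rw [sum_congr rfl this, sum_const, nsmul_eq_mul]; ring

/-- second moment and Chebyshev -/
lemma moment2 {α : Type*} [DecidableEq α] (s j f : ℕ) (G : Finset α) (𝓜 : Finset (Finset α))
    (h𝓜 : ∀ M ∈ 𝓜, M ⊆ G ∧ M.card = f) (hj : j ≤ s) (hs : s ≤ G.card) (hf : 0 < f)
    (hm : 4 * f ≤ G.card) (hj2 : 2 * j ≤ G.card) (c τ : ℝ)
    (hτ0 : 0 ≤ τ) (hc : 8 * (j : ℝ) * f / G.card ≤ c)
    (hτ : ∑ M ∈ 𝓜, ∑ M' ∈ 𝓜, ((M ∩ M').card : ℝ) ≤ τ * f * (𝓜.card : ℝ) ^ 2) :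
    (((paths s G).filter (fun l =>
      ((𝓜.filter (fun M => Disjoint M (l.take j).toFinset)).card : ℝ) <
        1 / 2 * (avoidP j f G.card * 𝓜.card))).card : ℝ) ≤ 4 * τ * Real.exp c * (paths s G).card := by
  set m := G.card with hmdef
  have hm0 : 0 < m := by omega
  have hm' : (0 : ℝ) < m := by exact_mod_cast hm0
  have hf' : (0 : ℝ) < f := by exact_mod_cast hf
  set P := ((paths s G).card : ℝ) with hP
  have hP0 : 0 ≤ P := by positivity
  set X : List α → ℝ := fun l => ((𝓜.filter (fun M => Disjoint M (l.take j).toFinset)).card : ℝ) with hX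
  set μ := avoidP j f m * 𝓜.card with hμ
  have hav : 0 < avoidP j f m := lt_of_lt_of_le (Real.exp_pos _) (avoidP_lower j f m hm hj2 hm0)
  have m1 : ∑ l ∈ paths s G, X l = μ * P := moment1 s j f G 𝓜 h𝓜 hj hs
  rcases (𝓜.card).eq_zero_or_pos with h0 | hpos
  · have hμ0 : μ = 0 := by rw [hμ, h0]; simp
    have h𝓜0 : 𝓜 = ∅ := card_eq_zero.1 h0
    have : (paths s G).filter (fun l => X l < 1 / 2 * μ) = ∅ := by
      apply filter_eq_empty_iff.2
      intro l _
      rw [hμ0]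
      have : 0 ≤ X l := by positivity
      linarith
    rw [this]
    simp only [card_empty, Nat.cast_zero]
    positivity
  have hM0 : (0 : ℝ) < 𝓜.card := by exact_mod_cast hpos
  have hμ0 : 0 < μ := by positivity
  have m2 : ∑ l ∈ paths s G, X l ^ 2 ≤ μ ^ 2 * (1 + τ * Real.exp c) * P := by
    have e1 : ∀ l ∈ paths s G, X l ^ 2 = ∑ M ∈ 𝓜, ∑ M' ∈ 𝓜,
        (if Disjoint (M ∪ M') (l.take j).toFinset then (1 : ℝ) else 0) := by
      intro l _
      simp only [hX]
      rw [← sum_boole, sq, sum_mul_sum]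
      refine sum_congr rfl fun M _ => sum_congr rfl fun M' _ => ?_
      simp only [disjoint_union_left]
      split_ifs <;> simp_all
    rw [sum_congr rfl e1, sum_comm]
    have e2 : ∀ M ∈ 𝓜, ∑ l ∈ paths s G, ∑ M' ∈ 𝓜,
        (if Disjoint (M ∪ M') (l.take j).toFinset then (1 : ℝ) else 0) ≤
        ∑ M' ∈ 𝓜, avoidP j f m ^ 2 * (1 + (M ∩ M').card / f * Real.exp c) * P := by
      intro M hM
      rw [sum_comm]
      refine sum_le_sum fun M' hM' => ?_
      obtain ⟨h1, h2⟩ := h𝓜 M hM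
      obtain ⟨h3, h4⟩ := h𝓜 M' hM'
      rw [sum_avoid s G (M ∪ M') j (union_subset h1 h3) hj hs]
      apply mul_le_mul_of_nonneg_right _ hP0
      have hcu : (M ∪ M').card = 2 * f - (M ∩ M').card := by
        have := card_union_add_card_inter M M'; omega
      have hx : (M ∩ M').card ≤ f := h2 ▸ card_le_card inter_subset_left
      rw [hcu]
      refine (avoidP_ratio2 j f m _ hm hj2 hx hm0).trans ?_
      apply mul_le_mul_of_nonneg_left _ (by positivity)
      set θ : ℝ := (M ∩ M').card / f with hθ
      have hθ0 : 0 ≤ θ := by positivity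
      have hθ1 : θ ≤ 1 := by
        rw [hθ, div_le_one hf']; exact_mod_cast hx
      have hle : 8 * (j : ℝ) * (M ∩ M').card / m ≤ θ * c := by
        calc _ = θ * (8 * (j : ℝ) * f / m) := by rw [hθ]; field_simp
          _ ≤ _ := by gcongr
      have hconv := convexOn_exp.2 (Set.mem_univ 0) (Set.mem_univ c)
        (sub_nonneg.2 hθ1) hθ0 (by ring)
      simp only [smul_eq_mul, mul_zero, zero_add, Real.exp_zero, mul_one] at hconv
      have := Real.exp_le_exp.2 hle
      linarith
    refine (sum_le_sum e2).trans (le_of_eq_of_le ?_ (mul_le_mul_of_nonneg_right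
      (?_ : avoidP j f m ^ 2 * ((𝓜.card : ℝ) ^ 2 + (∑ M ∈ 𝓜, ∑ M' ∈ 𝓜, ((M ∩ M').card : ℝ)) / f *
        Real.exp c) ≤ _) hP0))
    · simp_rw [← sum_mul, ← mul_sum, sum_add_distrib, ← sum_mul, ← sum_div]
      simp only [sum_const, nsmul_eq_mul, mul_one]
      ring
    · have h5 : (∑ M ∈ 𝓜, ∑ M' ∈ 𝓜, ((M ∩ M').card : ℝ)) / f ≤ τ * (𝓜.card : ℝ) ^ 2 := by
        rw [div_le_iff₀ hf']; linarith
      calc _ ≤ avoidP j f m ^ 2 * ((𝓜.card : ℝ) ^ 2 + τ * (𝓜.card : ℝ) ^ 2 * Real.exp c) := by gcongr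
        _ = _ := by rw [hμ]; ring
  -- Chebyshev
  have cheb : ∑ l ∈ paths s G, (X l - μ) ^ 2 ≤ μ ^ 2 * (τ * Real.exp c) * P := by
    have : ∑ l ∈ paths s G, (X l - μ) ^ 2 =
        ∑ l ∈ paths s G, X l ^ 2 - 2 * μ * ∑ l ∈ paths s G, X l + μ ^ 2 * P := by
      rw [mul_sum, ← sum_sub_distrib, hP, mul_comm (μ ^ 2), ← nsmul_eq_mul, ← sum_const, ← sum_add_distrib]
      exact sum_congr rfl fun l _ => by ring
    rw [this, m1]
    nlinarith
  have low : ((((paths s G).filter (fun l => X l < 1 / 2 * μ)).card : ℝ)) * (μ ^ 2 / 4) ≤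
      ∑ l ∈ paths s G, (X l - μ) ^ 2 := by
    calc _ = ∑ l ∈ (paths s G).filter (fun l => X l < 1 / 2 * μ), μ ^ 2 / 4 := by
          rw [sum_const, nsmul_eq_mul]
      _ ≤ ∑ l ∈ (paths s G).filter (fun l => X l < 1 / 2 * μ), (X l - μ) ^ 2 := by
          refine sum_le_sum fun l hl => ?_
          have := (mem_filter.1 hl).2
          nlinarith
      _ ≤ _ := sum_le_sum_of_subset_of_nonneg (filter_subset _ _) fun _ _ _ => by positivity
  have h6 := low.trans cheb
  have h7 : ((((paths s G).filter (fun l => X l < 1 / 2 * μ)).card : ℝ)) * μ ^ 2 ≤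
      (4 * τ * Real.exp c * P) * μ ^ 2 := by linarith
  exact le_of_mul_le_mul_right h7 (by positivity)


def badD (W : Finset ℕ) (D : ℝ) (G : Finset (Finset ℕ)) (U : Finset ℕ) : Prop :=
  U.Nonempty ∧ 2 * D * phiSub W G U < pmCount W G

lemma badD_erase (W : Finset ℕ) (D : ℝ) (G : Finset (Finset ℕ)) (a : Finset ℕ) (_ : a ∈ G)
    (h : badD W D (G.erase a) a) : badD W D G a := by
  refine ⟨h.1, ?_⟩
  have h2 := h.2
  rw [phiSub_erase h.1] at h2
  refine h2.trans_le ?_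
  exact_mod_cast pmCount_mono (erase_subset _ _)

lemma pmCount_sdiff (W : Finset ℕ) (G S : Finset (Finset ℕ)) :
    pmCount W (G \ S) = ((pmSet W G).filter (fun M => Disjoint M S)).card := by
  unfold pmCount; rw [pmSet_sdiff]

lemma phiSub_sdiff (W U : Finset ℕ) (G S : Finset (Finset ℕ)) :
    phiSub W (G \ S) U = ((pmSet (W \ U) (minus G U)).filter (fun M => Disjoint M S)).card := by
  unfold phiSub; rw [minus_sdiff, pmCount_sdiff]

lemma inter_sum {W : Finset ℕ} {G : Finset (Finset ℕ)} (hG : ∀ A ∈ G, A.Nonempty ∧ A ⊆ W) :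
    ∑ M ∈ pmSet W G, ∑ M' ∈ pmSet W G, ((M ∩ M').card : ℝ) = ∑ A ∈ G, (phiSub W G A : ℝ) ^ 2 := by
  have h1 : ∀ M ∈ pmSet W G, ∑ M' ∈ pmSet W G, ((M ∩ M').card : ℝ) =
      ∑ A ∈ M, (phiSub W G A : ℝ) := by
    intro M hM
    have hMG := (mem_pmSet.1 hM).1
    have : ∀ M' ∈ pmSet W G, ((M ∩ M').card : ℝ) = ∑ A ∈ M, if A ∈ M' then (1 : ℝ) else 0 := by
      intro M' _
      rw [sum_boole, filter_mem_eq_inter]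
    rw [sum_congr rfl this, sum_comm]
    refine sum_congr rfl fun A hA => ?_
    rw [sum_boole, phiSub_eq hG (hMG hA)]
  rw [sum_congr rfl h1, sum_phiSub hG]
  exact sum_congr rfl fun A _ => by ring

open scoped Classical in
lemma half_good {r ℓ s : ℕ} (hr : 0 < r) (hℓ : 0 < ℓ) (hs : 0 < s) {W : Finset ℕ}
    {G : Finset (Finset ℕ)} (hW : W.card = r * ℓ) (hG : G ⊆ powersetCard r W)
    (hm : 4 * ℓ ≤ G.card) (h8 : 8 * s ≤ G.card) (c τ σ : ℝ) (hτ0 : 0 ≤ τ)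
    (hc : 8 * (s : ℝ) * ℓ / G.card ≤ c) (hτc : 4 * τ * Real.exp c ≤ 1 / 100)
    (hp2 : ∑ A ∈ G, (phiSub W G A : ℝ) ^ 2 ≤ τ * ℓ * (pmCount W G : ℝ) ^ 2)
    (hΦ : 0 < pmCount W G)
    (𝓑 : Finset (Finset ℕ)) (h𝓑 : 𝓑 ⊆ powersetCard r W \ G)
    (h𝓑2 : ∀ U ∈ 𝓑, 160 * (G.card / ℓ : ℝ) * phiSub W G U < pmCount W G)
    (hσ : 0 < σ) (h𝓑3 : σ / 2 * (powersetCard r W).card ≤ 𝓑.card) :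
    (1 / 2 : ℝ) * (paths s G).card ≤ (((paths s G).filter (fun l =>
      1 / 2 * (avoidP s ℓ G.card * pmCount W G) ≤ (pmCount W (G \ l.toFinset) : ℝ) ∧
      σ / 4 * s ≤ addF (badFrac (powersetCard r W) (badD W (G.card / ℓ))) G l)).card : ℝ) := by
  set m := G.card with hmdef
  set Ω := powersetCard r W with hΩ
  set D : ℝ := (m : ℝ) / (ℓ : ℝ) with hD
  set Φ : ℝ := ((pmCount W G : ℕ) : ℝ) with hΦdef
  have hΦ' : 0 < Φ := by rw [hΦdef]; exact_mod_cast hΦ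
  have hm0 : 0 < m := by omega
  have hm' : (0 : ℝ) < m := by exact_mod_cast hm0
  have hℓ' : (0 : ℝ) < ℓ := by exact_mod_cast hℓ
  have hs' : (0 : ℝ) < s := by exact_mod_cast hs
  have hD0 : 0 < D := by positivity
  set P : ℝ := (((paths s G).card : ℕ) : ℝ) with hP
  have hP0 : 0 ≤ P := by positivity
  have hG' := edges_ok hr hG
  have hN : (0 : ℝ) < Ω.card := lt_of_lt_of_le hm' (by exact_mod_cast card_le_card hG)
  have h𝓑p : (0 : ℝ) < 𝓑.card := lt_of_lt_of_le (by positivity) h𝓑3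
  have hpm : ∀ M ∈ pmSet W G, M ⊆ G ∧ M.card = ℓ := fun M hM =>
    ⟨(mem_pmSet.1 hM).1, pm_card hr hW hG hM⟩
  -- low Φ events
  have cheb : ∀ j ≤ s, (((paths s G).filter (fun l =>
      (pmCount W (G \ (l.take j).toFinset) : ℝ) < 1 / 2 * (avoidP j ℓ m * Φ))).card : ℝ)
      ≤ 1 / 100 * P := by
    intro j hj
    have := moment2 s j ℓ G (pmSet W G) hpm hj (by omega) hℓ hm (by omega) c τ hτ0 (by
      refine le_trans ?_ hc
      gcongr) (by rw [inter_sum hG']; exact hp2)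
    simp_rw [pmCount_sdiff]
    exact this.trans (mul_le_mul_of_nonneg_right hτc hP0)
  have hav : ∀ j ≤ s, 0 < avoidP j ℓ m := fun j hj =>
    lt_of_lt_of_le (Real.exp_pos _) (avoidP_lower j ℓ m hm (by omega) hm0)
  -- Markov for U
  have mark : ∀ j ≤ s, ∀ U ∈ 𝓑, (((paths s G).filter (fun l =>
      avoidP j ℓ m * Φ / (4 * D) ≤ (phiSub W (G \ (l.take j).toFinset) U : ℝ))).card : ℝ)
      ≤ 1 / 20 * P := by
    intro j hj U hU
    have hUΩ := mem_powersetCard.1 (mem_sdiff.1 (h𝓑 hU)).1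
    have hWU : (W \ U).card = r * (ℓ - 1) := by
      rw [card_sdiff_of_subset hUΩ.1, hUΩ.2, hW, Nat.mul_sub, mul_one]
    have hGU := minus_sub_powersetCard hG U
    have h1 := moment1 s j (ℓ - 1) G (pmSet (W \ U) (minus G U)) (fun M hM =>
      ⟨(mem_pmSet.1 hM).1.trans (minus_subset _ _), pm_card hr hWU hGU hM⟩) hj (by omega)
    have h2 : ∑ l ∈ paths s G, (phiSub W (G \ (l.take j).toFinset) U : ℝ) =
        avoidP j (ℓ - 1) m * phiSub W G U * P := by
      simp_rw [phiSub_sdiff]; exact h1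
    set y := avoidP j ℓ m * Φ / (4 * D) with hy
    have hy0 : 0 < y := by have := hav j hj; positivity
    have h3 : (((paths s G).filter (fun l =>
      y ≤ (phiSub W (G \ (l.take j).toFinset) U : ℝ))).card : ℝ) * y ≤
        ∑ l ∈ paths s G, (phiSub W (G \ (l.take j).toFinset) U : ℝ) := by
      rw [← nsmul_eq_mul]
      refine (card_nsmul_le_sum _ _ _ fun l hl => (mem_filter.1 hl).2).trans ?_
      exact sum_le_sum_of_subset_of_nonneg (filter_subset _ _) fun _ _ _ => by positivity
    rw [h2] at h3
    have h4 := avoidP_ratio1 j ℓ m hm (by omega) hℓ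
    have h5 : (phiSub W G U : ℝ) ≤ Φ / (160 * D) := by
      rw [le_div_iff₀ (by positivity)]
      have := h𝓑2 U hU
      linarith
    have h6 : avoidP j (ℓ - 1) m * phiSub W G U * P ≤ (1 / 20 * P) * y := by
      calc _ ≤ (2 * avoidP j ℓ m) * (Φ / (160 * D)) * P := by
            have := hav j hj
            gcongr
        _ = _ := by rw [hy]; field_simp; ring
    exact le_of_mul_le_mul_right (h3.trans h6) hy0
  -- not bad
  have nb : ∀ j ≤ s, ∀ U ∈ 𝓑, (((paths s G).filter (fun l =>
      ¬ badD W D (G \ (l.take j).toFinset) U)).card : ℝ) ≤ 3 / 50 * P := by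
    intro j hj U hU
    have hsub : (paths s G).filter (fun l => ¬ badD W D (G \ (l.take j).toFinset) U) ⊆
        (paths s G).filter (fun l =>
          (pmCount W (G \ (l.take j).toFinset) : ℝ) < 1 / 2 * (avoidP j ℓ m * Φ)) ∪
        (paths s G).filter (fun l =>
          avoidP j ℓ m * Φ / (4 * D) ≤ (phiSub W (G \ (l.take j).toFinset) U : ℝ)) := by
      intro l hl
      obtain ⟨hl1, hl2⟩ := mem_filter.1 hl
      rw [mem_union, mem_filter, mem_filter]
      by_contra hcon
      push Not at hcon
      have ha := hcon.1 hl1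
      have hb := hcon.2 hl1
      apply hl2
      refine ⟨card_pos.1 ?_, ?_⟩
      · have := (mem_powersetCard.1 (mem_sdiff.1 (h𝓑 hU)).1).2
        omega
      · rw [lt_div_iff₀ (by positivity)] at hb
        linarith
    have h1 := (card_le_card hsub).trans (card_union_le _ _)
    have h2 := (Nat.cast_le (α := ℝ)).2 h1
    push_cast at h2
    linarith [cheb j hj, mark j hj U hU]
  set Z : List (Finset ℕ) → ℝ := fun l => ∑ j ∈ range s,
    ((𝓑.filter (fun U => ¬ badD W D (G \ (l.take (j + 1)).toFinset) U)).card : ℝ) with hZ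
  have hEZ : ∑ l ∈ paths s G, Z l ≤ s * 𝓑.card * (3 / 50 * P) := by
    simp only [hZ]
    rw [sum_comm]
    calc _ ≤ ∑ j ∈ range s, 𝓑.card * (3 / 50 * P) := by
          refine sum_le_sum fun j hj => ?_
          simp_rw [← sum_boole]
          rw [sum_comm]
          simp_rw [sum_boole]
          rw [← nsmul_eq_mul]
          exact sum_le_card_nsmul _ _ _ fun U hU => nb (j + 1) (mem_range.1 hj) U hU
      _ = _ := by rw [sum_const, card_range, nsmul_eq_mul]; ring
  have hA2 : (((paths s G).filter (fun l => s * 𝓑.card / 2 ≤ Z l)).card : ℝ) ≤ 3 / 25 * P := by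
    have h1 : (((paths s G).filter (fun l => s * 𝓑.card / 2 ≤ Z l)).card : ℝ) * (s * 𝓑.card / 2) ≤
        ∑ l ∈ paths s G, Z l := by
      rw [← nsmul_eq_mul]
      refine (card_nsmul_le_sum _ _ _ fun l hl => (mem_filter.1 hl).2).trans ?_
      exact sum_le_sum_of_subset_of_nonneg (filter_subset _ _) fun _ _ _ =>
        sum_nonneg fun _ _ => by positivity
    have h2 : (s * 𝓑.card : ℝ) * (3 / 50 * P) = (3 / 25 * P) * (s * 𝓑.card / 2) := by ring
    exact le_of_mul_le_mul_right ((h1.trans hEZ).trans h2.le) (by positivity)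
  have hA1 := cheb s le_rfl
  have hcover : paths s G ⊆ ((paths s G).filter (fun l =>
      1 / 2 * (avoidP s ℓ m * Φ) ≤ (pmCount W (G \ l.toFinset) : ℝ) ∧
      σ / 4 * s ≤ addF (badFrac Ω (badD W D)) G l)) ∪
      ((paths s G).filter (fun l =>
      (pmCount W (G \ (l.take s).toFinset) : ℝ) < 1 / 2 * (avoidP s ℓ m * Φ)) ∪
      (paths s G).filter (fun l => s * 𝓑.card / 2 ≤ Z l)) := by
    intro l hl
    rw [mem_union, mem_union, mem_filter, mem_filter, mem_filter]
    by_contra hcon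
    push Not at hcon
    obtain ⟨h1, h2, h3⟩ := hcon
    have hlen := length_paths hl
    have h2' := h2 hl
    rw [List.take_of_length_le hlen.le] at h2'
    have h4 := h1 hl h2'
    have h3' := h3 hl
    have h5 : ∀ j ∈ range s, ((𝓑.card : ℝ) - ((𝓑.filter (fun U =>
        ¬ badD W D (G \ (l.take (j + 1)).toFinset) U)).card : ℝ)) / Ω.card ≤
        badFrac Ω (badD W D) (G \ (l.take (j + 1)).toFinset) := by
      intro j _
      set G' := G \ (l.take (j + 1)).toFinset with hG'
      unfold badFrac
      have e1 : (𝓑.card : ℝ) - ((𝓑.filter (fun U => ¬ badD W D G' U)).card : ℝ) =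
          ((𝓑.filter (fun U => badD W D G' U)).card : ℝ) := by
        have := card_filter_add_card_filter_not (s := 𝓑) (fun U => badD W D G' U)
        rw [← this]; push_cast; ring
      rw [e1]
      have hsub : 𝓑 ⊆ Ω \ G' := h𝓑.trans (sdiff_subset_sdiff le_rfl sdiff_subset)
      have hpos : (0 : ℝ) < (Ω \ G').card := lt_of_lt_of_le h𝓑p (by exact_mod_cast card_le_card hsub)
      apply div_le_div₀ (by positivity) _ hpos
      · exact_mod_cast card_le_card sdiff_subset
      · exact_mod_cast card_le_card (filter_subset_filter _ hsub)
    have h6 : ((s : ℝ) * 𝓑.card - Z l) / Ω.card ≤ addF (badFrac Ω (badD W D)) G l := by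
      rw [addF_eq, hlen]
      refine le_trans (le_of_eq ?_) (sum_le_sum h5)
      rw [← sum_div, sum_sub_distrib]
      simp [hZ]
    have h7 : σ / 4 * s ≤ ((s : ℝ) * 𝓑.card - Z l) / Ω.card := by
      rw [le_div_iff₀ hN]
      have : (s : ℝ) / 2 * (σ / 2 * Ω.card) ≤ s / 2 * 𝓑.card := by gcongr
      linarith
    linarith
  have h1 := (card_le_card hcover).trans ((card_union_le _ _).trans
    (Nat.add_le_add_left (card_union_le _ _) _))
  have h2 := (Nat.cast_le (α := ℝ)).2 h1
  push_cast at h2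
  linarith


lemma Cod_mono {W : Finset ℕ} {G G' : Finset (Finset ℕ)} {c c' : ℝ} (h : G' ⊆ G) (hc : c ≤ c')
    (hG : Cod W G c) : Cod W G' c' := by
  intro x hx y hy hxy
  refine le_trans ?_ ((hG x hx y hy hxy).trans hc)
  exact_mod_cast card_le_card (filter_subset_filter _ h)

open scoped Classical in
set_option maxHeartbeats 1000000 in
lemma PropF (r : ℕ) (hr : 0 < r) (σ : ℝ) (hσ : 0 < σ) (k : ℝ) (hk : 0 < k) :
    ∃ δ0 : ℝ, 0 < δ0 ∧ ∃ ℓ0 : ℕ, ∀ ℓ : ℕ, ℓ0 ≤ ℓ → ∀ W : Finset ℕ, W.card = r * ℓ →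
    ∀ m : ℕ, 1 / 2 * (ℓ : ℝ) * Real.log ℓ ≤ m →
    (((powersetCard m (powersetCard r W)).filter (fun G => Cod W G (δ0 * m / ℓ) ∧
      Adash r ℓ W G δ0 ∧ σ * (powersetCard r W).card <
        (((powersetCard r W).filter (fun U =>
          160 * (m / ℓ : ℝ) * phiSub W G U < pmCount W G)).card : ℝ))).card : ℝ) ≤
      Real.exp (-(k * Real.log ℓ)) * (powersetCard m (powersetCard r W)).card := by
  set M := 32 * (k + 1) / σ with hM
  have hM0 : 0 < M := by positivity
  set c := 32 * M with hc
  set τ := Real.exp (-c) / 400 with hτ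
  have hτ0 : 0 < τ := by positivity
  obtain ⟨δE, hδE, D0, hD0, ℓE, hE⟩ := E1 r hr (min (σ / 32) τ) (by positivity)
  set δ0 := δE / 2 with hδ0
  have hpos_δ0 : 0 < δ0 := by positivity
  refine ⟨δ0, hpos_δ0, max ℓE (max ⌈Real.exp (max 8 (max (4 * D0) (1 / M)))⌉₊
    (max ⌈32 * M⌉₊ (max ⌈(1 + 16 * M) / δ0⌉₊ 4))), ?_⟩
  intro ℓ hℓ W hW m hmℓ
  simp only [max_le_iff] at hℓ
  obtain ⟨hℓE, hℓL, hℓM, hℓδ, hℓ4⟩ := hℓ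
  have hℓ4' : (4 : ℝ) ≤ ℓ := by exact_mod_cast hℓ4
  have hℓ0 : (0 : ℝ) < ℓ := by linarith
  have hlog : max 8 (max (4 * D0) (1 / M)) ≤ Real.log ℓ :=
    (Real.le_log_iff_exp_le hℓ0).2 (Nat.ceil_le.1 hℓL)
  simp only [max_le_iff] at hlog
  obtain ⟨hlog8, hlogD, hlogM⟩ := hlog
  have hℓM' := Nat.ceil_le.1 hℓM
  have hℓδ' := Nat.ceil_le.1 hℓδ
  set L := Real.log ℓ with hL
  set s := ⌈M * L⌉₊ with hs
  have hML : 1 ≤ M * L := by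
    rw [div_le_iff₀ hM0] at hlogM; linarith
  have hs1 : M * L ≤ s := Nat.le_ceil _
  have hs2 : (s : ℝ) ≤ 2 * M * L := by
    have := Nat.ceil_lt_add_one (show 0 ≤ M * L by linarith)
    linarith
  have hspos : 0 < s := Nat.ceil_pos.2 (by linarith)
  have hs' : (0 : ℝ) < s := by exact_mod_cast hspos
  have hm4 : (4 : ℝ) * ℓ ≤ m := by nlinarith
  have hmpos : (0 : ℝ) < m := by linarith
  have hm4' : 4 * ℓ ≤ m := by exact_mod_cast hm4
  have hs8 : 8 * (s : ℝ) ≤ m := by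
    have : 32 * M * L ≤ ℓ * L := by gcongr
    linarith
  have hs8' : 8 * s ≤ m := by exact_mod_cast hs8
  have hcs : 8 * (s : ℝ) * ℓ / m ≤ c := by
    rw [div_le_iff₀ hmpos, hc]
    calc 8 * (s : ℝ) * ℓ ≤ 8 * (2 * M * L) * ℓ := by gcongr
      _ = 32 * M * (1 / 2 * ℓ * L) := by ring
      _ ≤ _ := by gcongr
  set Ω := powersetCard r W with hΩ
  set D : ℝ := (m : ℝ) / (ℓ : ℝ) with hD
  set Ev := (powersetCard m Ω).filter (fun G => Cod W G (δ0 * m / ℓ) ∧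
      Adash r ℓ W G δ0 ∧ σ * Ω.card <
        ((Ω.filter (fun U => 160 * D * phiSub W G U < pmCount W G)).card : ℝ)) with hEv
  set σ' := σ / 32 with hσ'
  have hσ'0 : 0 < σ' := by positivity
  have hℓpos : 0 < ℓ := by omega
  -- each event graph has many good paths
  have main : ∀ G ∈ Ev, (1 / 2 : ℝ) * m.descFactorial s ≤
      (((paths s G).filter (fun l =>
        (∀ G', G \ l.toFinset ⊆ G' → G' ⊆ G → eGood (badD W D) σ' G') ∧
        σ / 4 * s ≤ addF (badFrac Ω (badD W D)) G l)).card : ℝ) := by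
    intro G hG
    obtain ⟨hG1, hcod, hAd, hbad⟩ := mem_filter.1 hG
    obtain ⟨hGΩ, hGm⟩ := mem_powersetCard.1 hG1
    have hDm : D0 * ℓ ≤ m := by nlinarith
    obtain ⟨hΦ, hi, hii⟩ := hE ℓ hℓE W G hW hGΩ (by rw [hGm]; exact hDm) δ0 hpos_δ0.le
      (by rw [hδ0]; linarith) (by rw [hGm]; exact hcod) hAd
    rw [hGm] at hi
    set 𝓑 := (Ω.filter (fun U => 160 * D * phiSub W G U < pmCount W G)) \ G with h𝓑
    have hNm : (m : ℝ) ≤ Ω.card := by rw [← hGm]; exact_mod_cast card_le_card hGΩ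
    have h𝓑3 : σ / 2 * Ω.card ≤ 𝓑.card := by
      have h1 : (Ω.filter (fun U => 160 * D * phiSub W G U < pmCount W G)) ⊆
          𝓑 ∪ G.filter (fun A => 2 * ((m : ℝ) / ℓ) * phiSub W G A < pmCount W G) := by
        intro U hU
        rw [mem_union]
        by_cases hUG : U ∈ G
        · right
          refine mem_filter.2 ⟨hUG, lt_of_le_of_lt ?_ (mem_filter.1 hU).2⟩
          have : 0 ≤ D * phiSub W G U := by positivity
          rw [← hD]; linarith
        · left; exact mem_sdiff.2 ⟨hU, hUG⟩
      have h2 := (Nat.cast_le (α := ℝ)).2 ((card_le_card h1).trans (card_union_le _ _))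
      push_cast at h2
      have h3 : min (σ / 32) τ * m ≤ σ / 32 * Ω.card :=
        mul_le_mul (min_le_left _ _) hNm hmpos.le (by positivity)
      have h4 : 0 ≤ σ * (Ω.card : ℝ) := by positivity
      linarith
    have hhalf := half_good hr hℓpos hspos hW hGΩ (by rw [hGm]; exact hm4')
      (by rw [hGm]; exact hs8') c τ σ hτ0.le (by rw [hGm]; exact hcs)
      (by
        rw [hτ, Real.exp_neg]
        have := Real.exp_pos c
        field_simp
        norm_num)
      (hii.trans (by gcongr; exact min_le_right _ _)) hΦ 𝓑
      (by
        intro U hU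
        rw [mem_sdiff] at hU ⊢
        exact ⟨(mem_filter.1 hU.1).1, hU.2⟩)
      (by
        intro U hU
        rw [hGm]
        exact (mem_filter.1 (mem_sdiff.1 hU).1).2) hσ h𝓑3
    rw [card_paths, hGm] at hhalf
    refine hhalf.trans ?_
    norm_cast
    apply card_le_card
    intro l hl
    obtain ⟨hl1, hl2, hl3⟩ := mem_filter.1 hl
    refine mem_filter.2 ⟨hl1, ?_, hl3⟩
    intro G' hG'1 hG'2
    have hG'm : (m : ℝ) / 2 ≤ G'.card := by
      have h1 : m - s ≤ G'.card := by
        refine le_trans ?_ (card_le_card hG'1)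
        have h2 := le_card_sdiff l.toFinset G
        have h3 : l.toFinset.card ≤ s := by
          rw [← length_paths hl1]; exact List.toFinset_card_le _
        omega
      have : (m : ℝ) - s ≤ G'.card := by
        rw [← Nat.cast_sub (by omega)]; exact_mod_cast h1
      linarith
    have hG'm2 : (G'.card : ℝ) ≤ m := by rw [← hGm]; exact_mod_cast card_le_card hG'2
    have hav : Real.exp (-(16 * M)) ≤ avoidP s ℓ m := by
      refine le_trans (Real.exp_le_exp.2 ?_) (avoidP_lower s ℓ m hm4' (by omega) (by omega))
      have : 4 * (s : ℝ) * ℓ / m = (8 * (s : ℝ) * ℓ / m) / 2 := by ring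
      rw [this]
      linarith
    have hcod' : Cod W G' (δE * G'.card / ℓ) := by
      refine Cod_mono hG'2 ?_ hcod
      apply div_le_div_of_nonneg_right _ hℓ0.le
      rw [hδ0]
      nlinarith
    have hAd' : Adash r ℓ W G' δE := by
      unfold Adash at hAd ⊢
      rw [hGm] at hAd
      have h1 : (pmCount W (G \ l.toFinset) : ℝ) ≤ pmCount W G' := by
        exact_mod_cast pmCount_mono hG'1
      have h2 : (pmCount W G : ℝ) ≤ 2 * Real.exp (16 * M) * pmCount W G' := by
        have h3 : 1 / 2 * (Real.exp (-(16 * M)) * pmCount W G) ≤ (pmCount W G' : ℝ) := by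
          refine le_trans ?_ (hl2.trans h1)
          gcongr
        rw [Real.exp_neg] at h3
        have := Real.exp_pos (16 * M)
        calc (pmCount W G : ℝ) = 2 * Real.exp (16 * M) *
              (1 / 2 * ((Real.exp (16 * M))⁻¹ * pmCount W G)) := by field_simp
          _ ≤ _ := by gcongr
      have h4 : 2 * Real.exp (16 * M) ≤ Real.exp (δ0 * ℓ) := by
        have : (2 : ℝ) ≤ Real.exp 1 := by linarith [Real.add_one_le_exp (1 : ℝ)]
        calc 2 * Real.exp (16 * M) ≤ Real.exp 1 * Real.exp (16 * M) := by gcongr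
          _ = Real.exp (1 + 16 * M) := by rw [Real.exp_add]
          _ ≤ _ := by
            apply Real.exp_le_exp.2
            rw [div_le_iff₀ hpos_δ0] at hℓδ'
            linarith
      calc (G'.card : ℝ) ^ ℓ ≤ (m : ℝ) ^ ℓ := by gcongr
        _ ≤ ℓ.factorial * pmCount W G * Real.exp ((r + δ0) * ℓ) := hAd
        _ ≤ ℓ.factorial * (2 * Real.exp (16 * M) * pmCount W G') * Real.exp ((r + δ0) * ℓ) := by gcongr
        _ ≤ ℓ.factorial * (Real.exp (δ0 * ℓ) * pmCount W G') * Real.exp ((r + δ0) * ℓ) := by gcongr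
        _ = ℓ.factorial * pmCount W G' * (Real.exp (δ0 * ℓ) * Real.exp ((r + δ0) * ℓ)) := by ring
        _ = _ := by rw [← Real.exp_add]; congr 2; rw [hδ0]; ring
    have hD2 : D0 * ℓ ≤ G'.card := by
      refine le_trans ?_ hG'm
      nlinarith
    obtain ⟨-, hi', -⟩ := hE ℓ hℓE W G' hW (hG'2.trans hGΩ) hD2 δE hδE.le le_rfl hcod' hAd'
    unfold eGood
    calc _ ≤ ((G'.filter (fun A => 2 * ((G'.card : ℝ) / ℓ) * phiSub W G' A < pmCount W G')).card : ℝ) := by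
          norm_cast
          apply card_le_card
          intro A hA
          obtain ⟨hA1, hA2⟩ := mem_filter.1 hA
          refine mem_filter.2 ⟨hA1, lt_of_le_of_lt ?_ hA2.2⟩
          have : (G'.card : ℝ) / ℓ ≤ D := by rw [hD]; gcongr
          gcongr
      _ ≤ _ := hi'.trans (by gcongr; exact min_le_left _ _)
  have hchain := chain_lemma Ω (badD W D) σ' hσ'0.le (badD_erase W D) s m (σ / 4)
  have hsum : (Ev.card : ℝ) * (1 / 2 * m.descFactorial s) ≤
      Real.exp (-(σ / 4 * s / 4)) * (1 + (1 + σ') ^ s) * (Ω.card.choose m * m.descFactorial s) := by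
    refine le_trans ?_ hchain
    rw [← nsmul_eq_mul]
    refine (card_nsmul_le_sum _ _ _ main).trans ?_
    exact sum_le_sum_of_subset_of_nonneg (filter_subset _ _) fun _ _ _ => by positivity
  have hdf : (0 : ℝ) < m.descFactorial s := by
    have : 0 < m.descFactorial s := Nat.pos_of_ne_zero (by
      rw [Ne, Nat.descFactorial_eq_zero_iff_lt]; omega)
    exact_mod_cast this
  have h1 : (Ev.card : ℝ) ≤ 2 * Real.exp (-(σ / 4 * s / 4)) * (1 + (1 + σ') ^ s) * Ω.card.choose m := by
    refine le_of_mul_le_mul_right (a := 1 / 2 * (m.descFactorial s : ℝ)) ?_ (by positivity)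
    refine hsum.trans (le_of_eq ?_)
    ring
  have h2 : (1 + (1 + σ') ^ s) ≤ 2 * Real.exp (s * σ') := by
    have a : (1 + σ') ^ s ≤ Real.exp (s * σ') := by
      rw [Real.exp_nat_mul]
      gcongr
      linarith [Real.add_one_le_exp σ']
    have b : 1 ≤ Real.exp (s * σ') := Real.one_le_exp (by positivity)
    linarith
  rw [card_powersetCard]
  refine h1.trans (mul_le_mul_of_nonneg_right ?_ (by positivity))
  calc 2 * Real.exp (-(σ / 4 * s / 4)) * (1 + (1 + σ') ^ s) ≤
      2 * Real.exp (-(σ / 4 * s / 4)) * (2 * Real.exp (s * σ')) := by gcongr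
    _ = 4 * Real.exp (-(σ / 32) * s) := by
      rw [mul_mul_mul_comm, ← Real.exp_add]; norm_num; rw [hσ']; ring
    _ ≤ Real.exp L * Real.exp (-(σ / 32) * (M * L)) := by
      apply mul_le_mul _ _ (Real.exp_pos _).le (Real.exp_pos _).le
      · rw [hL, Real.exp_log hℓ0]; exact hℓ4'
      · apply Real.exp_le_exp.2
        rw [neg_mul, neg_mul]
        apply neg_le_neg
        gcongr
    _ = _ := by
      rw [← Real.exp_add]
      congr 1
      have : σ / 32 * M = k + 1 := by rw [hM]; field_simp
      rw [neg_mul, ← mul_assoc, this]; ring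


section
variable {α : Type*} [DecidableEq α]

open scoped Classical in
lemma cond_fiber (Ω P : Finset α) (hP : P ⊆ Ω) (m : ℕ) (Q : Finset α → Prop) (T : Finset α)
    (hT : T ⊆ Ω \ P) :
    (((powersetCard m Ω).filter Q).filter (fun G => G \ P = T)).card =
      if T.card ≤ m then ((powersetCard (m - T.card) P).filter (fun L => Q (T ∪ L))).card else 0 := by
  split_ifs with h
  · refine card_bij' (fun G _ => G ∩ P) (fun L _ => T ∪ L) ?_ ?_ ?_ ?_
    · intro G hG
      simp only [mem_filter, mem_powersetCard] at hG ⊢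
      obtain ⟨⟨⟨h1, h2⟩, h3⟩, h4⟩ := hG
      have e : T ∪ G ∩ P = G := by rw [← h4]; exact sdiff_union_inter G P
      refine ⟨⟨inter_subset_right, ?_⟩, by rw [e]; exact h3⟩
      have := card_sdiff_add_card_inter G P
      rw [h4] at this
      omega
    · intro L hL
      simp only [mem_filter, mem_powersetCard] at hL ⊢
      obtain ⟨⟨h1, h2⟩, h3⟩ := hL
      have hd : Disjoint T P := disjoint_of_subset_left hT sdiff_disjoint
      refine ⟨⟨⟨union_subset (hT.trans sdiff_subset) (h1.trans hP), ?_⟩, h3⟩, ?_⟩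
      · rw [card_union_of_disjoint (hd.mono_right h1), h2]; omega
      · rw [union_sdiff_distrib, sdiff_eq_empty_iff_subset.2 h1, union_empty,
          sdiff_eq_self_of_disjoint hd]
    · intro G hG
      simp only [mem_filter, mem_powersetCard] at hG
      rw [← hG.2]; exact sdiff_union_inter G P
    · intro L hL
      simp only [mem_filter, mem_powersetCard] at hL
      have hd : Disjoint T P := disjoint_of_subset_left hT sdiff_disjoint
      rw [union_inter_distrib_right, disjoint_iff_inter_eq_empty.1 hd, empty_union,
        inter_eq_left.2 hL.1.1]
  · rw [card_eq_zero, filter_eq_empty_iff]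
    intro G hG hGT
    simp only [mem_filter, mem_powersetCard] at hG
    apply h
    rw [← hGT, ← hG.1.2]
    exact card_le_card sdiff_subset

open scoped Classical in
lemma cond_lemma (Ω P : Finset α) (hP : P ⊆ Ω) (m : ℕ) (Q : Finset α → Prop) (q : ℝ)
    (hq : ∀ T ⊆ Ω \ P, ∀ d : ℕ, (((powersetCard d P).filter (fun L => Q (T ∪ L))).card : ℝ) ≤
      q * (powersetCard d P).card) :
    (((powersetCard m Ω).filter Q).card : ℝ) ≤ q * (powersetCard m Ω).card := by
  have key : ∀ Q : Finset α → Prop, (((powersetCard m Ω).filter Q).card : ℝ) =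
      ∑ T ∈ (Ω \ P).powerset, ((if T.card ≤ m then
        ((powersetCard (m - T.card) P).filter (fun L => Q (T ∪ L))).card else 0 : ℕ) : ℝ) := by
    intro Q
    rw [card_eq_sum_card_fiberwise (f := fun G => G \ P) (t := (Ω \ P).powerset)]
    · push_cast
      refine sum_congr rfl fun T hT => ?_
      rw [cond_fiber Ω P hP m Q T (mem_powerset.1 hT)]
      push_cast; rfl
    · intro G hG
      have hG' : G ∈ (powersetCard m Ω).filter Q := hG
      simp only [mem_filter, mem_powersetCard] at hG'
      exact mem_coe.2 (mem_powerset.2 (sdiff_subset_sdiff hG'.1.1 le_rfl))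
  have h1 := key Q
  have h2 := key (fun _ => True)
  simp only [filter_true] at h2
  rw [h1, h2, mul_sum]
  refine sum_le_sum fun T hT => ?_
  split_ifs
  · exact hq T (mem_powerset.1 hT) _
  · simp

lemma choose_scale (b p h : ℕ) (σ : ℝ) (hσ0 : 0 ≤ σ) (hσ1 : σ ≤ 1) (hb : (b : ℝ) ≤ σ * p) :
    (b.choose h : ℝ) ≤ σ ^ h * p.choose h := by
  have gen : (b.descFactorial h : ℝ) ≤ σ ^ h * p.descFactorial h := by
    induction h with
    | zero => simp
    | succ h ih =>
      rw [Nat.descFactorial_succ, Nat.descFactorial_succ]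
      push_cast
      have h1 : ((b - h : ℕ) : ℝ) ≤ σ * ((p - h : ℕ) : ℝ) := by
        rcases le_total b h with hbh | hbh
        · rw [Nat.sub_eq_zero_of_le hbh]; simp; positivity
        · have hbp : b ≤ p := by
            have : (b : ℝ) ≤ p := hb.trans (mul_le_of_le_one_left (by positivity) hσ1)
            exact_mod_cast this
          rw [Nat.cast_sub hbh, Nat.cast_sub (hbh.trans hbp)]
          have : (0 : ℝ) ≤ h := by positivity
          nlinarith
      calc _ ≤ (σ * ((p - h : ℕ) : ℝ)) * (σ ^ h * p.descFactorial h) := by gcongr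
        _ = _ := by ring
  rw [Nat.descFactorial_eq_factorial_mul_choose, Nat.descFactorial_eq_factorial_mul_choose] at gen
  push_cast at gen
  have hf : (0 : ℝ) < h.factorial := by positivity
  refine le_of_mul_le_mul_left (a := (h.factorial : ℝ)) ?_ hf
  linarith

lemma link_lemma (P bad : Finset α) (hbad : bad ⊆ P) (d : ℕ) (σ a : ℝ) (ha : 0 ≤ a) (hσ0 : 0 ≤ σ)
    (hσ : 4 * σ ≤ Real.exp (-a)) (hb : (bad.card : ℝ) ≤ σ * P.card) :
    (((powersetCard d P).filter (fun L => 2 * (L \ bad).card < d)).card : ℝ) ≤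
      Real.exp (-(a * d / 2)) * (powersetCard d P).card := by
  have hexp : Real.exp (-a) ≤ 1 := Real.exp_le_one_iff.2 (by linarith)
  set h := (d + 1) / 2 with hh
  rcases Nat.lt_or_ge P.card d with hPd | hPd
  · rw [powersetCard_eq_empty.2 hPd]; simp
  rcases Nat.eq_zero_or_pos d with hd0 | hd0
  · subst hd0; simp
  have hsub : (powersetCard d P).filter (fun L => 2 * (L \ bad).card < d) ⊆
      (powersetCard h bad).biUnion (fun S => (powersetCard (d - h) (P \ S)).image (fun R => S ∪ R)) := by
    intro L hL
    simp only [mem_filter, mem_powersetCard] at hL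
    obtain ⟨⟨h1, h2⟩, h3⟩ := hL
    have h4 := card_sdiff_add_card_inter L bad
    obtain ⟨S, hS1, hS2⟩ := exists_subset_card_eq (show h ≤ (L ∩ bad).card by omega)
    simp only [mem_biUnion, mem_image, mem_powersetCard]
    have hSL : S ⊆ L := hS1.trans inter_subset_left
    refine ⟨S, ⟨hS1.trans inter_subset_right, hS2⟩, L \ S,
      ⟨sdiff_subset_sdiff h1 le_rfl, ?_⟩, ?_⟩
    · rw [card_sdiff_of_subset hSL, h2, hS2]
    · exact union_sdiff_of_subset hSL
  have hcard : ((powersetCard d P).filter (fun L => 2 * (L \ bad).card < d)).card ≤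
      bad.card.choose h * (P.card - h).choose (d - h) := by
    refine (card_le_card hsub).trans ?_
    refine (card_biUnion_le_card_mul _ _ ((P.card - h).choose (d - h)) ?_).trans_eq (by
      rw [card_powersetCard])
    intro S hS
    rw [mem_powersetCard] at hS
    refine card_image_le.trans ?_
    rw [card_powersetCard, card_sdiff_of_subset (hS.1.trans hbad), hS.2]
  have hmul := Nat.choose_mul (n := P.card) (k := d) (s := h) (by omega)
  have h5 := choose_scale bad.card P.card h σ hσ0 (by linarith) hb
  rw [card_powersetCard]
  calc _ ≤ ((bad.card.choose h * (P.card - h).choose (d - h) : ℕ) : ℝ) := by exact_mod_cast hcard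
    _ = (bad.card.choose h : ℝ) * (P.card - h).choose (d - h) := by push_cast; ring
    _ ≤ (σ ^ h * P.card.choose h) * (P.card - h).choose (d - h) := by gcongr
    _ = σ ^ h * ((P.card.choose h * (P.card - h).choose (d - h) : ℕ) : ℝ) := by push_cast; ring
    _ = σ ^ h * (P.card.choose d * d.choose h) := by rw [← hmul]; push_cast; ring
    _ ≤ σ ^ h * (P.card.choose d * 4 ^ h) := by
        gcongr
        have h6 : d.choose h ≤ 2 ^ d := Nat.choose_le_two_pow d h
        have h7 : (2 : ℕ) ^ d ≤ 4 ^ h := by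
          rw [show 4 = 2 ^ 2 by norm_num, ← pow_mul]
          exact Nat.pow_le_pow_right (by norm_num) (by omega)
        exact_mod_cast h6.trans h7
    _ = (4 * σ) ^ h * P.card.choose d := by rw [mul_pow]; ring
    _ ≤ (Real.exp (-a)) ^ h * P.card.choose d := by gcongr
    _ ≤ _ := by
        gcongr
        rw [← Real.exp_nat_mul]
        apply Real.exp_le_exp.2
        have : (d : ℝ) ≤ 2 * h := by
          have : d ≤ 2 * h := by omega
          exact_mod_cast this
        nlinarith

open scoped Classical in
lemma link_cond (Ω P : Finset α) (hP : P ⊆ Ω) (m : ℕ) (B : Finset α → Finset α)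
    (hB : ∀ G, B G = B (G \ P)) (hBP : ∀ G, B G ⊆ P) (σ a d0 : ℝ) (ha : 0 ≤ a) (hσ0 : 0 ≤ σ)
    (hσ : 4 * σ ≤ Real.exp (-a)) :
    (((powersetCard m Ω).filter (fun G => ((B G).card : ℝ) ≤ σ * P.card ∧
      d0 ≤ ((G ∩ P).card : ℝ) ∧ 2 * ((G ∩ P) \ B G).card < (G ∩ P).card)).card : ℝ) ≤
      Real.exp (-(a * d0 / 2)) * (powersetCard m Ω).card := by
  obtain ⟨Q, hQ⟩ : ∃ Q : Finset α → Prop, ∀ G, Q G ↔ (((B G).card : ℝ) ≤ σ * P.card ∧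
      d0 ≤ ((G ∩ P).card : ℝ) ∧ 2 * ((G ∩ P) \ B G).card < (G ∩ P).card) := ⟨_, fun _ => Iff.rfl⟩
  simp only [← hQ]
  refine le_trans (le_of_eq ?_) (cond_lemma Ω P hP m Q (Real.exp (-(a * d0 / 2))) ?_)
  · congr!
  intro T hT d
  have hd : Disjoint T P := disjoint_of_subset_left hT sdiff_disjoint
  have e1 : ∀ L ⊆ P, (T ∪ L) \ P = T := fun L hL => by
    rw [union_sdiff_distrib, sdiff_eq_empty_iff_subset.2 hL, union_empty,
          sdiff_eq_self_of_disjoint hd]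
  have e2 : ∀ L ⊆ P, (T ∪ L) ∩ P = L := fun L hL => by
    rw [union_inter_distrib_right, disjoint_iff_inter_eq_empty.1 hd, empty_union,
        inter_eq_left.2 hL]
  by_cases hc : ((B T).card : ℝ) ≤ σ * P.card ∧ d0 ≤ (d : ℝ)
  · refine le_trans ?_ ((link_lemma P (B T) (hBP T) d σ a ha hσ0 hσ hc.1).trans ?_)
    · refine Nat.cast_le.2 (card_le_card ?_)
      intro L hL
      rw [mem_filter, mem_powersetCard] at hL ⊢
      obtain ⟨⟨h1, h2⟩, h3⟩ := hL
      obtain ⟨-, -, h3⟩ := (hQ _).1 h3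
      rw [hB, e1 L h1, e2 L h1] at h3
      exact ⟨⟨h1, h2⟩, by omega⟩
    · refine mul_le_mul_of_nonneg_right (Real.exp_le_exp.2 ?_) (Nat.cast_nonneg _)
      clear hQ
      have := mul_le_mul_of_nonneg_left hc.2 ha
      linarith only [this]
  · rw [filter_eq_empty_iff.2]
    · rw [card_empty, Nat.cast_zero]
      exact mul_nonneg (Real.exp_pos _).le (Nat.cast_nonneg _)
    · intro L hL hcon
      rw [mem_powersetCard] at hL
      apply hc
      rw [hQ, hB, e1 L hL.1, e2 L hL.1, hL.2] at hcon
      exact ⟨hcon.1, hcon.2.1⟩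
end


lemma gamma_sum (N : ℕ) (t : ℕ) (ht : t < N) :
    ∑ i ∈ Icc 1 t, (1 : ℝ) / ((N : ℝ) - (i : ℝ) + 1) ≤ Real.log N - Real.log ((N : ℝ) - t) := by
  induction t with
  | zero => simp
  | succ t ih =>
    rw [sum_Icc_succ_top (by omega)]
    have := ih (by omega)
    push_cast at *
    have hN : (t : ℝ) + 1 < N := by exact_mod_cast ht
    have h1 := Real.log_le_sub_one_of_pos (x := ((N : ℝ) - (t + 1)) / (N - t)) (by
      apply div_pos <;> linarith)
    rw [Real.log_div (by linarith) (by linarith)] at h1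
    have h2 : ((N : ℝ) - (t + 1)) / (N - t) - 1 = - (1 / ((N : ℝ) - (t + 1) + 1)) := by
      have a : (N : ℝ) - t ≠ 0 := by linarith
      have b : (N : ℝ) - (t + 1) + 1 ≠ 0 := by intro h; apply a; linarith
      rw [show (N : ℝ) - (t + 1) + 1 = N - t by ring]
      field_simp
      ring
    rw [h2] at h1
    linarith

lemma propA_Adash (r : ℕ) (hr : 0 < r) (ℓ : ℕ) (hℓ : 0 < ℓ) (G : Finset (Finset ℕ))
    (hG : G ⊆ powersetCard r (range (r * ℓ))) (δ : ℝ) (hδ1 : δ ≤ 1)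
    (hm : Real.exp (2 * r) * ℓ ≤ G.card) (hA : propA r (r * ℓ) G δ) :
    Adash r ℓ (range (r * ℓ)) G (r * δ) := by
  unfold propA at hA
  unfold Adash
  have hℓ' : (0 : ℝ) < ℓ := by exact_mod_cast hℓ
  have hr' : (0 : ℝ) < r := by exact_mod_cast hr
  have hmpos : (0 : ℝ) < G.card := lt_of_lt_of_le (by positivity) hm
  have hmN : G.card ≤ (r * ℓ).choose r := by
    have := card_le_card hG
    rwa [card_powersetCard, card_range] at this
  set m := G.card with hmdef
  set n := r * ℓ with hn
  set N := n.choose r with hN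
  set Φ := pmCount (range n) G with hΦ
  have hn' : (n : ℝ) = r * ℓ := by rw [hn]; push_cast; ring
  have hnpos : (0 : ℝ) < n := by rw [hn']; positivity
  have hNpos : (0 : ℝ) < N := hmpos.trans_le (by exact_mod_cast hmN)
  have hmpos' : 0 < m := by exact_mod_cast hmpos
  have hnr : n / r = ℓ := by rw [hn]; exact Nat.mul_div_cancel_left ℓ hr
  have hnr' : (n : ℝ) / r = ℓ := by rw [hn']; field_simp
  rw [hnr, hnr'] at hA
  have hsum : ∑ i ∈ Icc 1 (N - m), (ℓ : ℝ) / ((N : ℝ) - (i : ℝ) + 1) ≤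
      ℓ * (Real.log N - Real.log m) := by
    have := gamma_sum N (N - m) (by omega)
    rw [Nat.cast_sub hmN, sub_sub_cancel] at this
    refine le_trans (le_of_eq ?_) (mul_le_mul_of_nonneg_left this hℓ'.le)
    rw [mul_sum]
    refine sum_congr rfl fun i _ => ?_
    ring
  have hlog0 : Real.log ((n.factorial : ℝ) / ((ℓ.factorial : ℝ) * (r.factorial : ℝ) ^ ℓ)) =
      Real.log n.factorial - Real.log ℓ.factorial - ℓ * Real.log r.factorial := by
    rw [Real.log_div (by positivity) (by positivity), Real.log_mul (by positivity) (by positivity),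
      Real.log_pow]
    ring
  have hNle : Real.log N ≤ r * Real.log n - Real.log r.factorial := by
    have h := Nat.choose_le_pow_div (α := ℝ) r n
    have := Real.log_le_log hNpos h
    rwa [Real.log_div (by positivity) (by positivity), Real.log_pow] at this
  have hnfac : n * Real.log n - n ≤ Real.log n.factorial := by
    have h := Real.pow_div_factorial_le_exp (n : ℝ) hnpos.le n
    have := Real.log_le_log (by positivity) h
    rw [Real.log_div (by positivity) (by positivity), Real.log_pow, Real.log_exp] at this
    linarith
  have hℓfac : Real.log ℓ.factorial ≤ ℓ * Real.log ℓ := by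
    have h : (ℓ.factorial : ℝ) ≤ (ℓ : ℝ) ^ ℓ := by exact_mod_cast Nat.factorial_le_pow ℓ
    have := Real.log_le_log (by positivity) h
    rwa [Real.log_pow] at this
  have hlogm : 2 * r + Real.log ℓ ≤ Real.log m := by
    have := Real.log_le_log (by positivity) hm
    rwa [Real.log_mul (by positivity) (by positivity), Real.log_exp] at this
  have key : ℓ * Real.log m - Real.log ℓ.factorial - n - δ * n < Real.log Φ := by
    rw [hlog0] at hA
    have a := mul_le_mul_of_nonneg_left hNle hℓ'.le
    have b : ℓ * (r * Real.log n) = n * Real.log n := by rw [hn']; ring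
    nlinarith
  rcases Nat.eq_zero_or_pos Φ with h0 | h0
  · exfalso
    rw [h0] at key
    simp only [Nat.cast_zero, Real.log_zero] at key
    have a := mul_le_mul_of_nonneg_left hlogm hℓ'.le
    have b := mul_le_mul_of_nonneg_right hδ1 hnpos.le
    rw [hn'] at key b
    nlinarith
  · have h0' : (0 : ℝ) < Φ := by exact_mod_cast h0
    rw [← Real.log_le_log_iff (by positivity) (by positivity), Real.log_pow,
      Real.log_mul (by positivity) (by positivity), Real.log_mul (by positivity) (by positivity),
      Real.log_exp]
    rw [hn'] at key
    nlinarith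


open scoped Classical in
noncomputable def badU (r : ℕ) (W : Finset ℕ) (G : Finset (Finset ℕ)) (c : ℝ) : Finset (Finset ℕ) :=
  (powersetCard r W).filter (fun U => c * (phiSub W G U : ℝ) < pmCount W G)

def Q1 (r l : ℕ) (W : Finset ℕ) (δ0 σ : ℝ) (Z : Finset ℕ) (G : Finset (Finset ℕ)) : Prop :=
  1 / 2 * (l : ℝ) * Real.log l ≤ (minus G Z).card ∧
  Cod (W \ Z) (minus G Z) (δ0 * (minus G Z).card / l) ∧ Adash r l (W \ Z) (minus G Z) δ0 ∧
  σ * (powersetCard r (W \ Z)).card <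
    (badU r (W \ Z) (minus G Z) (160 * ((minus G Z).card / l : ℝ))).card

open scoped Classical in
lemma Q1_prob (r l : ℕ) (δ0 σ q : ℝ) (hq : 0 ≤ q)
    (hF : ∀ W : Finset ℕ, W.card = r * l → ∀ m : ℕ, 1 / 2 * (l : ℝ) * Real.log l ≤ m →
      (((powersetCard m (powersetCard r W)).filter (fun G => Cod W G (δ0 * m / l) ∧
        Adash r l W G δ0 ∧ σ * (powersetCard r W).card <
          (((powersetCard r W).filter (fun U => 160 * (m / l : ℝ) * (phiSub W G U : ℝ) <
            pmCount W G)).card : ℝ))).card : ℝ) ≤ q * (powersetCard m (powersetCard r W)).card)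
    (W Z : Finset ℕ) (hW : W.card = r * (l + 1)) (hZ : Z ∈ powersetCard r W) (m : ℕ) :
    (((powersetCard m (powersetCard r W)).filter (fun G => Q1 r l W δ0 σ Z G)).card : ℝ) ≤
      q * (powersetCard m (powersetCard r W)).card := by
  have hZ' := mem_powersetCard.1 hZ
  refine cond_lemma (powersetCard r W) (powersetCard r (W \ Z)) (powersetCard_mono sdiff_subset) m
    _ q ?_
  intro T hT d
  have e : ∀ L ⊆ powersetCard r (W \ Z), minus (T ∪ L) Z = L := by
    intro L hL
    ext A
    rw [mem_minus, mem_union]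
    constructor
    · rintro ⟨h1 | h1, h2⟩
      · exfalso
        have h3 := mem_sdiff.1 (hT h1)
        apply h3.2
        have h4 := mem_powersetCard.1 h3.1
        rw [mem_powersetCard, subset_sdiff]
        exact ⟨⟨h4.1, disjoint_iff_inter_eq_empty.2 h2⟩, h4.2⟩
      · exact h1
    · intro h1
      have h2 := mem_powersetCard.1 (hL h1)
      rw [subset_sdiff] at h2
      exact ⟨Or.inr h1, disjoint_iff_inter_eq_empty.1 h2.1.2⟩
  by_cases hd : 1 / 2 * (l : ℝ) * Real.log l ≤ d
  · have := hF (W \ Z) (by rw [card_sdiff_of_subset hZ'.1, hW, hZ'.2]; ring_nf; omega) d hd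
    refine le_trans ?_ this
    refine Nat.cast_le.2 (card_le_card ?_)
    intro L hL
    rw [mem_filter] at hL ⊢
    refine ⟨hL.1, ?_⟩
    have h1 := mem_powersetCard.1 hL.1
    have h2 := hL.2
    unfold Q1 badU at h2
    rw [e L h1.1, h1.2] at h2
    exact h2.2
  · rw [filter_eq_empty_iff.2]
    · rw [card_empty, Nat.cast_zero]
      exact mul_nonneg hq (Nat.cast_nonneg _)
    · intro L hL hcon
      apply hd
      have h1 := mem_powersetCard.1 hL
      have h2 := hcon.1
      rwa [e L h1.1, h1.2] at h2

open scoped Classical in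
lemma Q1_det (r l : ℕ) (hl : 1 ≤ l) (W Z : Finset ℕ) (hW : W.card = r * (l + 1))
    (hZ : Z ∈ powersetCard r W) (G : Finset (Finset ℕ)) 
    (δ0 δa σ K D : ℝ) (hδ0 : 0 < δ0) (hD : D = G.card / (l + 1 : ℝ)) (hD0 : 0 < D)
    (hA : Adash r (l + 1) W G δa) (hC : Cod W G (δ0 / 2 * D))
    (hdeg : ∀ x ∈ W, (deg G x : ℝ) ≤ K * D) (hZφ : (pmCount W G : ℝ) / D ≤ phiSub W G Z)
    (hlog : Real.log (l + 1) ≤ D) (hl1 : 2 * r * K ≤ l + 1) (hl2 : r + δa ≤ (δ0 - δa) * l)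
    (hnot : ¬ Q1 r l W δ0 σ Z G) :
    (((powersetCard r (W \ Z)).filter (fun U =>
      320 * D * (phiSub W G (Z ∪ U) : ℝ) < phiSub W G Z)).card : ℝ) ≤
      σ * (powersetCard r (W \ Z)).card := by
  have hZ' := mem_powersetCard.1 hZ
  have hl0 : (1 : ℝ) ≤ l := by exact_mod_cast hl
  have hmD : (G.card : ℝ) = D * (l + 1) := by rw [hD]; field_simp
  have hHm : (minus G Z).card ≤ G.card := card_le_card (minus_subset _ _)
  have hHm' : ((minus G Z).card : ℝ) ≤ G.card := by exact_mod_cast hHm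
  have hHl : (G.card : ℝ) / 2 ≤ (minus G Z).card := by
    have h1 : G ⊆ minus G Z ∪ Z.biUnion (fun z => G.filter (fun A => z ∈ A)) := by
      intro A hA
      by_cases h : A ∩ Z = ∅
      · exact mem_union_left _ (mem_minus.2 ⟨hA, h⟩)
      · obtain ⟨z, hz⟩ := nonempty_iff_ne_empty.2 h
        rw [mem_inter] at hz
        exact mem_union_right _ (mem_biUnion.2 ⟨z, hz.2, mem_filter.2 ⟨hA, hz.1⟩⟩)
    have h2 : (G.card : ℝ) ≤ (minus G Z).card + ∑ z ∈ Z, (deg G z : ℝ) := by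
      have := (card_le_card h1).trans ((card_union_le _ _).trans (Nat.add_le_add_left card_biUnion_le _))
      exact_mod_cast this
    have h3 : ∑ z ∈ Z, (deg G z : ℝ) ≤ r * (K * D) := by
      refine (sum_le_card_nsmul Z _ (K * D) (fun z hz => hdeg z (hZ'.1 hz))).trans_eq ?_
      rw [hZ'.2, nsmul_eq_mul]
    nlinarith
  by_contra hcon
  push Not at hcon
  apply hnot
  have hφ : phiSub W G Z = pmCount (W \ Z) (minus G Z) := rfl
  refine ⟨?_, ?_, ?_, lt_of_lt_of_le hcon ?_⟩
  · refine le_trans ?_ hHl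
    rw [hmD]
    have h1 : Real.log l ≤ Real.log (l + 1) := Real.log_le_log (by linarith) (by linarith)
    have h2 : 0 ≤ Real.log l := Real.log_nonneg hl0
    nlinarith
  · intro x hx y hy hxy
    have h1 : codeg (minus G Z) x y ≤ codeg G x y :=
      card_le_card (filter_subset_filter _ (minus_subset _ _))
    have h2 := hC x (sdiff_subset hx) y (sdiff_subset hy) hxy
    have h3 : (codeg (minus G Z) x y : ℝ) ≤ codeg G x y := by exact_mod_cast h1
    refine h3.trans (h2.trans ?_)
    rw [le_div_iff₀ (by linarith)]
    have : D * l ≤ 2 * (minus G Z).card := by nlinarith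
    nlinarith
  · unfold Adash at hA ⊢
    rw [← hφ]
    have hG0 : (0 : ℝ) < G.card := by rw [hmD]; positivity
    rw [div_le_iff₀ hD0] at hZφ
    refine le_of_mul_le_mul_right (a := (G.card : ℝ)) ?_ hG0
    calc ((minus G Z).card : ℝ) ^ l * G.card ≤ (G.card : ℝ) ^ l * G.card :=
          mul_le_mul_of_nonneg_right (pow_le_pow_left₀ (Nat.cast_nonneg _) hHm' _) hG0.le
      _ = (G.card : ℝ) ^ (l + 1) := by ring
      _ ≤ (l + 1).factorial * pmCount W G * Real.exp ((r + δa) * (l + 1 : ℕ)) := hA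
      _ ≤ (l + 1).factorial * (phiSub W G Z * D) * Real.exp ((r + δ0) * l) := by
          refine mul_le_mul (mul_le_mul_of_nonneg_left hZφ (Nat.cast_nonneg _))
            (Real.exp_le_exp.2 ?_) (Real.exp_pos _).le ?_
          · push_cast
            linarith
          · exact mul_nonneg (Nat.cast_nonneg _) (mul_nonneg (Nat.cast_nonneg _) hD0.le)
      _ = _ := by
          rw [hmD, Nat.factorial_succ]
          push_cast
          ring
  · refine Nat.cast_le.2 (card_le_card ?_)
    intro U hU
    unfold badU
    rw [mem_filter] at hU ⊢
    refine ⟨hU.1, ?_⟩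
    rw [phiSub_union, ← hφ]
    refine lt_of_le_of_lt ?_ hU.2
    apply mul_le_mul_of_nonneg_right _ (Nat.cast_nonneg _)
    have : ((minus G Z).card : ℝ) / l ≤ 2 * D := by
      rw [div_le_iff₀ (by linarith)]
      nlinarith
    linarith


lemma phiSub_sdiff_meets (W : Finset ℕ) (G P : Finset (Finset ℕ)) (V : Finset ℕ)
    (h : ∀ A ∈ P, A ∩ V ≠ ∅) : phiSub W (G \ P) V = phiSub W G V := by
  unfold phiSub
  congr 1
  ext A
  simp only [mem_minus, mem_sdiff]
  constructor
  · tauto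
  · rintro ⟨h1, h2⟩
    exact ⟨⟨h1, fun h3 => h A h3 h2⟩, h2⟩

def sm (W : Finset ℕ) (D : ℝ) (G : Finset (Finset ℕ)) (Z U : Finset ℕ) : Prop :=
  320 * D * (phiSub W G (Z ∪ U) : ℝ) < phiSub W G Z

def P2 (r : ℕ) (W Z : Finset ℕ) (x : ℕ) : Finset (Finset ℕ) :=
  (powersetCard r W).filter (fun A => A ∩ Z = {x})

open scoped Classical in
noncomputable def B2 (r : ℕ) (W : Finset ℕ) (D : ℝ) (Z : Finset ℕ) (x y : ℕ)
    (G : Finset (Finset ℕ)) : Finset (Finset ℕ) :=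
  (P2 r W Z x).filter (fun A => y ∈ A ∨ sm W D G Z (insert y (A.erase x)))

def Q2 (r : ℕ) (W : Finset ℕ) (D σ1 d0 : ℝ) (Z : Finset ℕ) (x y : ℕ)
    (G : Finset (Finset ℕ)) : Prop :=
  ((B2 r W D Z x y G).card : ℝ) ≤ σ1 * (P2 r W Z x).card ∧
    d0 ≤ ((G ∩ P2 r W Z x).card : ℝ) ∧
    2 * ((G ∩ P2 r W Z x) \ B2 r W D Z x y G).card < (G ∩ P2 r W Z x).card

open scoped Classical in
lemma mem_B2 {r : ℕ} {W : Finset ℕ} {D : ℝ} {Z : Finset ℕ} {x y : ℕ}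
    {G : Finset (Finset ℕ)} {A : Finset ℕ} : A ∈ B2 r W D Z x y G ↔
      A ∈ P2 r W Z x ∧ (y ∈ A ∨ sm W D G Z (insert y (A.erase x))) := by
  unfold B2
  rw [mem_filter]

lemma B2_indep (r : ℕ) (W : Finset ℕ) (D : ℝ) (Z : Finset ℕ) (x y : ℕ) (G : Finset (Finset ℕ)) :
    B2 r W D Z x y G = B2 r W D Z x y (G \ P2 r W Z x) := by
  have h : ∀ V, phiSub W (G \ P2 r W Z x) (Z ∪ V) = phiSub W G (Z ∪ V) := by
    intro V
    apply phiSub_sdiff_meets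
    intro A hA h
    have := (mem_filter.1 hA).2
    rw [inter_union_distrib_left, union_eq_empty] at h
    rw [h.1] at this
    exact (singleton_ne_empty x) this.symm
  have h0 := h ∅
  rw [union_empty] at h0
  unfold B2 sm
  simp only [h, h0]

open scoped Classical in
lemma Q2_prob (r : ℕ) (W : Finset ℕ) (D σ1 d0 a : ℝ) (ha : 0 ≤ a) (hσ0 : 0 ≤ σ1)
    (hσ : 4 * σ1 ≤ Real.exp (-a)) (Z : Finset ℕ) (x y m : ℕ) :
    (((powersetCard m (powersetCard r W)).filter (fun G => Q2 r W D σ1 d0 Z x y G)).card : ℝ) ≤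
      Real.exp (-(a * d0 / 2)) * (powersetCard m (powersetCard r W)).card := by
  refine le_trans (le_of_eq ?_) (link_cond (powersetCard r W) (P2 r W Z x) (filter_subset _ _) m
    (B2 r W D Z x y) (B2_indep r W D Z x y) (fun G => filter_subset _ _) σ1 a d0 ha hσ0 hσ)
  unfold Q2
  congr!

lemma Q2_det (r : ℕ) (hr : 0 < r) (W : Finset ℕ) (D σ1 d0 : ℝ) (hD : 0 ≤ D)
    (Z : Finset ℕ) (hZ : Z ⊆ W)
    (x y : ℕ) (hx : x ∈ Z) (hy : y ∈ W \ Z) (G : Finset (Finset ℕ)) (hG : G ⊆ powersetCard r W)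
    (h1 : ((B2 r W D Z x y G).card : ℝ) ≤ σ1 * (P2 r W Z x).card)
    (h2 : d0 ≤ ((G ∩ P2 r W Z x).card : ℝ)) (hn : ¬ Q2 r W D σ1 d0 Z x y G) :
    d0 / 2 * phiSub W G Z ≤ 320 * D * phiSub W G (insert y (Z.erase x)) := by
  unfold Q2 at hn
  have h3 : (G ∩ P2 r W Z x).card ≤ 2 * ((G ∩ P2 r W Z x) \ B2 r W D Z x y G).card := by
    by_contra h
    exact hn ⟨h1, h2, by omega⟩
  have h3' : ((G ∩ P2 r W Z x).card : ℝ) ≤ 2 * ((G ∩ P2 r W Z x) \ B2 r W D Z x y G).card := by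
    exact_mod_cast h3
  rw [mem_sdiff] at hy
  have hxy : x ≠ y := fun h => hy.2 (h ▸ hx)
  set Z' := insert y (Z.erase x) with hZ'
  have hxZ' : x ∈ W \ Z' := by
    rw [mem_sdiff, hZ', mem_insert, mem_erase]
    refine ⟨hZ hx, ?_⟩
    rintro (h | h)
    · exact hxy h
    · exact h.1 rfl
  have hv := pmCount_vertex (edges_ok hr (minus_sub_powersetCard hG Z')) hxZ'
  have hφ : phiSub W G Z' = pmCount (W \ Z') (minus G Z') := rfl
  rw [← hφ] at hv
  set S := (G ∩ P2 r W Z x) \ B2 r W D Z x y G with hS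
  have hSP : ∀ A ∈ S, A ∈ G ∧ A ∩ Z = {x} ∧ y ∉ A ∧ ¬ sm W D G Z (insert y (A.erase x)) := by
    intro A hA
    rw [hS, mem_sdiff, mem_inter] at hA
    have hP := (mem_filter.1 hA.1.2).2
    have hB : ¬ (y ∈ A ∨ sm W D G Z (insert y (A.erase x))) := by
      intro h
      exact hA.2 (mem_B2.2 ⟨hA.1.2, h⟩)
    push Not at hB
    exact ⟨hA.1.1, hP, hB.1, hB.2⟩
  have hsub : S ⊆ (minus G Z').filter (fun A => x ∈ A) := by
    intro A hA
    obtain ⟨a1, a2, a3, a4⟩ := hSP A hA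
    rw [mem_filter, mem_minus]
    have hxA : x ∈ A ∩ Z := by rw [a2]; exact mem_singleton_self x
    refine ⟨⟨a1, ?_⟩, (mem_inter.1 hxA).1⟩
    rw [eq_empty_iff_forall_notMem]
    intro z hz
    rw [mem_inter, hZ', mem_insert, mem_erase] at hz
    rcases hz.2 with h | h
    · exact a3 (h ▸ hz.1)
    · have : z ∈ A ∩ Z := mem_inter.2 ⟨hz.1, h.2⟩
      rw [a2, mem_singleton] at this
      exact h.1 this
  have hterm : ∀ A ∈ S, (phiSub W G Z : ℝ) ≤ 320 * D * phiSub (W \ Z') (minus G Z') A := by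
    intro A hA
    obtain ⟨a1, a2, a3, a4⟩ := hSP A hA
    rw [phiSub_union]
    have hxA : x ∈ A ∩ Z := by rw [a2]; exact mem_singleton_self x
    rw [mem_inter] at hxA
    have : Z' ∪ A = Z ∪ insert y (A.erase x) := by
      ext z
      simp only [hZ', mem_union, mem_insert, mem_erase]
      by_cases hzx : z = x
      · subst hzx; simp [hxA]
      · simp [hzx]; tauto
    rw [this]
    unfold sm at a4
    exact not_lt.1 a4
  calc d0 / 2 * phiSub W G Z ≤ (S.card : ℝ) * phiSub W G Z := by
        apply mul_le_mul_of_nonneg_right _ (Nat.cast_nonneg _)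
        linarith
    _ = ∑ A ∈ S, (phiSub W G Z : ℝ) := by rw [sum_const, nsmul_eq_mul]
    _ ≤ ∑ A ∈ S, 320 * D * (phiSub (W \ Z') (minus G Z') A : ℝ) := sum_le_sum hterm
    _ = 320 * D * ∑ A ∈ S, (phiSub (W \ Z') (minus G Z') A : ℝ) := by rw [mul_sum]
    _ ≤ _ := by
        rw [hv]
        apply mul_le_mul_of_nonneg_left _ (by linarith)
        exact sum_le_sum_of_subset_of_nonneg hsub (fun _ _ _ => Nat.cast_nonneg _)

lemma deg_P2 (r : ℕ) (W : Finset ℕ) (D δ : ℝ) (hδD : 0 ≤ δ * D) (Z : Finset ℕ)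
    (hZ : Z ∈ powersetCard r W) (x : ℕ) (hx : x ∈ Z) (G : Finset (Finset ℕ)) (hG : G ⊆ powersetCard r W)
    (hC : Cod W G (δ * D)) : (deg G x : ℝ) - r * (δ * D) ≤ (G ∩ P2 r W Z x).card := by
  rw [mem_powersetCard] at hZ
  have h1 : G.filter (fun A => x ∈ A) ⊆ (G ∩ P2 r W Z x) ∪
      (Z.erase x).biUnion (fun z => G.filter (fun A => x ∈ A ∧ z ∈ A)) := by
    intro A hA
    rw [mem_filter] at hA
    by_cases h : ∃ z ∈ Z.erase x, z ∈ A
    · obtain ⟨z, hz, hzA⟩ := h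
      exact mem_union_right _ (mem_biUnion.2 ⟨z, hz, mem_filter.2 ⟨hA.1, hA.2, hzA⟩⟩)
    · apply mem_union_left
      rw [mem_inter]
      refine ⟨hA.1, mem_filter.2 ⟨hG hA.1, ?_⟩⟩
      ext z
      rw [mem_inter, mem_singleton]
      constructor
      · rintro ⟨h1, h2⟩
        by_contra h3
        exact h ⟨z, mem_erase.2 ⟨h3, h2⟩, h1⟩
      · rintro rfl
        exact ⟨hA.2, hx⟩
  have h2 : (deg G x : ℝ) ≤ (G ∩ P2 r W Z x).card + ∑ z ∈ Z.erase x, (codeg G x z : ℝ) := by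
    have := (card_le_card h1).trans ((card_union_le _ _).trans (Nat.add_le_add_left card_biUnion_le _))
    exact_mod_cast this
  have h3 : ∑ z ∈ Z.erase x, (codeg G x z : ℝ) ≤ r * (δ * D) := by
    refine (sum_le_card_nsmul _ _ (δ * D) (fun z hz => ?_)).trans ?_
    · rw [mem_erase] at hz
      exact hC x (hZ.1 hx) z (hZ.1 hz.2) (Ne.symm hz.1)
    · rw [nsmul_eq_mul]
      apply mul_le_mul_of_nonneg_right _ hδD
      rw [← hZ.2]
      exact_mod_cast card_le_card (erase_subset _ _)
  linarith

lemma sum_card_mem (V : Finset ℕ) (S : Finset (Finset ℕ)) (r : ℕ) (hS : ∀ A ∈ S, A.card ≤ r) :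
    ∑ y ∈ V, (S.filter (fun A => y ∈ A)).card ≤ r * S.card := by
  simp_rw [card_filter]
  rw [sum_comm, mul_comm]
  refine sum_le_card_nsmul _ _ _ fun A hA => ?_
  rw [← card_filter]
  exact (card_le_card (fun y hy => (mem_filter.1 hy).2)).trans (hS A hA)

open scoped Classical in
lemma nonnice (r n : ℕ) (hr : 0 < r) (hn : 2 * r ≤ n) (W : Finset ℕ) (hW : W.card = n) (D σ σ1 : ℝ)
    (hσ1 : 0 < σ1) (hσ : σ = σ1 ^ 2 / 2) (hrn : r ≤ σ * n)
    (Z : Finset ℕ) (hZ : Z ∈ powersetCard r W) (x : ℕ) (hx : x ∈ Z) (G : Finset (Finset ℕ))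
    (hs : (((powersetCard r (W \ Z)).filter (fun U => sm W D G Z U)).card : ℝ) ≤
      σ * (powersetCard r (W \ Z)).card) :
    (((W \ Z).filter (fun y => σ1 * (P2 r W Z x).card < (B2 r W D Z x y G).card)).card : ℝ) ≤
      σ1 * n := by
  rw [mem_powersetCard] at hZ
  set P := P2 r W Z x with hP
  set S := (powersetCard r (W \ Z)).filter (fun U => sm W D G Z U) with hS
  set N := (W \ Z).filter (fun y => σ1 * P.card < (B2 r W D Z x y G).card) with hN
  have hWZ : (W \ Z).card = n - r := by rw [card_sdiff_of_subset hZ.1, hW, hZ.2]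
  have hPr : ∀ A ∈ P, A.card ≤ r := fun A hA => ((mem_powersetCard.1 (mem_filter.1 hA).1).2).le
  have hPx : ∀ A ∈ P, x ∈ A ∧ A ∩ Z = {x} ∧ A ⊆ W ∧ A.card = r := by
    intro A hA
    have h1 := mem_filter.1 hA
    have h2 := mem_powersetCard.1 h1.1
    have hxA : x ∈ A ∩ Z := by rw [h1.2]; exact mem_singleton_self x
    exact ⟨(mem_inter.1 hxA).1, h1.2, h2⟩
  have hPc : (n - r).choose (r - 1) ≤ P.card := by
    rw [← hWZ, ← card_powersetCard]
    refine card_le_card_of_injOn (fun A => insert x A) ?_ ?_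
    · intro A hA
      have h := mem_powersetCard.1 (mem_coe.1 hA)
      have hxA : x ∉ A := fun h' => (mem_sdiff.1 (h.1 h')).2 hx
      refine mem_coe.2 (mem_filter.2 ⟨mem_powersetCard.2 ⟨?_, ?_⟩, ?_⟩)
      · exact insert_subset (hZ.1 hx) (h.1.trans sdiff_subset)
      · rw [card_insert_of_notMem hxA, h.2]; omega
      · ext z
        rw [mem_inter, mem_insert, mem_singleton]
        constructor
        · rintro ⟨h1 | h1, h2⟩
          · exact h1
          · exact absurd h2 (mem_sdiff.1 (h.1 h1)).2
        · rintro rfl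
          exact ⟨Or.inl rfl, hx⟩
    · intro A hA A' hA' he
      have h := mem_powersetCard.1 (mem_coe.1 hA)
      have h' := mem_powersetCard.1 (mem_coe.1 hA')
      have hxA : x ∉ A := fun h1 => (mem_sdiff.1 (h.1 h1)).2 hx
      have hxA' : x ∉ A' := fun h1 => (mem_sdiff.1 (h'.1 h1)).2 hx
      have he' : insert x A = insert x A' := he
      rw [← erase_insert hxA, he', erase_insert hxA']
  have hPpos : 0 < P.card := lt_of_lt_of_le (Nat.choose_pos (by omega)) hPc
  have hB : ∀ y ∈ W \ Z, (B2 r W D Z x y G).card ≤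
      (P.filter (fun A => y ∈ A)).card + (S.filter (fun U => y ∈ U)).card := by
    intro y hy
    rw [mem_sdiff] at hy
    have hxy : x ≠ y := fun h => hy.2 (h ▸ hx)
    have h1 : B2 r W D Z x y G ⊆ P.filter (fun A => y ∈ A) ∪
        P.filter (fun A => y ∉ A ∧ sm W D G Z (insert y (A.erase x))) := by
      intro A hA
      have h := mem_B2.1 hA
      rw [mem_union, mem_filter, mem_filter]
      by_cases hyA : y ∈ A
      · exact Or.inl ⟨h.1, hyA⟩
      · exact Or.inr ⟨h.1, hyA, h.2.resolve_left hyA⟩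
    refine (card_le_card h1).trans ((card_union_le _ _).trans (Nat.add_le_add_left ?_ _))
    refine card_le_card_of_injOn (fun A => insert y (A.erase x)) ?_ ?_
    · intro A hA
      obtain ⟨h1, h2, h3⟩ := mem_filter.1 (mem_coe.1 hA)
      obtain ⟨p1, p2, p3, p4⟩ := hPx A h1
      refine mem_coe.2 (mem_filter.2 ⟨mem_filter.2 ⟨mem_powersetCard.2 ⟨?_, ?_⟩, h3⟩,
        mem_insert_self _ _⟩)
      · intro z hz
        rcases mem_insert.1 hz with rfl | hz
        · exact mem_sdiff.2 hy
        · rw [mem_erase] at hz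
          refine mem_sdiff.2 ⟨p3 hz.2, fun hzZ => hz.1 ?_⟩
          have : z ∈ A ∩ Z := mem_inter.2 ⟨hz.2, hzZ⟩
          rwa [p2, mem_singleton] at this
      · rw [card_insert_of_notMem (fun h => h2 (mem_erase.1 h).2), card_erase_of_mem p1, p4]; omega
    · intro A hA A' hA' he
      obtain ⟨h1, h2, h3⟩ := mem_filter.1 (mem_coe.1 hA)
      obtain ⟨h1', h2', h3'⟩ := mem_filter.1 (mem_coe.1 hA')
      have he' : insert y (A.erase x) = insert y (A'.erase x) := he
      have e : A.erase x = A'.erase x := by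
        rw [← erase_insert (fun h => h2 (mem_erase.1 h).2 : y ∉ A.erase x), he',
          erase_insert (fun h => h2' (mem_erase.1 h).2 : y ∉ A'.erase x)]
      rw [← insert_erase (hPx A h1).1, e, insert_erase (hPx A' h1').1]
  have hsum : ∑ y ∈ W \ Z, (B2 r W D Z x y G).card ≤ r * P.card + r * S.card := by
    refine (sum_le_sum hB).trans ?_
    rw [sum_add_distrib]
    exact Nat.add_le_add (sum_card_mem _ _ _ hPr) (sum_card_mem _ _ _ (fun A hA =>
      ((mem_powersetCard.1 (mem_filter.1 hA).1).2).le))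
  have hlow : (N.card : ℝ) * (σ1 * P.card) ≤ r * P.card + r * S.card := by
    calc (N.card : ℝ) * (σ1 * P.card) = ∑ y ∈ N, σ1 * (P.card : ℝ) := by
          rw [sum_const, nsmul_eq_mul]
      _ ≤ ∑ y ∈ N, ((B2 r W D Z x y G).card : ℝ) := sum_le_sum (fun y hy => (mem_filter.1 hy).2.le)
      _ ≤ ∑ y ∈ W \ Z, ((B2 r W D Z x y G).card : ℝ) :=
          sum_le_sum_of_subset_of_nonneg (filter_subset _ _) (fun _ _ _ => Nat.cast_nonneg _)
      _ ≤ _ := by exact_mod_cast hsum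
  have hch : r * (n - r).choose r ≤ n * P.card := by
    obtain ⟨s, rfl⟩ : ∃ s, r = s + 1 := ⟨r - 1, by omega⟩
    have := Nat.choose_succ_right_eq (n - (s + 1)) s
    rw [mul_comm, this, mul_comm]
    exact Nat.mul_le_mul (by omega) hPc
  have hch' : (r : ℝ) * (n - r).choose r ≤ n * P.card := by exact_mod_cast hch
  rw [card_powersetCard, hWZ] at hs
  have hσ0 : 0 ≤ σ := by rw [hσ]; positivity
  have hPpos' : (0 : ℝ) < P.card := by exact_mod_cast hPpos
  have hr' : (0 : ℝ) ≤ r := Nat.cast_nonneg _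
  have h5 : (r : ℝ) * S.card ≤ σ * (n * P.card) := by
    have a := mul_le_mul_of_nonneg_left hs hr'
    have b := mul_le_mul_of_nonneg_left hch' hσ0
    linarith
  have h6 : ((N.card : ℝ) * σ1) * P.card ≤ (σ1 * n * σ1) * P.card := by
    have a := mul_le_mul_of_nonneg_right hrn hPpos'.le
    have : σ1 * n * σ1 = 2 * (σ * n) := by rw [hσ]; ring
    rw [this]
    linarith
  exact le_of_mul_le_mul_right (le_of_mul_le_mul_right h6 hPpos') hσ1


lemma card_biUnion_le_real {α β : Type*} [DecidableEq β] (s : Finset α) (t : α → Finset β) (c : α → ℝ)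
    (h : ∀ a ∈ s, ((t a).card : ℝ) ≤ c a) : ((s.biUnion t).card : ℝ) ≤ ∑ a ∈ s, c a := by
  have := card_biUnion_le (s := s) (t := t)
  calc ((s.biUnion t).card : ℝ) ≤ ((∑ a ∈ s, (t a).card : ℕ) : ℝ) := by exact_mod_cast this
    _ = ∑ a ∈ s, ((t a).card : ℝ) := by push_cast; rfl
    _ ≤ _ := sum_le_sum h

open scoped Classical in
lemma swap_induct (r n : ℕ) (W A0 : Finset ℕ) (hW : W.card = n) (hA0 : A0 ∈ powersetCard r W)
    (f : Finset ℕ → ℝ) (κ τ σ1 : ℝ) (hκ0 : 0 < κ) (hκ1 : κ ≤ 1) (hσ1 : 0 ≤ σ1)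
    (hτ : τ ≤ κ ^ (r - 1) * f A0) (hf0 : 0 ≤ f A0)
    (hstep : ∀ Z ∈ powersetCard r W, τ ≤ f Z → ∀ x ∈ Z,
      (((W \ Z).filter (fun y => f (insert y (Z.erase x)) < κ * f Z)).card : ℝ) ≤ σ1 * n)
    (j : ℕ) (hj : j ≤ r - 1) (X : Finset ℕ) (hX : X ⊆ A0) (hXc : X.card + j = r) :
    (((powersetCard j (W \ A0)).filter (fun Y => f (Y ∪ X) < κ ^ j * f A0)).card : ℝ) ≤
      j * σ1 * (n : ℝ) ^ j := by
  have hA := mem_powersetCard.1 hA0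
  induction j generalizing X with
  | zero =>
    have : X = A0 := eq_of_subset_of_card_le hX (by omega)
    subst this
    simp
  | succ j ih =>
    obtain ⟨x, hxA, hxX⟩ : ∃ x ∈ A0, x ∉ X := by
      by_contra h
      push Not at h
      have := card_le_card (show A0 ⊆ X from h)
      omega
    have hXc' : (insert x X).card + j = r := by rw [card_insert_of_notMem hxX]; omega
    have hih := ih (by omega) (insert x X) (insert_subset hxA hX) hXc'
    set X' := insert x X with hX'
    have hX'A : X' ⊆ A0 := insert_subset hxA hX
    set bad := (powersetCard j (W \ A0)).filter (fun Y => f (Y ∪ X') < κ ^ j * f A0) with hbad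
    obtain ⟨E, hE⟩ : ∃ E : Finset ℕ → Finset ℕ, ∀ Y, E Y = if Y ∈ bad then W \ A0 else
      (W \ (Y ∪ X')).filter (fun y => f (insert y ((Y ∪ X').erase x)) < κ * f (Y ∪ X')) :=
      ⟨_, fun _ => rfl⟩
    have hsub : (powersetCard (j + 1) (W \ A0)).filter (fun Y => f (Y ∪ X) < κ ^ (j + 1) * f A0) ⊆
        (powersetCard j (W \ A0)).biUnion (fun Y' => (E Y').image (fun y => insert y Y')) := by
      intro Y hY
      rw [mem_filter, mem_powersetCard] at hY
      obtain ⟨⟨y1, y2⟩, y3⟩ := hY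
      obtain ⟨y, hy⟩ := card_pos.1 (show 0 < Y.card by omega)
      rw [mem_biUnion]
      have hY' : Y.erase y ∈ powersetCard j (W \ A0) :=
        mem_powersetCard.2 ⟨(erase_subset _ _).trans y1, by rw [card_erase_of_mem hy]; omega⟩
      refine ⟨Y.erase y, hY', mem_image.2 ⟨y, ?_, insert_erase hy⟩⟩
      rw [hE]
      have hyWA := y1 hy
      split_ifs with hb
      · exact hyWA
      · rw [mem_sdiff] at hyWA
        have hg : κ ^ j * f A0 ≤ f (Y.erase y ∪ X') := by
          by_contra h
          exact hb (mem_filter.2 ⟨hY', not_le.1 h⟩)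
        rw [mem_filter]
        refine ⟨mem_sdiff.2 ⟨hyWA.1, ?_⟩, ?_⟩
        · rw [mem_union]
          rintro (h | h)
          · exact (mem_erase.1 h).1 rfl
          · exact hyWA.2 (hX'A h)
        · have e : insert y ((Y.erase y ∪ X').erase x) = Y ∪ X := by
            have hxY : x ∉ Y := fun h => (mem_sdiff.1 (y1 h)).2 hxA
            ext z
            simp only [hX', mem_insert, mem_erase, mem_union]
            by_cases hzy : z = y
            · subst hzy; simp [hy]
            · by_cases hzx : z = x
              · subst hzx; simp [hzy, hxY, hxX]
              · simp [hzy, hzx]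
          rw [e]
          calc f (Y ∪ X) < κ ^ (j + 1) * f A0 := y3
            _ = κ * (κ ^ j * f A0) := by ring
            _ ≤ _ := mul_le_mul_of_nonneg_left hg hκ0.le
    have hWn : ((W \ A0).card : ℝ) ≤ n := by
      rw [← hW]; exact_mod_cast card_le_card sdiff_subset
    have hEc : ∀ Y ∈ powersetCard j (W \ A0), (((E Y).image (fun y => insert y Y)).card : ℝ) ≤
        (if Y ∈ bad then (n : ℝ) else 0) + σ1 * n := by
      intro Y hY
      refine (Nat.cast_le.2 card_image_le).trans ?_
      have hsn : 0 ≤ σ1 * n := mul_nonneg hσ1 (Nat.cast_nonneg _)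
      rw [hE]
      split_ifs with hb
      · linarith
      · rw [zero_add]
        have hYm := mem_powersetCard.1 hY
        have hd : Disjoint Y X' := by
          rw [disjoint_left]
          intro z hz hz'
          exact (mem_sdiff.1 (hYm.1 hz)).2 (hX'A hz')
        apply hstep
        · rw [mem_powersetCard]
          refine ⟨union_subset (hYm.1.trans sdiff_subset) (hX'A.trans hA.1), ?_⟩
          rw [card_union_of_disjoint hd, hYm.2]; omega
        · have hg : κ ^ j * f A0 ≤ f (Y ∪ X') := by
            by_contra h
            exact hb (mem_filter.2 ⟨hY, not_le.1 h⟩)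
          refine hτ.trans (le_trans ?_ hg)
          exact mul_le_mul_of_nonneg_right (pow_le_pow_of_le_one hκ0.le hκ1 (by omega)) hf0
        · exact mem_union_right _ (mem_insert_self _ _)
    have h1 := card_biUnion_le_real _ _ _ hEc
    have h2 : (((powersetCard (j + 1) (W \ A0)).filter
        (fun Y => f (Y ∪ X) < κ ^ (j + 1) * f A0)).card : ℝ) ≤ _ :=
      (Nat.cast_le.2 (card_le_card hsub)).trans h1
    refine h2.trans ?_
    rw [sum_add_distrib, sum_const, nsmul_eq_mul, ← sum_filter, sum_const, nsmul_eq_mul]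
    have h3 : (((powersetCard j (W \ A0)).filter (fun Y => Y ∈ bad)).card : ℝ) ≤ j * σ1 * (n : ℝ) ^ j := by
      refine le_trans (Nat.cast_le.2 (card_le_card ?_)) hih
      intro Y hY
      exact (mem_filter.1 hY).2
    have h4 : ((powersetCard j (W \ A0)).card : ℝ) ≤ (n : ℝ) ^ j := by
      rw [card_powersetCard]
      have := Nat.choose_le_pow (W \ A0).card j
      calc (((W \ A0).card.choose j : ℕ) : ℝ) ≤ ((W \ A0).card : ℝ) ^ j := by exact_mod_cast this
        _ ≤ _ := pow_le_pow_left₀ (Nat.cast_nonneg _) hWn _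
    have hn0 : (0 : ℝ) ≤ n := Nat.cast_nonneg _
    have h5 := mul_le_mul_of_nonneg_right h3 hn0
    have h6 := mul_le_mul_of_nonneg_right h4 (mul_nonneg hσ1 hn0)
    push_cast
    rw [pow_succ]
    linarith

def P3 (r : ℕ) (W : Finset ℕ) (x : ℕ) : Finset (Finset ℕ) :=
  (powersetCard r W).filter (fun A => x ∈ A)

open scoped Classical in
noncomputable def B3 (r : ℕ) (W : Finset ℕ) (c : ℝ) (A0 : Finset ℕ) (x : ℕ)
    (G : Finset (Finset ℕ)) : Finset (Finset ℕ) :=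
  (P3 r W x).filter (fun A => (phiSub W G A : ℝ) < c * phiSub W G A0)

def Q3 (r : ℕ) (W : Finset ℕ) (c σ3 d0 : ℝ) (A0 : Finset ℕ) (x : ℕ)
    (G : Finset (Finset ℕ)) : Prop :=
  ((B3 r W c A0 x G).card : ℝ) ≤ σ3 * (P3 r W x).card ∧
    d0 ≤ ((G ∩ P3 r W x).card : ℝ) ∧
    2 * ((G ∩ P3 r W x) \ B3 r W c A0 x G).card < (G ∩ P3 r W x).card

open scoped Classical in
lemma Q3_prob (r : ℕ) (W : Finset ℕ) (c σ3 d0 a : ℝ) (ha : 0 ≤ a) (hσ0 : 0 ≤ σ3)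
    (hσ : 4 * σ3 ≤ Real.exp (-a)) (A0 : Finset ℕ) (x : ℕ) (hx : x ∈ A0) (m : ℕ) :
    (((powersetCard m (powersetCard r W)).filter (fun G => Q3 r W c σ3 d0 A0 x G)).card : ℝ) ≤
      Real.exp (-(a * d0 / 2)) * (powersetCard m (powersetCard r W)).card := by
  refine le_trans (le_of_eq ?_) (link_cond (powersetCard r W) (P3 r W x) (filter_subset _ _) m
    (B3 r W c A0 x) ?_ (fun G => filter_subset _ _) σ3 a d0 ha hσ0 hσ)
  · unfold Q3
    congr!
  · intro G
    have h : ∀ V, x ∈ V → phiSub W (G \ P3 r W x) V = phiSub W G V := by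
      intro V hV
      apply phiSub_sdiff_meets
      intro A hA h
      have h1 : x ∈ A ∩ V := mem_inter.2 ⟨(mem_filter.1 hA).2, hV⟩
      rw [h] at h1
      exact notMem_empty _ h1
    unfold B3
    refine filter_congr fun A hA => ?_
    rw [h A0 hx, h A (mem_filter.1 hA).2]

lemma Q3_det (r : ℕ) (hr : 0 < r) (W : Finset ℕ) (c σ3 d0 : ℝ) (hc : 0 ≤ c)
    (A0 : Finset ℕ) (x : ℕ) (hx : x ∈ W) (G : Finset (Finset ℕ)) (hG : G ⊆ powersetCard r W)
    (h1 : ((B3 r W c A0 x G).card : ℝ) ≤ σ3 * (P3 r W x).card)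
    (h2 : d0 ≤ deg G x) (hn : ¬ Q3 r W c σ3 d0 A0 x G) :
    d0 / 2 * (c * phiSub W G A0) ≤ pmCount W G := by
  classical
  have e : G ∩ P3 r W x = G.filter (fun A => x ∈ A) := by
    ext A
    rw [mem_inter, mem_filter, P3, mem_filter]
    constructor
    · tauto
    · rintro ⟨a, b⟩; exact ⟨a, hG a, b⟩
  have h2' : d0 ≤ ((G ∩ P3 r W x).card : ℝ) := by rw [e]; exact h2
  have h3 : (G ∩ P3 r W x).card ≤ 2 * ((G ∩ P3 r W x) \ B3 r W c A0 x G).card := by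
    by_contra h
    exact hn ⟨h1, h2', by omega⟩
  have h3' : ((G ∩ P3 r W x).card : ℝ) ≤ 2 * ((G ∩ P3 r W x) \ B3 r W c A0 x G).card := by
    exact_mod_cast h3
  rw [pmCount_vertex (edges_ok hr hG) hx, ← e]
  set S := (G ∩ P3 r W x) \ B3 r W c A0 x G with hS
  calc d0 / 2 * (c * phiSub W G A0) ≤ (S.card : ℝ) * (c * phiSub W G A0) := by
        apply mul_le_mul_of_nonneg_right _ (mul_nonneg hc (Nat.cast_nonneg _))
        linarith
    _ = ∑ A ∈ S, c * (phiSub W G A0 : ℝ) := by rw [sum_const, nsmul_eq_mul]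
    _ ≤ ∑ A ∈ S, (phiSub W G A : ℝ) := by
        refine sum_le_sum fun A hA => ?_
        rw [hS, mem_sdiff, mem_inter] at hA
        by_contra h
        exact hA.2 (by unfold B3; exact mem_filter.2 ⟨hA.1.2, not_le.1 h⟩)
    _ ≤ _ := sum_le_sum_of_subset_of_nonneg sdiff_subset (fun _ _ _ => Nat.cast_nonneg _)

lemma P3_card (r n : ℕ) (hr : 0 < r) (hn : 2 * r ≤ n) (W : Finset ℕ) (hW : W.card = n) (x : ℕ)
    (hx : x ∈ W) :
    (1 / (2 ^ (r - 1) * (r - 1).factorial) : ℝ) * (n : ℝ) ^ (r - 1) ≤ (P3 r W x).card := by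
  have h1 : (n - 1).choose (r - 1) ≤ (P3 r W x).card := by
    have hc : (W.erase x).card = n - 1 := by rw [card_erase_of_mem hx, hW]
    rw [← hc, ← card_powersetCard]
    have hA : ∀ A ∈ powersetCard (r - 1) (W.erase x), x ∉ A ∧ A ⊆ W ∧ A.card = r - 1 := by
      intro A hA
      have h := mem_powersetCard.1 hA
      exact ⟨fun h' => (mem_erase.1 (h.1 h')).1 rfl, h.1.trans (erase_subset _ _), h.2⟩
    refine card_le_card_of_injOn (fun A => insert x A) ?_ ?_
    · intro A hA'
      obtain ⟨a1, a2, a3⟩ := hA A (mem_coe.1 hA')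
      refine mem_coe.2 (mem_filter.2 ⟨mem_powersetCard.2 ⟨insert_subset hx a2, ?_⟩,
        mem_insert_self _ _⟩)
      rw [card_insert_of_notMem a1]; omega
    · intro A hA1 A' hA2 he
      have he' : insert x A = insert x A' := he
      rw [← erase_insert (hA A (mem_coe.1 hA1)).1, he', erase_insert (hA A' (mem_coe.1 hA2)).1]
  have h2 := Nat.pow_le_choose (α := ℝ) (r - 1) (n - 1)
  have h3 : ((n : ℝ) / 2) ^ (r - 1) ≤ ((n - 1 + 1 - (r - 1) : ℕ) : ℝ) ^ (r - 1) := by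
    apply pow_le_pow_left₀ (by positivity)
    rw [div_le_iff₀ (by norm_num)]
    exact_mod_cast (show n ≤ (n - 1 + 1 - (r - 1)) * 2 by omega)
  have h4 : ((n - 1).choose (r - 1) : ℝ) ≤ (P3 r W x).card := by exact_mod_cast h1
  refine le_trans ?_ h4
  refine le_trans ?_ h2
  rw [le_div_iff₀ (by positivity)]
  refine le_trans (le_of_eq ?_) h3
  field_simp
  rw [← mul_pow]
  congr 1
  ring

lemma B3_card (r n : ℕ) (hr : 2 ≤ r) (W A0 : Finset ℕ) (hW : W.card = n)
    (hA0 : A0 ∈ powersetCard r W) (x : ℕ) (hx : x ∈ A0) (G : Finset (Finset ℕ))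
    (c σ1 : ℝ) (hrn : r ≤ σ1 * n)
    (h : ∀ b : Finset (Finset ℕ), (∀ Y ∈ b, Y ∈ powersetCard (r - 1) (W \ A0) ∧ 
      (phiSub W G (Y ∪ {x}) : ℝ) < c * phiSub W G A0) →
      (b.card : ℝ) ≤ (r - 1 : ℕ) * σ1 * (n : ℝ) ^ (r - 1)) :
    ((B3 r W c A0 x G).card : ℝ) ≤ r * σ1 * (n : ℝ) ^ (r - 1) := by
  classical
  have hA := mem_powersetCard.1 hA0
  set b := ((B3 r W c A0 x G).filter (fun A => A ∩ A0 = {x})).image (fun A => A.erase x) with hb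
  have hB3 : ∀ A ∈ B3 r W c A0 x G, A ⊆ W ∧ A.card = r ∧ x ∈ A ∧
      (phiSub W G A : ℝ) < c * phiSub W G A0 := by
    intro A hA
    unfold B3 at hA
    have h1 := mem_filter.1 hA
    have h2 := mem_filter.1 h1.1
    have h3 := mem_powersetCard.1 h2.1
    exact ⟨h3.1, h3.2, h2.2, h1.2⟩
  have h1 := h b (by
    intro Y hY
    obtain ⟨A, hAm, rfl⟩ := mem_image.1 hY
    obtain ⟨a1, a2⟩ := mem_filter.1 hAm
    obtain ⟨b1, b2, b3, b4⟩ := hB3 A a1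
    constructor
    · rw [mem_powersetCard]
      refine ⟨?_, by rw [card_erase_of_mem b3, b2]⟩
      intro z hz
      rw [mem_erase] at hz
      refine mem_sdiff.2 ⟨b1 hz.2, fun hzA => hz.1 ?_⟩
      have : z ∈ A ∩ A0 := mem_inter.2 ⟨hz.2, hzA⟩
      rwa [a2, mem_singleton] at this
    · rw [union_comm, ← insert_eq, insert_erase b3]
      exact b4)
  have hsub : B3 r W c A0 x G ⊆ b.image (fun Y => insert x Y) ∪
      (A0.erase x).biUnion (fun z => (powersetCard (r - 2) W).image (fun Y => insert x (insert z Y))) := by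
    intro A hAm
    obtain ⟨b1, b2, b3, b4⟩ := hB3 A hAm
    rw [mem_union]
    by_cases hz : ∃ z ∈ A0.erase x, z ∈ A
    · right
      obtain ⟨z, hz, hzA⟩ := hz
      refine mem_biUnion.2 ⟨z, hz, mem_image.2 ⟨(A.erase x).erase z, ?_, ?_⟩⟩
      · have hz' : z ∈ A.erase x := mem_erase.2 ⟨(mem_erase.1 hz).1, hzA⟩
        refine mem_powersetCard.2 ⟨(erase_subset _ _).trans ((erase_subset _ _).trans b1), ?_⟩
        rw [card_erase_of_mem hz', card_erase_of_mem b3, b2]; omega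
      · have hz' : z ∈ A.erase x := mem_erase.2 ⟨(mem_erase.1 hz).1, hzA⟩
        rw [insert_erase hz', insert_erase b3]
    · left
      refine mem_image.2 ⟨A.erase x, mem_image.2 ⟨A, mem_filter.2 ⟨hAm, ?_⟩, rfl⟩, insert_erase b3⟩
      ext z
      rw [mem_inter, mem_singleton]
      constructor
      · rintro ⟨c1, c2⟩
        by_contra hne
        exact hz ⟨z, mem_erase.2 ⟨hne, c2⟩, c1⟩
      · rintro rfl
        exact ⟨b3, hx⟩
  have h2 : ((B3 r W c A0 x G).card : ℝ) ≤ b.card + (r * n ^ (r - 2) : ℕ) := by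
    have h3 : (B3 r W c A0 x G).card ≤ b.card + r * n ^ (r - 2) := by
      refine (card_le_card hsub).trans ((card_union_le _ _).trans (Nat.add_le_add card_image_le ?_))
      refine (card_biUnion_le_card_mul _ _ (n ^ (r - 2)) ?_).trans ?_
      · intro z _
        refine card_image_le.trans ?_
        rw [card_powersetCard, hW]
        exact Nat.choose_le_pow n (r - 2)
      · apply Nat.mul_le_mul_right
        rw [← hA.2]
        exact card_le_card (erase_subset _ _)
    exact_mod_cast h3
  obtain ⟨s, rfl⟩ : ∃ s, r = s + 2 := ⟨r - 2, by omega⟩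
  simp only [show s + 2 - 1 = s + 1 by omega, show s + 2 - 2 = s by omega] at *
  have h3 := mul_le_mul_of_nonneg_right hrn (show (0 : ℝ) ≤ (n : ℝ) ^ s by positivity)
  push_cast at *
  rw [pow_succ] at *
  nlinarith


lemma det_main (r l n : ℕ) (hr : 3 ≤ r) (hl : 1 ≤ l) (hn : n = r * (l + 1)) (W : Finset ℕ)
    (hW : W.card = n) (G : Finset (Finset ℕ)) (hG : G ⊆ powersetCard r W)
    (K D δ δ0 δa κ σ σ1 σ3 C : ℝ) (hK : 1 ≤ K) (hD : D = G.card / (l + 1 : ℝ)) (hD0 : 0 < D)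
    (hκ : κ = 1 / (1280 * K)) (hC : C = 2 * K / κ ^ (r - 1))
    (hσ1 : 0 < σ1) (hσ : σ = σ1 ^ 2 / 2) 
    (hσ3 : σ3 = r * σ1 / (1 / (2 ^ (r - 1) * (r - 1).factorial)))
    (hδp : 0 < δ) (hδ0 : 0 < δ0) (hδ1 : δ ≤ δ0 / 2) (hδ2 : r * δ ≤ 1 / (2 * K))
    (hrn : r ≤ σ * n) (hrn1 : r ≤ σ1 * n) 
    (hA : Adash r (l + 1) W G δa) (hCod : Cod W G (δ * D))
    (hdeg : ∀ x ∈ W, (deg G x : ℝ) ≤ K * D ∧ D / K ≤ deg G x)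
    (hlog : Real.log (l + 1) ≤ D) (hl1 : 2 * r * K ≤ l + 1) (hl2 : r + δa ≤ (δ0 - δa) * l)
    (hQ1 : ∀ Z ∈ powersetCard r W, ¬ Q1 r l W δ0 σ Z G)
    (hQ2 : ∀ Z ∈ powersetCard r W, ∀ x ∈ W, ∀ y ∈ W, ¬ Q2 r W D σ1 (D / (2 * K)) Z x y G)
    (hQ3 : ∀ Z ∈ powersetCard r W, ∀ x ∈ Z, ¬ Q3 r W (κ ^ (r - 1)) σ3 (D / K) Z x G)
    (A0 : Finset ℕ) (hA0 : A0 ∈ G) : (phiSub W G A0 : ℝ) ≤ C * pmCount W G / D := by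
  classical
  by_contra hcon
  push Not at hcon
  have hK0 : 0 < K := by linarith
  have hκ0 : 0 < κ := by rw [hκ]; positivity
  have hκ1 : κ ≤ 1 := by
    rw [hκ, div_le_one (by positivity)]; linarith
  have hκr : 0 < κ ^ (r - 1) := pow_pos hκ0 _
  have hn2 : 2 * r ≤ n := by rw [hn]; nlinarith
  have hΦ0 : (0 : ℝ) ≤ pmCount W G := Nat.cast_nonneg _
  have hA0r := hG hA0
  have hA0' := mem_powersetCard.1 hA0r
  have hcon' : C * pmCount W G < phiSub W G A0 * D := by rwa [div_lt_iff₀ hD0] at hcon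
  have hcon2 : 2 * K * pmCount W G < κ ^ (r - 1) * phiSub W G A0 * D := by
    have h := mul_lt_mul_of_pos_left hcon' hκr
    have e : κ ^ (r - 1) * (C * pmCount W G) = 2 * K * pmCount W G := by
      rw [hC]; field_simp
    rw [e] at h
    linarith
  have hτ : (pmCount W G : ℝ) / D ≤ κ ^ (r - 1) * phiSub W G A0 := by
    rw [div_le_iff₀ hD0]
    nlinarith
  have hδD : 0 ≤ δ * D := by positivity
  have hstep : ∀ Z ∈ powersetCard r W, (pmCount W G : ℝ) / D ≤ phiSub W G Z → ∀ x ∈ Z,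
      (((W \ Z).filter (fun y => (phiSub W G (insert y (Z.erase x)) : ℝ) < κ * phiSub W G Z)).card : ℝ)
        ≤ σ1 * n := by
    intro Z hZ hZφ x hx
    have hZ' := mem_powersetCard.1 hZ
    have h1 := Q1_det r l hl W Z (hW.trans hn) hZ G δ0 δa σ K D hδ0 hD hD0 hA
      (fun u hu v hv huv => (hCod u hu v hv huv).trans (mul_le_mul_of_nonneg_right hδ1 hD0.le))
      (fun u hu => (hdeg u hu).1) hZφ hlog hl1 hl2 (hQ1 Z hZ)
    have h2 := nonnice r n (by omega) hn2 W hW D σ σ1 hσ1 hσ hrn Z hZ x hx G h1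
    refine le_trans (Nat.cast_le.2 (card_le_card ?_)) h2
    intro y hy
    rw [mem_filter] at hy ⊢
    refine ⟨hy.1, ?_⟩
    by_contra hnice
    rw [not_lt] at hnice
    have hP2 : D / (2 * K) ≤ ((G ∩ P2 r W Z x).card : ℝ) := by
      refine le_trans ?_ (deg_P2 r W D δ hδD Z hZ x hx G hG hCod)
      have a := (hdeg x (hZ'.1 hx)).2
      have b := mul_le_mul_of_nonneg_right hδ2 hD0.le
      have e : D / K - 1 / (2 * K) * D = D / (2 * K) := by field_simp; ring
      linarith
    have h3 := Q2_det r (by omega) W D σ1 (D / (2 * K)) hD0.le Z hZ'.1 x y hx hy.1 G hG hnice hP2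
      (hQ2 Z hZ x (hZ'.1 hx) y (mem_sdiff.1 hy.1).1)
    have h4 : 320 * D * (phiSub W G (insert y (Z.erase x)) : ℝ) < 320 * D * (κ * phiSub W G Z) :=
      mul_lt_mul_of_pos_left hy.2 (by positivity)
    have e : 320 * D * (κ * phiSub W G Z) = D / (2 * K) / 2 * phiSub W G Z := by
      rw [hκ]; field_simp; ring
    linarith
  obtain ⟨x, hx⟩ := card_pos.1 (show 0 < A0.card by omega)
  have hB3 := B3_card r n (by omega) W A0 hW hA0r x hx G (κ ^ (r - 1)) σ1 hrn1 (by
    intro b hb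
    refine le_trans (Nat.cast_le.2 (card_le_card ?_)) (swap_induct r n W A0 hW hA0r
      (fun Y => (phiSub W G Y : ℝ)) κ (pmCount W G / D) σ1 hκ0 hκ1 hσ1.le hτ (Nat.cast_nonneg _)
      hstep (r - 1) le_rfl {x} (singleton_subset_iff.2 hx) (by rw [card_singleton]; omega))
    intro Y hY
    exact mem_filter.2 (hb Y hY))
  have hP3 := P3_card r n (by omega) hn2 W hW x (hA0'.1 hx)
  set cr : ℝ := 1 / (2 ^ (r - 1) * (r - 1).factorial) with hcr
  have hcr0 : 0 < cr := by rw [hcr]; positivity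
  have hfin := Q3_det r (by omega) W (κ ^ (r - 1)) σ3 (D / K) hκr.le A0 x (hA0'.1 hx) G hG (by
    refine hB3.trans ?_
    have : r * σ1 * (n : ℝ) ^ (r - 1) = σ3 * (cr * (n : ℝ) ^ (r - 1)) := by
      rw [hσ3]; field_simp
    rw [this]
    apply mul_le_mul_of_nonneg_left hP3
    rw [hσ3]; positivity) (hdeg x (hA0'.1 hx)).2 (hQ3 A0 hA0r x hx)
  have e : D / K / 2 * (κ ^ (r - 1) * phiSub W G A0) = 
      (κ ^ (r - 1) * phiSub W G A0 * D) / (2 * K) := by field_simp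
  rw [e, div_le_iff₀ (by positivity)] at hfin
  linarith


lemma card_biUnion_const {α β : Type*} [DecidableEq β] (s : Finset α) (t : α → Finset β) (N c : ℝ)
    (hc : 0 ≤ c) (hs : (s.card : ℝ) ≤ N) (h : ∀ a ∈ s, ((t a).card : ℝ) ≤ c) :
    ((s.biUnion t).card : ℝ) ≤ N * c := by
  refine (card_biUnion_le_real s t (fun _ => c) h).trans ?_
  rw [sum_const, nsmul_eq_mul]
  exact mul_le_mul_of_nonneg_right hs hc

open scoped Classical in
lemma union_bound {β : Type*} [DecidableEq β] (r n : ℕ) (W : Finset ℕ) (hW : W.card = n) (hn : 3 ≤ n)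
    (hrn : r ≤ n) (Gs : Finset β) (q : ℝ) (hq : 0 ≤ q) (bad : β → Prop)
    (F1 : Finset ℕ → β → Prop) (F2 : Finset ℕ → ℕ → ℕ → β → Prop) (F3 : Finset ℕ → ℕ → β → Prop)
    (h1 : ∀ Z ∈ powersetCard r W, ((Gs.filter (F1 Z)).card : ℝ) ≤ q * Gs.card)
    (h2 : ∀ Z ∈ powersetCard r W, ∀ x ∈ W, ∀ y ∈ W, ((Gs.filter (F2 Z x y)).card : ℝ) ≤ q * Gs.card)
    (h3 : ∀ Z ∈ powersetCard r W, ∀ x ∈ Z, ((Gs.filter (F3 Z x)).card : ℝ) ≤ q * Gs.card)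
    (h : ∀ G ∈ Gs, bad G → (∀ Z ∈ powersetCard r W, ¬ F1 Z G) →
      (∀ Z ∈ powersetCard r W, ∀ x ∈ W, ∀ y ∈ W, ¬ F2 Z x y G) →
      (∀ Z ∈ powersetCard r W, ∀ x ∈ Z, ¬ F3 Z x G) → False) :
    ((Gs.filter bad).card : ℝ) ≤ (n : ℝ) ^ (r + 3) * (q * Gs.card) := by
  set c := q * (Gs.card : ℝ) with hc
  have hc0 : 0 ≤ c := mul_nonneg hq (Nat.cast_nonneg _)
  have hn0 : (0 : ℝ) ≤ n := Nat.cast_nonneg _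
  have hΩ : ((powersetCard r W).card : ℝ) ≤ (n : ℝ) ^ r := by
    rw [card_powersetCard, hW]
    exact_mod_cast Nat.choose_le_pow n r
  have hWn : (W.card : ℝ) ≤ n := by rw [hW]
  have b1 := card_biUnion_const (powersetCard r W) (fun Z => Gs.filter (F1 Z)) _ c hc0 hΩ h1
  have b2 := card_biUnion_const (powersetCard r W) (fun Z => W.biUnion (fun x => W.biUnion
    (fun y => Gs.filter (F2 Z x y)))) _ (n * (n * c)) (by positivity) hΩ (fun Z hZ =>
      card_biUnion_const W _ _ _ (by positivity) hWn (fun x hx =>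
        card_biUnion_const W _ _ _ hc0 hWn (h2 Z hZ x hx)))
  have b3 := card_biUnion_const (powersetCard r W) (fun Z => Z.biUnion (fun x =>
    Gs.filter (F3 Z x))) _ (n * c) (by positivity) hΩ (fun Z hZ =>
      card_biUnion_const Z _ _ _ hc0 (by rw [(mem_powersetCard.1 hZ).2]; exact_mod_cast hrn) (h3 Z hZ))
  set U1 := (powersetCard r W).biUnion (fun Z => Gs.filter (F1 Z)) with hU1
  set U2 := (powersetCard r W).biUnion (fun Z => W.biUnion (fun x => W.biUnion
    (fun y => Gs.filter (F2 Z x y)))) with hU2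
  set U3 := (powersetCard r W).biUnion (fun Z => Z.biUnion (fun x => Gs.filter (F3 Z x))) with hU3
  have hsub : Gs.filter bad ⊆ U1 ∪ U2 ∪ U3 := by
    intro G hG
    rw [mem_filter] at hG
    by_contra hnot
    rw [mem_union, mem_union] at hnot
    push Not at hnot
    obtain ⟨⟨n1, n2⟩, n3⟩ := hnot
    refine h G hG.1 hG.2 ?_ ?_ ?_
    · intro Z hZ hF
      exact n1 (mem_biUnion.2 ⟨Z, hZ, mem_filter.2 ⟨hG.1, hF⟩⟩)
    · intro Z hZ x hx y hy hF
      exact n2 (mem_biUnion.2 ⟨Z, hZ, mem_biUnion.2 ⟨x, hx, mem_biUnion.2 ⟨y, hy,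
        mem_filter.2 ⟨hG.1, hF⟩⟩⟩⟩)
    · intro Z hZ x hx hF
      exact n3 (mem_biUnion.2 ⟨Z, hZ, mem_biUnion.2 ⟨x, hx, mem_filter.2 ⟨hG.1, hF⟩⟩⟩)
  have hcard : ((Gs.filter bad).card : ℝ) ≤ U1.card + U2.card + U3.card := by
    have := (card_le_card hsub).trans ((card_union_le _ _).trans
      (Nat.add_le_add_right (card_union_le _ _) _))
    exact_mod_cast this
  have hn3 : (3 : ℝ) ≤ n := by exact_mod_cast hn
  have e : (n : ℝ) ^ (r + 3) * c = (n : ℝ) ^ r * c * n ^ 3 := by ring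
  have hX : 0 ≤ (n : ℝ) ^ r * c := by positivity
  set X := (n : ℝ) ^ r * c with hXd
  have e2 : (n : ℝ) ^ r * (n * (n * c)) = X * n ^ 2 := by rw [hXd]; ring
  have e3 : (n : ℝ) ^ r * (n * c) = X * n := by rw [hXd]; ring
  rw [e2] at b2
  rw [e3] at b3
  rw [e]
  have p : (1 : ℝ) + n ^ 2 + n ≤ n ^ 3 := by nlinarith [sq_nonneg ((n : ℝ) - 3)]
  have := mul_le_mul_of_nonneg_left p hX
  linarith

set_option maxHeartbeats 2000000 in
open scoped Classical in
theorem lemma_B (r : ℕ) (hr : 3 ≤ r) (ε : ℝ) (hε : 0 < ε) (K : ℝ) (hK : 1 ≤ K)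
    (δ : ℕ → ℝ) (hδpos : ∀ n, 0 < δ n)
    (hδ : Filter.Tendsto δ Filter.atTop (nhds 0)) :
    ∃ C : ℝ, 0 < C ∧ ∀ k : ℝ, 0 < k → ∃ n₀ : ℕ, ∀ n : ℕ, n₀ ≤ n → r ∣ n →
      ∀ m : ℕ, (1 + ε) * ((n : ℝ) / r) * Real.log n < m → m ≤ n.choose r →
      (((Finset.powersetCard m (Kn n r)).filter
          (fun H => propA r n H (δ n) ∧ propR r (Finset.range n) H (δ n) K ∧
            ¬propB r (Finset.range n) H C)).card : ℝ) /
        ((Finset.powersetCard m (Kn n r)).card : ℝ) ≤ (n : ℝ) ^ (-k) := by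
  have hK0 : 0 < K := by linarith
  have hr0 : (0 : ℝ) < r := by exact_mod_cast (show 0 < r by omega)
  obtain ⟨κ, hκ⟩ : ∃ κ : ℝ, κ = 1 / (1280 * K) := ⟨_, rfl⟩
  have hκ0 : 0 < κ := by rw [hκ]; positivity
  obtain ⟨C, hC⟩ : ∃ C : ℝ, C = 2 * K / κ ^ (r - 1) := ⟨_, rfl⟩
  refine ⟨C, by rw [hC]; positivity, fun k hk => ?_⟩
  obtain ⟨k', hk'⟩ : ∃ k' : ℝ, k' = k + (r + 3 : ℕ) := ⟨_, rfl⟩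
  have hk'0 : 0 < k' := by rw [hk']; positivity
  obtain ⟨a, ha⟩ : ∃ a : ℝ, a = 4 * K * k' := ⟨_, rfl⟩
  have ha0 : 0 ≤ a := by rw [ha]; positivity
  obtain ⟨cr, hcr⟩ : ∃ cr : ℝ, cr = 1 / (2 ^ (r - 1) * (r - 1).factorial) := ⟨_, rfl⟩
  have hcr0 : 0 < cr := by rw [hcr]; positivity
  have hcr1 : cr ≤ 1 := by
    rw [hcr, div_le_one (by positivity)]
    have h1 : (1 : ℝ) ≤ 2 ^ (r - 1) := one_le_pow₀ (by norm_num)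
    have h2 : (1 : ℝ) ≤ (r - 1).factorial := by exact_mod_cast Nat.factorial_pos (r - 1)
    nlinarith
  obtain ⟨σ1, hσ1⟩ : ∃ σ1 : ℝ, σ1 = cr * Real.exp (-a) / (4 * r) := ⟨_, rfl⟩
  have hσ10 : 0 < σ1 := by rw [hσ1]; positivity
  obtain ⟨σ3, hσ3⟩ : ∃ σ3 : ℝ, σ3 = r * σ1 / cr := ⟨_, rfl⟩
  have hσ30 : 0 < σ3 := by rw [hσ3]; positivity
  have hσ34 : 4 * σ3 ≤ Real.exp (-a) := by
    rw [hσ3, hσ1]; apply le_of_eq; field_simp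
  have hσ14 : 4 * σ1 ≤ Real.exp (-a) := by
    refine le_trans ?_ hσ34
    have : σ1 ≤ σ3 := by
      rw [hσ3, le_div_iff₀ hcr0]
      have : (1 : ℝ) ≤ r := by exact_mod_cast (show 1 ≤ r by omega)
      nlinarith
    linarith
  obtain ⟨σ, hσ⟩ : ∃ σ : ℝ, σ = σ1 ^ 2 / 2 := ⟨_, rfl⟩
  have hσ0 : 0 < σ := by rw [hσ]; positivity
  obtain ⟨δ0, hδ0, ℓ0, hF⟩ := PropF r (by omega) σ hσ0 (2 * k') (by positivity)
  -- smallness of δ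
  obtain ⟨n1, hn1⟩ : ∃ n1 : ℕ, ∀ n ≥ n1, δ n ≤ min (min 1 (δ0 / (2 * r))) (1 / (2 * K * r)) := by
    have := hδ.eventually_le_const (show (0 : ℝ) < min (min 1 (δ0 / (2 * r))) (1 / (2 * K * r)) by
      positivity)
    exact Filter.eventually_atTop.1 this
  -- largeness of l
  obtain ⟨L, hL⟩ := exists_nat_ge (2 * r * K + 4 * r / δ0 + r / σ1 + r / σ + Real.exp (Real.exp (2 * r)))
  refine ⟨n1 + r * (L + ℓ0 + 2 * r + 3 + 1), fun n hn hdvd m hm _ => ?_⟩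
  obtain ⟨q', hq'⟩ := hdvd
  have hq'1 : L + ℓ0 + 2 * r + 3 + 1 ≤ q' := by
    by_contra h
    push Not at h
    have := Nat.mul_lt_mul_of_pos_left h (show 0 < r by omega)
    omega
  obtain ⟨l, rfl⟩ : ∃ l, q' = l + 1 := ⟨q' - 1, by omega⟩
  have hlL : L + ℓ0 + 2 * r + 3 ≤ l := by omega
  have hln : l + 1 ≤ n := by rw [hq']; exact Nat.le_mul_of_pos_left _ (by omega)
  have hlL' : (L : ℝ) ≤ l := by exact_mod_cast (show L ≤ l by omega)
  have hl0 : (0 : ℝ) < l := by exact_mod_cast (show 0 < l by omega)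
  have hn' : (n : ℝ) = r * (l + 1) := by rw [hq']; push_cast; ring
  have hln' : (l : ℝ) + 1 ≤ n := by exact_mod_cast hln
  have t1 : 0 ≤ 2 * r * K := by positivity
  have t2 : 0 ≤ 4 * r / δ0 := by positivity
  have t3 : 0 ≤ r / σ1 := by positivity
  have t4 : 0 ≤ r / σ := by positivity
  have t5 := Real.exp_pos (Real.exp (2 * r))
  have L1 : 2 * r * K ≤ l := by linarith
  have L2 : 4 * r / δ0 ≤ l := by linarith
  have L3 : r / σ1 ≤ n := by linarith
  have L4 : r / σ ≤ n := by linarith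
  have L5 : Real.exp (Real.exp (2 * r)) ≤ n := by linarith
  have hδn := hn1 n (by omega)
  have d1 : δ n ≤ 1 := hδn.trans ((min_le_left _ _).trans (min_le_left _ _))
  have d2 : δ n ≤ δ0 / (2 * r) := hδn.trans ((min_le_left _ _).trans (min_le_right _ _))
  have d3 : δ n ≤ 1 / (2 * K * r) := hδn.trans (min_le_right _ _)
  have hδp := hδpos n
  have d2' : r * δ n ≤ δ0 / 2 := by
    rw [le_div_iff₀ (by positivity)] at d2; linarith
  have d3' : r * δ n ≤ 1 / (2 * K) := by
    rw [le_div_iff₀ (by positivity)] at d3 ⊢; linarith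
  have hr1 : (1 : ℝ) ≤ r := by exact_mod_cast (show 1 ≤ r by omega)
  have d2'' : δ n ≤ δ0 / 2 := (le_mul_of_one_le_left hδp.le hr1).trans d2'
  have hnpos : (0 : ℝ) < n := by linarith
  have hlogn : Real.exp (2 * r) ≤ Real.log n := (Real.le_log_iff_exp_le hnpos).2 L5
  have hlogn0 : 0 < Real.log n := lt_of_lt_of_le (Real.exp_pos _) hlogn
  obtain ⟨D, hD⟩ : ∃ D : ℝ, D = m / (l + 1 : ℝ) := ⟨_, rfl⟩
  have hDlog : Real.log n ≤ D := by
    rw [hD, le_div_iff₀ (by positivity)]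
    have e : (n : ℝ) / r = l + 1 := by rw [hn']; field_simp
    rw [e] at hm
    have h1 : 0 < ε * ((l + 1) * Real.log n) := by positivity
    have h2 : (1 + ε) * ((l : ℝ) + 1) * Real.log n =
      Real.log n * (l + 1) + ε * ((l + 1) * Real.log n) := by ring
    linarith only [h1, h2, hm]
  have hD0 : 0 < D := hlogn0.trans_le hDlog
  obtain ⟨q, hq⟩ : ∃ q : ℝ, q = Real.exp (-(k' * Real.log n)) := ⟨_, rfl⟩
  have hq0 : 0 < q := by rw [hq]; exact Real.exp_pos _
  have hWc : (range n).card = n := card_range n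
  have hKn : Kn n r = powersetCard r (range n) := rfl
  rw [hKn]
  have H1 : ∀ Z ∈ powersetCard r (range n), (((powersetCard m (powersetCard r (range n))).filter
      (fun G => Q1 r l (range n) δ0 σ Z G)).card : ℝ) ≤ q * (powersetCard m (powersetCard r (range n))).card := by
    intro Z hZ
    refine (Q1_prob r l δ0 σ (Real.exp (-(2 * k' * Real.log l))) (Real.exp_pos _).le
      (hF l (by omega)) (range n) Z (hWc.trans hq') hZ m).trans ?_
    refine mul_le_mul_of_nonneg_right ?_ (Nat.cast_nonneg _)
    rw [hq]
    apply Real.exp_le_exp.2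
    have : Real.log n ≤ 2 * Real.log l := by
      have h2 : (2 : ℝ) * Real.log l = Real.log ((l : ℝ) ^ 2) := by rw [Real.log_pow]; norm_num
      rw [h2]
      apply Real.log_le_log hnpos
      have h3 : n ≤ l ^ 2 := by
        rw [hq']
        have h5 : 2 * r ≤ l := by omega
        have h6 : 2 * r * l ≤ l * l := Nat.mul_le_mul_right l h5
        have h7 : r * 1 ≤ r * l := Nat.mul_le_mul_left r (by omega)
        have h8 : r * (l + 1) = r * l + r * 1 := by ring
        have h9 : 2 * r * l = r * l + r * l := by ring
        rw [h8, pow_two]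
        omega
      exact_mod_cast h3
    have h4 := mul_le_mul_of_nonneg_left this hk'0.le
    linarith only [h4]
  have H2 : ∀ Z ∈ powersetCard r (range n), ∀ x ∈ range n, ∀ y ∈ range n, (((powersetCard m (powersetCard r (range n))).filter
      (fun G => Q2 r (range n) D σ1 (D / (2 * K)) Z x y G)).card : ℝ) ≤ q * (powersetCard m (powersetCard r (range n))).card := by
    intro Z hZ x hx y hy
    refine (Q2_prob r (range n) D σ1 (D / (2 * K)) a ha0 hσ10.le hσ14 Z x y m).trans ?_
    refine mul_le_mul_of_nonneg_right ?_ (Nat.cast_nonneg _)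
    rw [hq]
    apply Real.exp_le_exp.2
    have e : a * (D / (2 * K)) / 2 = k' * D := by rw [ha]; field_simp; ring
    rw [e]
    exact neg_le_neg (mul_le_mul_of_nonneg_left hDlog hk'0.le)
  have H3 : ∀ Z ∈ powersetCard r (range n), ∀ x ∈ Z, (((powersetCard m (powersetCard r (range n))).filter
      (fun G => Q3 r (range n) (κ ^ (r - 1)) σ3 (D / K) Z x G)).card : ℝ) ≤ q * (powersetCard m (powersetCard r (range n))).card := by
    intro Z hZ x hx
    refine (Q3_prob r (range n) (κ ^ (r - 1)) σ3 (D / K) a ha0 hσ30.le hσ34 Z x hx m).trans ?_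
    refine mul_le_mul_of_nonneg_right ?_ (Nat.cast_nonneg _)
    rw [hq]
    apply Real.exp_le_exp.2
    have e : a * (D / K) / 2 = 2 * (k' * D) := by rw [ha]; field_simp; ring
    rw [e]
    have h1 := mul_le_mul_of_nonneg_left hDlog hk'0.le
    have h2 := mul_pos hk'0 hD0
    linarith only [h1, h2]
  have H4 : ∀ G ∈ (powersetCard m (powersetCard r (range n))), (propA r n G (δ n) ∧ propR r (Finset.range n) G (δ n) K ∧
            ¬propB r (Finset.range n) G C) → (∀ Z ∈ powersetCard r (range n), ¬ Q1 r l (range n) δ0 σ Z G) →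
      (∀ Z ∈ powersetCard r (range n), ∀ x ∈ range n, ∀ y ∈ range n,
        ¬ Q2 r (range n) D σ1 (D / (2 * K)) Z x y G) →
      (∀ Z ∈ powersetCard r (range n), ∀ x ∈ Z,
        ¬ Q3 r (range n) (κ ^ (r - 1)) σ3 (D / K) Z x G) → False := by
    intro G hG hbad hQ1 hQ2 hQ3
    obtain ⟨hGA, hGR, hGB⟩ := hbad
    apply hGB
    have hGm := mem_powersetCard.1 hG
    have hGs : G ⊆ powersetCard r (range n) := hGm.1
    have hD' : D = G.card / (l + 1 : ℝ) := by rw [hGm.2]; exact hD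
    have hav : avgDeg r (range n) G = D := by
      unfold avgDeg
      rw [hWc, hn', hD']
      field_simp
    obtain ⟨-, hR2, hR3⟩ := hGR
    rw [hav] at hR2 hR3
    have hAd : Adash r (l + 1) (range n) G (r * δ n) := by
      have hmc : Real.exp (2 * r) * (l + 1 : ℕ) ≤ G.card := by
        have h1 := hlogn.trans hDlog
        rw [hD', le_div_iff₀ (by positivity)] at h1
        push_cast
        exact h1
      rw [hq'] at hGs hGA ⊢
      rw [hq'] at d1
      exact propA_Adash r (by omega) (l + 1) (by omega) G hGs _ d1 hmc hGA
    intro A0 hA0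
    rw [hav]
    refine det_main r l n hr (by omega) hq' (range n) hWc G hGs K D (δ n) δ0 (r * δ n) κ σ σ1 σ3 C
      hK hD' hD0 hκ hC hσ10 hσ (by rw [hσ3, hcr]) hδp hδ0 d2'' d3' ?_ ?_ hAd hR3 hR2 ?_ ?_ ?_
      hQ1 hQ2 hQ3 A0 hA0
    · rwa [div_le_iff₀ hσ0, mul_comm] at L4
    · rwa [div_le_iff₀ hσ10, mul_comm] at L3
    · exact (Real.log_le_log (by linarith) hln').trans hDlog
    · linarith
    · rw [div_le_iff₀ hδ0] at L2
      have h1 : r * δ n ≤ r := mul_le_of_le_one_right hr0.le d1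
      have h2 := mul_le_mul_of_nonneg_right (show δ0 / 2 ≤ δ0 - r * δ n by linarith) hl0.le
      linarith
  have main := union_bound r n (range n) hWc (by omega)
    (by rw [hq']; exact Nat.le_mul_of_pos_right _ (by omega))
    (powersetCard m (powersetCard r (range n))) q hq0.le _ _ _ _ H1 H2 H3 H4
  rcases Nat.eq_zero_or_pos (powersetCard m (powersetCard r (range n))).card with h0 | h0
  · rw [h0, Nat.cast_zero, div_zero]
    positivity
  · have h0' : (0 : ℝ) < (powersetCard m (powersetCard r (range n))).card := by exact_mod_cast h0
    rw [div_le_iff₀ h0']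
    refine le_trans (le_of_eq ?_) (main.trans (le_of_eq ?_))
    · congr!
    · rw [← mul_assoc]
      congr 1
      rw [hq, Real.rpow_def_of_pos hnpos, hk', ← Real.exp_log hnpos, ← Real.exp_nat_mul, ← Real.exp_add,
        Real.log_exp]
      congr 1
      push_cast
      ring
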